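/- Proposition (the first return map is Markov). For every f ∈ Bimod, the first return map T⁰ of f to 𝕀 is a Markov map of Int(𝕀). -/

import Mathlib

open MeasureTheory Set Filter
open scoped ENNReal

noncomputable section

/-- Iterated fractional parts in the continued fraction algorithm:
`cfFrac ρ 0 = ρ - ⌊ρ⌋` and `cfFrac ρ (k+1) = 1/(cfFrac ρ k) - ⌊1/(cfFrac ρ k)⌋`. -/
noncomputable def cfFrac (ρ : ℝ) : ℕ → ℝ
  | 0 => Int.fract ρ
  | n + 1 => Int.fract (1 / cfFrac ρ n)

/-- Partial quotients `a_k` of the continued fraction expansion of `ρ`. -/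
noncomputable def cfA (ρ : ℝ) : ℕ → ℤ
  | 0 => ⌊ρ⌋
  | n + 1 => ⌊1 / cfFrac ρ n⌋

/-- Denominators `q_k` of the convergents of `ρ`:
`q_0 = 1`, `q_1 = a_1` (since `q_{-1} = 0`), `q_{k+1} = a_{k+1} q_k + q_{k-1}`. -/
noncomputable def cfQ (ρ : ℝ) : ℕ → ℕ
  | 0 => 1
  | 1 => (cfA ρ 1).toNat
  | n + 2 => (cfA ρ (n + 2)).toNat * cfQ ρ (n + 1) + cfQ ρ n
/-- The class `Bimod` of degree one bimodal circle endomorphisms, given by the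
circle map `f : 𝕋¹ → 𝕋¹` together with a lift `F : ℝ → ℝ` (`π ∘ F = f ∘ π`,
`F(x+1) = F(x)+1`), satisfying (A1) (`C²`, bimodal with non-flat critical points
`c̃⁺ < c̃⁻` of orders `ℓ⁺, ℓ⁻`), (A2) (the rotation numbers of the upper and lower
maps `F₊, F₋` are irrational) and (A3) (all periodic orbits are hyperbolic repelling). -/
structure BimodData where
  /-- the lift -/
  F : ℝ → ℝ
  /-- the circle endomorphism -/
  f : UnitAddCircle → UnitAddCircle
  /-- lift of the critical point `c⁺` -/
  ctp : ℝ
  /-- lift of the critical point `c⁻` -/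
  ctm : ℝ
  /-- `d̃⁺`, the second preimage of the critical value of `c⁺` -/
  dtp : ℝ
  /-- `d̃⁻`, the second preimage of the critical value of `c⁻` -/
  dtm : ℝ
  /-- the non-flatness order `ℓ⁺` -/
  lp : ℝ
  /-- the non-flatness order `ℓ⁻` -/
  lm : ℝ
  /-- the upper map `F₊` (a monotone degree one lift) -/
  Fp : CircleDeg1Lift
  /-- the lower map `F₋` (a monotone degree one lift) -/
  Fm : CircleDeg1Lift
  /-- the diffeomorphism `ψ⁺` -/
  psip : ℝ → ℝ
  /-- the diffeomorphism `ψ⁻` -/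
  psim : ℝ → ℝ
  hf : ∀ x : ℝ, f ((x : ℝ) : UnitAddCircle) = ((F x : ℝ) : UnitAddCircle)
  h0 : 0 < ctp
  h1 : ctp < ctm
  h2 : ctm < 1
  hlift : ∀ x, F (x + 1) = F x + 1
  hC2 : ContDiff ℝ 2 F
  hdecr : ∀ x ∈ Set.Ioo ctp ctm, deriv F x < 0
  hincr : ∀ x ∈ Set.Ioo ctm (ctp + 1), 0 < deriv F x
  hlp : 1 < lp
  hlm : 1 < lm
  hpsipC2 : ContDiff ℝ 2 psip
  hpsipBij : Function.Bijective psip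
  hpsipD : ∀ x, deriv psip x ≠ 0
  hpsip0 : psip ctp = 0
  hpsipEq : ∀ᶠ x in nhds ctp, F x = F ctp - |psip x| ^ lp
  hpsimC2 : ContDiff ℝ 2 psim
  hpsimBij : Function.Bijective psim
  hpsimD : ∀ x, deriv psim x ≠ 0
  hpsim0 : psim ctm = 0
  hpsimEq : ∀ᶠ x in nhds ctm, F x = F ctm + |psim x| ^ lm
  hdtp : dtp ∈ Set.Ioo ctm (ctp + 1)
  hdtpF : F dtp = F ctp
  hFp1 : ∀ x ∈ Set.Icc ctp dtp, Fp x = F ctp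
  hFp2 : ∀ x ∈ Set.Icc dtp (ctp + 1), Fp x = F x
  hdtm : dtm ∈ Set.Ioo (ctm - 1) ctp
  hdtmF : F dtm = F ctm
  hFm1 : ∀ x ∈ Set.Icc dtm ctm, Fm x = F ctm
  hFm2 : ∀ x ∈ Set.Icc ctm (dtm + 1), Fm x = F x
  hirrp : Irrational Fp.translationNumber
  hirrm : Irrational Fm.translationNumber
  hA3 : ∀ (x : ℝ) (n : ℕ), 1 ≤ n → (∃ m : ℤ, F^[n] x = x + (m : ℝ)) →
    1 < |deriv (F^[n]) x|

namespace BimodData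

/-- The critical point `c⁺ = π(c̃⁺)`. -/
noncomputable def cp (B : BimodData) : UnitAddCircle := ((B.ctp : ℝ) : UnitAddCircle)

/-- The critical point `c⁻ = π(c̃⁻)`. -/
noncomputable def cm (B : BimodData) : UnitAddCircle := ((B.ctm : ℝ) : UnitAddCircle)

/-- The interval `𝕀 = π([c̃⁺, c̃⁻])` on which `f` is decreasing. -/
def II (B : BimodData) : Set UnitAddCircle :=
  (fun x : ℝ => ((x : ℝ) : UnitAddCircle)) '' Set.Icc B.ctp B.ctm

/-- The upper rotation number `ρ⁺`. -/
noncomputable def rhop (B : BimodData) : ℝ := B.Fp.translationNumber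

/-- The lower rotation number `ρ⁻`. -/
noncomputable def rhom (B : BimodData) : ℝ := B.Fm.translationNumber

/-- Condition (C⁻): `Σ_{k≥0} q⁻_{2k+1} · d(f^{q⁻_{2k}}(c⁻), c⁻) < ∞`. -/
def CondCm (B : BimodData) : Prop :=
  Summable fun k : ℕ =>
    (cfQ B.rhom (2 * k + 1) : ℝ) * dist (B.f^[cfQ B.rhom (2 * k)] B.cm) B.cm

/-- Condition (C⁺): `Σ_{k≥1} q⁺_{2k} · d(f^{q⁺_{2k-1}}(c⁺), c⁺) < ∞`. -/
def CondCp (B : BimodData) : Prop :=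
  Summable fun k : ℕ =>
    (cfQ B.rhop (2 * k + 2) : ℝ) * dist (B.f^[cfQ B.rhop (2 * k + 1)] B.cp) B.cp

end BimodData

/-- The set of times `n ≥ 1` at which the orbit of `x` lies in `𝕀`. -/
def BimodData.returnSet (B : BimodData) (x : UnitAddCircle) : Set ℕ :=
  {n : ℕ | 1 ≤ n ∧ B.f^[n] x ∈ B.II}

/-- The first entry time `N⁰(x)` to `𝕀` (equal to `0` when the orbit of `x`
never enters `𝕀`). -/
noncomputable def BimodData.N0 (B : BimodData) (x : UnitAddCircle) : ℕ :=
  sInf (B.returnSet x)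

/-- The first entry map `T⁰(x) = f^{N⁰(x)}(x)` to `𝕀` (the first return map on `𝕀`). -/
noncomputable def BimodData.T0 (B : BimodData) (x : UnitAddCircle) : UnitAddCircle :=
  B.f^[B.N0 x] x

/-- A map `g` of the circle has derivative `d` at `x` if some local lift of `g`
through a lift of `x` has derivative `d` there. -/
def HasCircleDerivAt (g : UnitAddCircle → UnitAddCircle) (x : UnitAddCircle) (d : ℝ) : Prop :=
  ∃ (G : ℝ → ℝ) (x0 : ℝ), ((x0 : ℝ) : UnitAddCircle) = x ∧
    (∀ᶠ y in nhds x0, ((G y : ℝ) : UnitAddCircle) = g ((y : ℝ) : UnitAddCircle)) ∧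
    HasDerivAt G d x0

/-- `T` is a Markov map of the (open interval) subset `U` of the circle: there are a
countable family `𝒩` of pairwise disjoint intervals in `U` covering `U` up to Lebesgue
measure zero, on the interior of each of which `T` is a `C¹` diffeomorphism onto `U`
(with derivative `D`), with the uniform bounded distortion property (iii) for all chains
of intervals following the partition. -/
def IsMarkovMap (T : UnitAddCircle → UnitAddCircle) (U : Set UnitAddCircle) : Prop :=
  ∃ (N : Set (Set UnitAddCircle)) (D : UnitAddCircle → ℝ),
    N.Countable ∧
    (∀ I ∈ N, IsPreconnected I ∧ I ⊆ U) ∧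
    N.Pairwise Disjoint ∧
    volume (U \ ⋃₀ N) = 0 ∧
    (∀ I ∈ N, Set.BijOn T (interior I) U ∧
      ∀ x ∈ interior I, HasCircleDerivAt T x (D x) ∧ D x ≠ 0 ∧
        ContinuousWithinAt D (interior I) x) ∧
    ∃ D₀ > (0 : ℝ), ∀ n : ℕ, ∀ J : Set UnitAddCircle, IsPreconnected J → J ⊆ U →
      (∀ j, 1 ≤ j → j ≤ n → ∃ I ∈ N, T^[j] '' J ⊆ I) →
      ∀ x ∈ J, ∀ y ∈ J,
        (∏ k ∈ Finset.range n, D (T^[k] x)) / (∏ k ∈ Finset.range n, D (T^[k] y))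
          ≤ 1 + D₀ * dist (T^[n] y) (T^[n] x)

/-- The logarithm of the one-sided cross-ratio distortion of `h` at `x, y, d`. -/
def crossLog (h : ℝ → ℝ) (x y d : ℝ) : ℝ :=
  Real.log (deriv h y) - Real.log (deriv h x) + 2 * Real.log (h d - h x)
    - 2 * Real.log (h d - h y) - 2 * Real.log (d - x) + 2 * Real.log (d - y)

/-- `y` lies strictly between `x` and `d`. -/
def Betw (x y d : ℝ) : Prop := (x < y ∧ y < d) ∨ (d < y ∧ y < x)

lemma crossLog_split (h : ℝ → ℝ) (x y z d : ℝ) :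
    crossLog h x z d = crossLog h x y d + crossLog h y z d := by
  unfold crossLog; ring

lemma crossLog_comp {g h : ℝ → ℝ} {x y d : ℝ} (hx : DifferentiableAt ℝ h x)
    (hy : DifferentiableAt ℝ h y) (gx : DifferentiableAt ℝ g (h x))
    (gy : DifferentiableAt ℝ g (h y)) (hx0 : deriv h x ≠ 0) (hy0 : deriv h y ≠ 0)
    (gx0 : deriv g (h x) ≠ 0) (gy0 : deriv g (h y) ≠ 0) :
    crossLog (g ∘ h) x y d = crossLog h x y d + crossLog g (h x) (h y) (h d) := by
  unfold crossLog
  rw [deriv_comp x gx hx, deriv_comp y gy hy, Real.log_mul gx0 hx0, Real.log_mul gy0 hy0]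
  simp only [Function.comp]
  ring

lemma crossLog_reflect (h : ℝ → ℝ) (x y d : ℝ) :
    crossLog (fun t => h (-t)) (-x) (-y) (-d) = crossLog h x y d := by
  unfold crossLog
  have e : ∀ t : ℝ, deriv (fun t => h (-t)) (-t) = - deriv h t := by
    intro t
    rw [deriv_comp_neg, neg_neg]
  rw [e, e, Real.log_neg_eq_log, Real.log_neg_eq_log]
  have e1 : -d - -x = -(d - x) := by ring
  have e2 : -d - -y = -(d - y) := by ring
  rw [e1, e2, Real.log_neg_eq_log, Real.log_neg_eq_log]
  simp only [neg_neg]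

lemma crossLog_neg (h : ℝ → ℝ) (x y d : ℝ) :
    crossLog (fun t => - h t) x y d = crossLog h x y d := by
  unfold crossLog
  have e : ∀ t : ℝ, deriv (fun t => - h t) t = - deriv h t := by
    intro t
    rw [deriv.fun_neg]
  rw [e, e, Real.log_neg_eq_log, Real.log_neg_eq_log]
  have e1 : -h d - -h x = -(h d - h x) := by ring
  have e2 : -h d - -h y = -(h d - h y) := by ring
  rw [e1, e2, Real.log_neg_eq_log, Real.log_neg_eq_log]

lemma Betw.neg {x y d : ℝ} (h : Betw x y d) : Betw (-x) (-y) (-d) := by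
  rcases h with h | h
  · right; constructor <;> linarith [h.1, h.2]
  · left; constructor <;> linarith [h.1, h.2]

lemma ContDiff.contDiff_one_deriv {φ : ℝ → ℝ} (hφ : ContDiff ℝ 2 φ) : ContDiff ℝ 1 (deriv φ) :=
  ((contDiff_succ_iff_deriv (n := 1)).1 (by norm_num; exact hφ)).2.2

/-- Second order Taylor bound. -/
lemma taylor_two_bound {φ : ℝ → ℝ} (hφ : ContDiff ℝ 2 φ) {z d ε : ℝ}
    (h : ∀ t ∈ uIcc z d, |deriv (deriv φ) t - deriv (deriv φ) z| ≤ ε) :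
    |φ d - φ z - deriv φ z * (d - z) - deriv (deriv φ) z / 2 * (d - z) ^ 2| ≤ ε * (d - z) ^ 2 := by
  have hε : 0 ≤ ε := (abs_nonneg _).trans (h z left_mem_uIcc)
  have hd1 : Differentiable ℝ φ := hφ.differentiable (by norm_num)
  have hC1 : ContDiff ℝ 1 (deriv φ) := hφ.contDiff_one_deriv
  have hd2 : Differentiable ℝ (deriv φ) := hC1.differentiable (by norm_num)
  have conv : Convex ℝ (uIcc z d) := convex_uIcc z d
  have k1 : ∀ t ∈ uIcc z d, |deriv φ t - deriv φ z - deriv (deriv φ) z * (t - z)| ≤ ε * |d - z| := by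
    intro t ht
    have := conv.norm_image_sub_le_of_norm_hasDerivWithin_le (C := ε)
      (f := fun t => deriv φ t - deriv (deriv φ) z * (t - z))
      (f' := fun t => deriv (deriv φ) t - deriv (deriv φ) z) (x := z) (y := t)
      (fun s _ => by
        have h1 := (hd2 s).hasDerivAt
        have h2 := ((hasDerivAt_id s).sub_const z).const_mul (deriv (deriv φ) z)
        exact (h1.sub h2).hasDerivWithinAt.congr_deriv (by simp))
      (fun s hs => by simpa using h s hs) left_mem_uIcc ht
    simp only [sub_self, mul_zero, sub_zero, Real.norm_eq_abs] at this
    have e : deriv φ t - deriv φ z - deriv (deriv φ) z * (t - z)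
      = deriv φ t - deriv (deriv φ) z * (t - z) - deriv φ z := by ring
    rw [e]
    refine this.trans ?_
    exact mul_le_mul_of_nonneg_left (by simpa [abs_sub_comm] using abs_sub_left_of_mem_uIcc ht) hε
  have := conv.norm_image_sub_le_of_norm_hasDerivWithin_le (C := ε * |d - z|)
      (f := fun t => φ t - deriv φ z * (t - z) - deriv (deriv φ) z / 2 * (t - z) ^ 2)
      (f' := fun t => deriv φ t - deriv φ z - deriv (deriv φ) z * (t - z)) (x := z) (y := d)
      (fun s _ => by
        have h1 := (hd1 s).hasDerivAt
        have h2 := ((hasDerivAt_id s).sub_const z).const_mul (deriv φ z)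
        have h3 := (((hasDerivAt_id s).sub_const z).pow 2).const_mul (deriv (deriv φ) z / 2)
        have := ((h1.sub h2).sub h3).hasDerivWithinAt (s := uIcc z d)
        refine this.congr_deriv ?_
        simp; ring)
      (fun s hs => by simpa using k1 s hs) left_mem_uIcc right_mem_uIcc
  simp only [sub_self, mul_zero, sub_zero, Real.norm_eq_abs, ne_eq, OfNat.ofNat_ne_zero,
    not_false_eq_true, zero_pow] at this
  have e : φ d - φ z - deriv φ z * (d - z) - deriv (deriv φ) z / 2 * (d - z) ^ 2
    = φ d - deriv φ z * (d - z) - deriv (deriv φ) z / 2 * (d - z) ^ 2 - φ z := by ring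
  rw [e]
  refine this.trans (le_of_eq ?_)
  rw [mul_assoc, abs_mul_abs_self]; ring

lemma crossLog_deriv_bound {A B D e m M ε δ η : ℝ} (hA : m ≤ |A|) (hB : |B| ≤ M) (hm : 0 < m)
    (hD : |D| ≤ δ) (hD0 : D ≠ 0) (he : |e| ≤ ε) (h1 : (M / 2 + ε) * δ ≤ m / 2)
    (h2 : M * ((M / 2 + ε) * δ) ≤ η * m ^ 2 / 4) (h3 : ε ≤ η * m / 8) :
    A + B / 2 * D + e * D ≠ 0 ∧
    |B / A + 2 * A / (D * (A + B / 2 * D + e * D)) - 2 / D| ≤ η := by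
  have hM : 0 ≤ M := (abs_nonneg _).trans hB
  have hε : 0 ≤ ε := (abs_nonneg _).trans he
  have hδ : 0 ≤ δ := (abs_nonneg _).trans hD
  have hA0 : A ≠ 0 := by
    intro h; rw [h, abs_zero] at hA; linarith
  have hs : |B / 2 * D + e * D| ≤ (M / 2 + ε) * δ := by
    rw [← add_mul, abs_mul]
    gcongr
    refine (abs_add_le _ _).trans ?_
    rw [abs_div, abs_two]
    gcongr
  have hQ : |A| / 2 ≤ |A + B / 2 * D + e * D| := by
    have := abs_sub_abs_le_abs_sub A (-(B / 2 * D + e * D))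
    rw [abs_neg] at this
    have e1 : A - -(B / 2 * D + e * D) = A + B / 2 * D + e * D := by ring
    rw [e1] at this
    linarith
  have hAp : 0 < |A| := abs_pos.2 hA0
  have hQ0 : A + B / 2 * D + e * D ≠ 0 := by
    intro h; rw [h, abs_zero] at hQ; linarith
  refine ⟨hQ0, ?_⟩
  have e1 : B / A + 2 * A / (D * (A + B / 2 * D + e * D)) - 2 / D
    = (B * (B / 2 * D + e * D) - 2 * e * A) / (A * (A + B / 2 * D + e * D)) := by
    generalize hq : A + B / 2 * D + e * D = Q at hQ0 ⊢
    have hBe : B / 2 * D + e * D = Q - A := by linarith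
    have hBD : B * D = 2 * (Q - A) - 2 * e * D := by linarith
    rw [hBe]
    field_simp
    linear_combination A * hBD
  rw [e1, abs_div, abs_mul, div_le_iff₀ (mul_pos hAp (abs_pos.2 hQ0))]
  have hη : 0 ≤ η := by
    by_contra hc; push Not at hc
    have : η * m < 0 := mul_neg_of_neg_of_pos hc hm
    linarith
  have n1 : |B * (B / 2 * D + e * D) - 2 * e * A| ≤ M * ((M / 2 + ε) * δ) + 2 * ε * |A| := by
    refine (abs_sub _ _).trans ?_
    rw [abs_mul, abs_mul, abs_mul, abs_two]
    gcongr
  have n2 : η * (|A| * (|A| / 2)) ≤ η * (|A| * |A + B / 2 * D + e * D|) := by gcongr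
  have n3 : η * m ^ 2 / 4 ≤ η * (|A| * |A|) / 4 := by
    have : m ^ 2 ≤ |A| * |A| := by nlinarith
    nlinarith
  have n4 : 2 * ε * |A| ≤ η * (|A| * |A|) / 4 := by
    have : 2 * ε ≤ η * |A| / 4 := by nlinarith
    nlinarith
  linarith

/-- Away from critical points the cross-ratio distortion is small at small scales. -/
lemma crossLog_regular {φ : ℝ → ℝ} (hφ : ContDiff ℝ 2 φ) (a b : ℝ)
    (h0 : ∀ x ∈ Icc a b, deriv φ x ≠ 0) {η : ℝ} (hη : 0 < η) :
    ∃ δ > 0, ∀ x ∈ Icc a b, ∀ d ∈ Icc a b, ∀ y, Betw x y d → |d - x| < δ →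
      -(η * |x - y|) ≤ crossLog φ x y d := by
  have hd1 : Differentiable ℝ φ := hφ.differentiable (by norm_num)
  have hC1 := hφ.contDiff_one_deriv
  have hd2 : Differentiable ℝ (deriv φ) := hC1.differentiable (by norm_num)
  have hc2 : Continuous (deriv (deriv φ)) := hC1.continuous_deriv (by norm_num)
  rcases (Icc a b).eq_empty_or_nonempty with hE | hne
  · exact ⟨1, one_pos, fun x hx => by simp [hE] at hx⟩
  have hcomp : IsCompact (Icc a b) := isCompact_Icc
  obtain ⟨z0, hz0, hmin⟩ := hcomp.exists_isMinOn hne (f := fun x => |deriv φ x|)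
    (hd2.continuous.abs.continuousOn)
  obtain ⟨M, hM⟩ := hcomp.exists_bound_of_continuousOn (f := deriv (deriv φ)) hc2.continuousOn
  set m := |deriv φ z0| with hmdef
  have hm : 0 < m := abs_pos.2 (h0 _ hz0)
  have hM0 : 0 ≤ M := (norm_nonneg _).trans (hM _ hz0)
  set ε := η * m / 8 with hε
  have hεp : 0 < ε := by positivity
  have huc := hcomp.uniformContinuousOn_of_continuous (f := deriv (deriv φ)) hc2.continuousOn
  obtain ⟨δ1, hδ1, huc⟩ := Metric.uniformContinuousOn_iff.1 huc ε hεp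
  set c1 := m / 2 / (M / 2 + ε + 1) with hc1
  set c2 := η * m ^ 2 / 4 / ((M + 1) * (M / 2 + ε + 1)) with hc2'
  have hc1p : 0 < c1 := by positivity
  have hc2p : 0 < c2 := by positivity
  refine ⟨min δ1 (min c1 c2), lt_min hδ1 (lt_min hc1p hc2p), ?_⟩
  intro x hx d hd y hb hlt
  set δ := min c1 c2 with hδ
  have hδp : 0 ≤ δ := (lt_min hc1p hc2p).le
  have hlt1 : |d - x| < δ1 := hlt.trans_le (min_le_left _ _)
  have hlt2 : |d - x| < δ := hlt.trans_le (min_le_right _ _)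
  have g1 : (M / 2 + ε) * δ ≤ m / 2 := by
    have : δ ≤ c1 := min_le_left _ _
    calc (M / 2 + ε) * δ ≤ (M / 2 + ε + 1) * c1 := by
          apply mul_le_mul (by linarith) this hδp (by positivity)
      _ = m / 2 := by rw [hc1]; field_simp
  have g2 : M * ((M / 2 + ε) * δ) ≤ η * m ^ 2 / 4 := by
    have : δ ≤ c2 := min_le_right _ _
    calc M * ((M / 2 + ε) * δ) ≤ (M + 1) * ((M / 2 + ε + 1) * c2) := by
          apply mul_le_mul (by linarith) _ (by positivity) (by positivity)
          apply mul_le_mul (by linarith) this hδp (by positivity)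
      _ = η * m ^ 2 / 4 := by rw [hc2']; field_simp
  -- the interval [x,y] and its points
  have hsub : ∀ z ∈ uIcc x y, z ∈ Icc a b ∧ z ≠ d ∧ |d - z| ≤ |d - x| ∧ uIcc z d ⊆ Icc a b := by
    intro z hz
    have hzI : z ∈ Icc a b := by
      have : z ∈ uIcc x d := by
        rcases hb with h | h
        · rw [uIcc_of_le h.1.le] at hz; rw [uIcc_of_le (h.1.trans h.2).le]
          exact ⟨hz.1, hz.2.trans h.2.le⟩
        · rw [uIcc_of_ge h.2.le] at hz; rw [uIcc_of_ge (h.1.trans h.2).le]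
          exact ⟨h.1.le.trans hz.1, hz.2⟩
      exact (ordConnected_Icc.uIcc_subset hx hd) this
    refine ⟨hzI, ?_, ?_, ordConnected_Icc.uIcc_subset hzI hd⟩
    · rcases hb with h | h
      · rw [uIcc_of_le h.1.le] at hz; exact (hz.2.trans_lt h.2).ne
      · rw [uIcc_of_ge h.2.le] at hz; exact (h.1.trans_le hz.1).ne'
    · rcases hb with h | h
      · rw [uIcc_of_le h.1.le] at hz
        rw [abs_of_nonneg (by linarith [hz.2, h.2]), abs_of_nonneg (by linarith [h.1, h.2])]
        linarith [hz.1]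
      · rw [uIcc_of_ge h.2.le] at hz
        rw [abs_of_nonpos (by linarith [hz.1, h.1]), abs_of_nonpos (by linarith [h.1, h.2])]
        linarith [hz.2]
  have key : ∀ z ∈ uIcc x y, φ d - φ z ≠ 0 ∧
      |deriv (deriv φ) z / deriv φ z + 2 * deriv φ z / (φ d - φ z) - 2 / (d - z)| ≤ η := by
    intro z hz
    obtain ⟨hzI, hzd, hzl, hzs⟩ := hsub z hz
    have hD0 : d - z ≠ 0 := sub_ne_zero.2 hzd.symm
    have ht := taylor_two_bound hφ (z := z) (d := d) (ε := ε) (fun t ht => by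
      have := huc t (hzs ht) z hzI (by
        rw [Real.dist_eq]
        have := abs_sub_left_of_mem_uIcc ht
        linarith)
      rw [Real.dist_eq] at this; exact this.le)
    set e := (φ d - φ z - deriv φ z * (d - z) - deriv (deriv φ) z / 2 * (d - z) ^ 2) / (d - z) ^ 2
      with he
    have hDp : 0 < (d - z) ^ 2 := by positivity
    have he1 : |e| ≤ ε := by
      rw [he, abs_div, abs_of_pos hDp, div_le_iff₀ hDp]; exact ht
    have hΔ : φ d - φ z = (d - z) * (deriv φ z + deriv (deriv φ) z / 2 * (d - z) + e * (d - z)) := by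
      have : e * (d - z) ^ 2 = φ d - φ z - deriv φ z * (d - z) - deriv (deriv φ) z / 2 * (d - z) ^ 2 := by
        rw [he]; field_simp
      linear_combination -this
    have := crossLog_deriv_bound (A := deriv φ z) (B := deriv (deriv φ) z) (D := d - z) (e := e)
      (m := m) (M := M) (ε := ε) (δ := δ) (η := η) (hmin hzI) (hM z hzI) hm
      (hzl.trans hlt2.le) hD0 he1 g1 g2 le_rfl
    rw [hΔ]
    exact ⟨mul_ne_zero hD0 this.1, this.2⟩
  have mv := (convex_uIcc x y).norm_image_sub_le_of_norm_hasDerivWithin_le (C := η)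
    (f := fun z => Real.log (deriv φ z) - 2 * Real.log (φ d - φ z) + 2 * Real.log (d - z))
    (f' := fun z => deriv (deriv φ) z / deriv φ z + 2 * deriv φ z / (φ d - φ z) - 2 / (d - z))
    (x := x) (y := y)
    (fun z hz => by
      have h1 := (hd2 z).hasDerivAt.log (h0 z (hsub z hz).1)
      have h2 := (((hd1 z).hasDerivAt.const_sub (φ d)).log (key z hz).1).const_mul 2
      have h3 := (((hasDerivAt_id z).const_sub d).log
        (by simpa [sub_eq_zero] using (hsub z hz).2.1.symm)).const_mul 2
      refine ((h1.sub h2).add h3).hasDerivWithinAt.congr_deriv ?_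
      simp only [id]; ring)
    (fun z hz => (key z hz).2) left_mem_uIcc right_mem_uIcc
  simp only [Real.norm_eq_abs] at mv
  have e1 : crossLog φ x y d = (Real.log (deriv φ y) - 2 * Real.log (φ d - φ y) + 2 * Real.log (d - y))
     - (Real.log (deriv φ x) - 2 * Real.log (φ d - φ x) + 2 * Real.log (d - x)) := by
    unfold crossLog; ring
  rw [e1, abs_sub_comm x y]
  exact (abs_le.1 mv).1

lemma powAux_antitone {l : ℝ} (hl : 1 < l) :
    AntitoneOn (fun v : ℝ => (l - 1) - (l + 1) * v + (l + 1) * v ^ l - (l - 1) * v ^ (l + 1)) (Ioi 0) := by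
  have hd : ∀ v ∈ Ioi (0:ℝ), HasDerivAt
      (fun v : ℝ => (l - 1) - (l + 1) * v + (l + 1) * v ^ l - (l - 1) * v ^ (l + 1))
      ((l + 1) * (-1 + l * v ^ (l - 1) - (l - 1) * v ^ l)) v := by
    intro v hv
    have h1 := (hasDerivAt_id v).const_mul (l + 1)
    have h2 := (Real.hasDerivAt_rpow_const (x := v) (p := l) (Or.inl (ne_of_gt hv))).const_mul (l + 1)
    have h3 := (Real.hasDerivAt_rpow_const (x := v) (p := l + 1)
      (Or.inl (ne_of_gt hv))).const_mul (l - 1)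
    refine ((((h1.const_sub (l - 1)).add h2)).sub h3).congr_deriv ?_
    rw [show l + 1 - 1 = l by ring]; ring
  refine antitoneOn_of_deriv_nonpos (convex_Ioi 0)
    (fun v hv => (hd v hv).continuousAt.continuousWithinAt)
    (fun v hv => (hd v (by simpa using hv)).differentiableAt.differentiableWithinAt) ?_
  intro v hv
  have hv' : (0:ℝ) < v := by simpa using hv
  rw [(hd v hv').deriv]
  have hb := one_add_mul_self_le_rpow_one_add (s := 1 / v - 1) (by
    have : 0 < 1 / v := by positivity
    linarith) hl.le
  rw [show 1 + (1 / v - 1) = 1 / v by ring, Real.div_rpow zero_le_one hv'.le, Real.one_rpow] at hb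
  have hvl : 0 < v ^ l := Real.rpow_pos_of_pos hv' l
  have hm : v ^ (l - 1) = v ^ l / v := by rw [Real.rpow_sub hv', Real.rpow_one]
  have := mul_le_mul_of_nonneg_right hb hvl.le
  rw [one_div_mul_cancel hvl.ne'] at this
  have e : (1 + l * (1 / v - 1)) * v ^ l = l * (v ^ l / v) - (l - 1) * v ^ l := by
    field_simp; ring
  rw [e] at this
  rw [hm]
  have : -1 + l * (v ^ l / v) - (l - 1) * v ^ l ≤ 0 := by linarith
  exact mul_nonpos_of_nonneg_of_nonpos (by linarith) this

lemma hasDerivAt_powCross {l v : ℝ} (hl : 1 < l) (hv : 0 < v) (hv1 : v ≠ 1) :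
    HasDerivAt (fun v : ℝ => (l - 1) * Real.log v - 2 * Real.log (1 - v ^ l) + 2 * Real.log (1 - v))
      (((l - 1) - (l + 1) * v + (l + 1) * v ^ l - (l - 1) * v ^ (l + 1)) /
        (v * ((1 - v) * (1 - v ^ l)))) v := by
  have hne : 1 - v ^ l ≠ 0 := by
    rcases lt_or_gt_of_ne hv1 with h | h
    · have := Real.rpow_lt_one hv.le h (by linarith : 0 < l); linarith
    · have := Real.one_lt_rpow h (by linarith : 0 < l); linarith
  have hne1 : 1 - v ≠ 0 := by intro h; apply hv1; linarith
  have h1 := (Real.hasDerivAt_log hv.ne').const_mul (l - 1)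
  have h2 := (((Real.hasDerivAt_rpow_const (x := v) (p := l) (Or.inl hv.ne')).const_sub 1).log
    hne).const_mul 2
  have h3 := (((hasDerivAt_id v).const_sub 1).log hne1).const_mul 2
  refine ((h1.sub h2).add h3).congr_deriv ?_
  have hm : v ^ (l - 1) = v ^ l / v := by rw [Real.rpow_sub hv, Real.rpow_one]
  have hp : v ^ (l + 1) = v ^ l * v := by rw [Real.rpow_add hv, Real.rpow_one]
  simp only [id]
  rw [hm, hp]
  field_simp
  ring

lemma powCross_one {l u v : ℝ} (hl : 1 < l) (hu : 0 < u) (hv : 0 < v) (hb : Betw u v 1) :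
    (l - 1) * Real.log u - 2 * Real.log (1 - u ^ l) + 2 * Real.log (1 - u) ≤
    (l - 1) * Real.log v - 2 * Real.log (1 - v ^ l) + 2 * Real.log (1 - v) := by
  have hm1 : (l - 1) - (l + 1) * 1 + (l + 1) * (1:ℝ) ^ l - (l - 1) * (1:ℝ) ^ (l + 1) = 0 := by
    rw [Real.one_rpow, Real.one_rpow]; ring
  rcases hb with hb | hb
  · refine (monotoneOn_of_deriv_nonneg (convex_Ioo 0 1)
      (f := fun v : ℝ => (l - 1) * Real.log v - 2 * Real.log (1 - v ^ l) + 2 * Real.log (1 - v))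
      (fun v hv => (hasDerivAt_powCross hl hv.1 hv.2.ne).continuousAt.continuousWithinAt)
      (fun v hv => ?_) (fun v hv => ?_)) ⟨hu, hb.1.trans hb.2⟩ ⟨hv, hb.2⟩ hb.1.le
    · rw [interior_Ioo] at hv
      exact (hasDerivAt_powCross hl hv.1 hv.2.ne).differentiableAt.differentiableWithinAt
    · rw [interior_Ioo] at hv
      rw [(hasDerivAt_powCross hl hv.1 hv.2.ne).deriv]
      have := powAux_antitone hl (a := v) (b := 1) hv.1 (mem_Ioi.2 one_pos) hv.2.le
      simp only [hm1] at this
      have h1 := Real.rpow_lt_one hv.1.le hv.2 (by linarith : 0 < l)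
      exact div_nonneg this (mul_nonneg hv.1.le (mul_nonneg (by linarith [hv.2]) (by linarith)))
  · refine (antitoneOn_of_deriv_nonpos (convex_Ioi 1)
      (f := fun v : ℝ => (l - 1) * Real.log v - 2 * Real.log (1 - v ^ l) + 2 * Real.log (1 - v))
      (fun v hv => (hasDerivAt_powCross hl (one_pos.trans hv) (ne_of_gt hv)).continuousAt.continuousWithinAt)
      (fun v hv => ?_) (fun v hv => ?_)) hb.1 (hb.1.trans hb.2) hb.2.le
    · rw [interior_Ioi] at hv
      exact (hasDerivAt_powCross hl (one_pos.trans hv)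
        (ne_of_gt hv)).differentiableAt.differentiableWithinAt
    · rw [interior_Ioi] at hv
      have hv0 : (0:ℝ) < v := one_pos.trans hv
      rw [(hasDerivAt_powCross hl hv0 (ne_of_gt hv)).deriv]
      have := powAux_antitone hl (a := 1) (b := v) (mem_Ioi.2 one_pos) hv0 (le_of_lt hv)
      simp only [hm1] at this
      have h1 := Real.one_lt_rpow hv (by linarith : 0 < l)
      have hv' : (1:ℝ) < v := hv
      exact div_nonpos_of_nonpos_of_nonneg this
        (mul_nonneg hv0.le (mul_nonneg_of_nonpos_of_nonpos (by linarith) (by linarith)))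

/-- Power maps do not decrease the cross-ratio. -/
lemma crossLog_rpow_nonneg {l u v w : ℝ} (hl : 1 < l) (hu : 0 < u) (hv : 0 < v) (hw : 0 < w)
    (hb : Betw u v w) : 0 ≤ crossLog (fun t : ℝ => t ^ l) u v w := by
  have hb' : Betw (u / w) (v / w) 1 := by
    rcases hb with h | h
    · left; exact ⟨div_lt_div_of_pos_right h.1 hw, (div_lt_one hw).2 h.2⟩
    · right; exact ⟨(one_lt_div hw).2 h.1, div_lt_div_of_pos_right h.2 hw⟩
  have key := powCross_one hl (div_pos hu hw) (div_pos hv hw) hb'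
  have hlog : ∀ t : ℝ, 0 < t → t ≠ w → (l - 1) * Real.log (t / w) - 2 * Real.log (1 - (t / w) ^ l)
      + 2 * Real.log (1 - t / w) = (l - 1) * Real.log t - 2 * Real.log (w ^ l - t ^ l)
      + 2 * Real.log (w - t) + (2 * l * Real.log w - 2 * Real.log w - (l - 1) * Real.log w) := by
    intro t ht htw
    have hwl : 0 < w ^ l := Real.rpow_pos_of_pos hw l
    have e1 : 1 - (t / w) ^ l = (w ^ l - t ^ l) / w ^ l := by
      rw [Real.div_rpow ht.le hw.le]; field_simp
    have e2 : 1 - t / w = (w - t) / w := by field_simp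
    have n1 : w ^ l - t ^ l ≠ 0 := by
      rw [sub_ne_zero]
      intro h
      exact htw ((Real.rpow_left_inj ht.le hw.le (by linarith)).1 h.symm)
    have n2 : w - t ≠ 0 := sub_ne_zero.2 htw.symm
    rw [e1, e2, Real.log_div n1 hwl.ne', Real.log_div n2 hw.ne', Real.log_div ht.ne' hw.ne',
      Real.log_rpow hw]
    ring
  have huw : u ≠ w := by rcases hb with h | h <;> [exact (h.1.trans h.2).ne; exact (h.1.trans h.2).ne']
  have hvw : v ≠ w := by rcases hb with h | h <;> [exact h.2.ne; exact h.1.ne']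
  rw [hlog u hu huw, hlog v hv hvw] at key
  have hder : ∀ t : ℝ, 0 < t → Real.log (deriv (fun t : ℝ => t ^ l) t)
      = Real.log l + (l - 1) * Real.log t := by
    intro t ht
    rw [Real.deriv_rpow_const, Real.log_mul (by linarith) (Real.rpow_pos_of_pos ht _).ne',
      Real.log_rpow ht]
  unfold crossLog
  rw [hder u hu, hder v hv]
  linarith

/-- To the right of `c`, the map `F` is a power of a diffeomorphism. -/
def PowRight (F : ℝ → ℝ) (c : ℝ) : Prop :=
  ∃ (l : ℝ) (ψ : ℝ → ℝ) (s ρ : ℝ), 1 < l ∧ ContDiff ℝ 2 ψ ∧ (∀ x, 0 < deriv ψ x) ∧ s ≠ 0 ∧ 0 < ρ ∧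
    ∀ x ∈ Ioo c (c + ρ), 0 < ψ x ∧ F x = F c + s * ψ x ^ l

lemma crossLog_congr {g h : ℝ → ℝ} {x y d : ℝ} (hx : g =ᶠ[nhds x] h) (hy : g =ᶠ[nhds y] h)
    (hd : g d = h d) : crossLog g x y d = crossLog h x y d := by
  unfold crossLog
  rw [hx.deriv_eq, hy.deriv_eq, hx.eq_of_nhds, hy.eq_of_nhds, hd]

lemma crossLog_affine {h : ℝ → ℝ} {x y d a s : ℝ} (hs : s ≠ 0) (hx : h d - h x ≠ 0)
    (hy : h d - h y ≠ 0) (hx0 : deriv h x ≠ 0) (hy0 : deriv h y ≠ 0) :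
    crossLog (fun t => a + s * h t) x y d = crossLog h x y d := by
  unfold crossLog
  have e : ∀ t, deriv (fun t => a + s * h t) t = s * deriv h t := by
    intro t; simp [deriv_const_mul_field]
  have e2 : ∀ t, a + s * h d - (a + s * h t) = s * (h d - h t) := by intro t; ring
  rw [e, e, e2, e2, Real.log_mul hs hx, Real.log_mul hs hy, Real.log_mul hs hx0,
    Real.log_mul hs hy0]
  ring

lemma Betw.mem_Ioo {x y d a b : ℝ} (h : Betw x y d) (hx : x ∈ Ioo a b) (hd : d ∈ Ioo a b) :
    y ∈ Ioo a b := by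
  rcases h with h | h
  · exact ⟨hx.1.trans h.1, h.2.trans hd.2⟩
  · exact ⟨hd.1.trans h.1, h.2.trans hx.2⟩

lemma StrictMono.betw {g : ℝ → ℝ} (hg : StrictMono g) {x y d : ℝ} (h : Betw x y d) :
    Betw (g x) (g y) (g d) := by
  rcases h with h | h
  · exact Or.inl ⟨hg h.1, hg h.2⟩
  · exact Or.inr ⟨hg h.1, hg h.2⟩

lemma PowRight.cross {F : ℝ → ℝ} {c : ℝ} (h : PowRight F c) {η : ℝ} (hη : 0 < η) :
    ∃ ρ > 0, ∃ δ > 0, ∀ x ∈ Ioo c (c + ρ), ∀ d ∈ Ioo c (c + ρ), ∀ y, Betw x y d → |d - x| < δ →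
      -(η * |x - y|) ≤ crossLog F x y d := by
  obtain ⟨l, ψ, s, ρ, hl, hψ, hψ', hs, hρ, hF⟩ := h
  obtain ⟨δ, hδ, H⟩ := crossLog_regular hψ c (c + ρ) (fun x _ => (hψ' x).ne') hη
  refine ⟨ρ, hρ, δ, hδ, ?_⟩
  intro x hx d hd y hb hlt
  have hy := hb.mem_Ioo hx hd
  have H1 := H x (Ioo_subset_Icc_self hx) d (Ioo_subset_Icc_self hd) y hb hlt
  have hdiff : Differentiable ℝ ψ := hψ.differentiable (by norm_num)
  have hmono : StrictMono ψ := strictMono_of_deriv_pos hψ'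
  set g : ℝ → ℝ := fun u => F c + s * u ^ l with hg
  have ev : ∀ z ∈ Ioo c (c + ρ), F =ᶠ[nhds z] g ∘ ψ := by
    intro z hz
    filter_upwards [isOpen_Ioo.mem_nhds hz] with t ht
    exact (hF t ht).2
  have hgd : ∀ u : ℝ, 0 < u → HasDerivAt g (s * (l * u ^ (l - 1))) u := by
    intro u hu
    exact ((Real.hasDerivAt_rpow_const (Or.inl hu.ne')).const_mul s).const_add _
  have hgne : ∀ u : ℝ, 0 < u → deriv g u ≠ 0 := by
    intro u hu
    rw [(hgd u hu).deriv]
    have := Real.rpow_pos_of_pos hu (l - 1)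
    have : 0 < l * u ^ (l - 1) := by positivity
    exact mul_ne_zero hs this.ne'
  have hb2 := hmono.betw hb
  have px := (hF x hx).1
  have py := (hF y hy).1
  have pd := (hF d hd).1
  have hpne : ∀ u : ℝ, 0 < u → u ≠ ψ d → (ψ d) ^ l - u ^ l ≠ 0 := by
    intro u hu hud h
    exact hud ((Real.rpow_left_inj hu.le pd.le (by linarith)).1 (sub_eq_zero.1 h).symm)
  have hpd : ∀ u : ℝ, 0 < u → deriv (fun t : ℝ => t ^ l) u ≠ 0 := by
    intro u hu
    rw [Real.deriv_rpow_const]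
    have := Real.rpow_pos_of_pos hu (l - 1)
    positivity
  have nx : ψ x ≠ ψ d := by
    rcases hb2 with h | h <;> [exact (h.1.trans h.2).ne; exact (h.1.trans h.2).ne']
  have ny : ψ y ≠ ψ d := by rcases hb2 with h | h <;> [exact h.2.ne; exact h.1.ne']
  rw [crossLog_congr (ev x hx) (ev y hy) (ev d hd).eq_of_nhds,
    crossLog_comp (hdiff x) (hdiff y) (hgd _ px).differentiableAt (hgd _ py).differentiableAt
      (hψ' x).ne' (hψ' y).ne' (hgne _ px) (hgne _ py), hg,
    crossLog_affine (h := fun u : ℝ => u ^ l) hs (hpne _ px nx) (hpne _ py ny) (hpd _ px) (hpd _ py)]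
  have := crossLog_rpow_nonneg hl px py pd hb2
  linarith

lemma log_deriv_lipschitz {φ : ℝ → ℝ} (hφ : ContDiff ℝ 2 φ) (a b : ℝ)
    (h0 : ∀ x ∈ Icc a b, deriv φ x ≠ 0) :
    ∃ C ≥ 0, ∀ x ∈ Icc a b, ∀ y ∈ Icc a b,
      |Real.log (deriv φ y) - Real.log (deriv φ x)| ≤ C * |y - x| := by
  have hC1 := hφ.contDiff_one_deriv
  have hd2 : Differentiable ℝ (deriv φ) := hC1.differentiable (by norm_num)
  have hc2 : Continuous (deriv (deriv φ)) := hC1.continuous_deriv (by norm_num)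
  obtain ⟨M, hM⟩ := (isCompact_Icc (a := a) (b := b)).exists_bound_of_continuousOn
    (f := fun x => deriv (deriv φ) x / deriv φ x)
    (hc2.continuousOn.div hd2.continuous.continuousOn h0)
  refine ⟨|M|, abs_nonneg _, ?_⟩
  intro x hx y hy
  have := (convex_Icc a b).norm_image_sub_le_of_norm_hasDerivWithin_le (C := |M|)
    (f := fun z => Real.log (deriv φ z)) (f' := fun x => deriv (deriv φ) x / deriv φ x)
    (fun z hz => ((hd2 z).hasDerivAt.log (h0 z hz)).hasDerivWithinAt)
    (fun z hz => (hM z hz).trans (le_abs_self M)) hx hy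
  simpa using this

lemma PowRight.log_deriv {F : ℝ → ℝ} {c : ℝ} (h : PowRight F c) :
    ∃ ρ > 0, ∃ C ≥ 0, ∀ x ∈ Ioo c (c + ρ), ∀ y ∈ Ioo c (c + ρ), x ≤ y →
      -(C * (y - x)) ≤ Real.log (deriv F y) - Real.log (deriv F x) := by
  obtain ⟨l, ψ, s, ρ, hl, hψ, hψ', hs, hρ, hF⟩ := h
  obtain ⟨C, hC, H⟩ := log_deriv_lipschitz hψ c (c + ρ) (fun x _ => (hψ' x).ne')
  have hdiff : Differentiable ℝ ψ := hψ.differentiable (by norm_num)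
  have hmono : StrictMono ψ := strictMono_of_deriv_pos hψ'
  refine ⟨ρ, hρ, C, hC, ?_⟩
  have key : ∀ z ∈ Ioo c (c + ρ), Real.log (deriv F z)
      = Real.log s + (Real.log l + (l - 1) * Real.log (ψ z)) + Real.log (deriv ψ z) := by
    intro z hz
    have hp := (hF z hz).1
    have ev : F =ᶠ[nhds z] fun t => F c + s * ψ t ^ l := by
      filter_upwards [isOpen_Ioo.mem_nhds hz] with t ht
      exact (hF t ht).2
    have hd := (((hdiff z).hasDerivAt.rpow_const (p := l) (Or.inl hp.ne')).const_mul s).const_add (F c)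
    rw [ev.deriv_eq, hd.deriv]
    have h1 := Real.rpow_pos_of_pos hp (l - 1)
    have h2 := hψ' z
    have hl0 : 0 < l := by linarith
    rw [Real.log_mul hs (by positivity), Real.log_mul (by positivity) h1.ne',
      Real.log_mul h2.ne' hl0.ne', Real.log_rpow hp]
    ring
  intro x hx y hy hxy
  rw [key x hx, key y hy]
  have h1 := (abs_le.1 (H x (Ioo_subset_Icc_self hx) y (Ioo_subset_Icc_self hy))).1
  rw [abs_of_nonneg (by linarith : 0 ≤ y - x)] at h1
  have h2 : Real.log (ψ x) ≤ Real.log (ψ y) := Real.log_le_log (hF x hx).1 (hmono.monotone hxy)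
  have : 0 ≤ (l - 1) * (Real.log (ψ y) - Real.log (ψ x)) :=
    mul_nonneg (by linarith) (by linarith)
  linarith

lemma lap_crossLog_small {F : ℝ → ℝ} {a b : ℝ} (hF : ContDiff ℝ 2 F)
    (h0 : ∀ x ∈ Ioo a b, deriv F x ≠ 0) (ha : PowRight F a) (hb : PowRight (fun t => F (-t)) (-b))
    {η : ℝ} (hη : 0 < η) :
    ∃ δ > 0, ∀ x ∈ Ioo a b, ∀ d ∈ Ioo a b, ∀ y, Betw x y d → |d - x| < δ →
      -(η * |x - y|) ≤ crossLog F x y d := by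
  obtain ⟨ρa, hρa, δa, hδa, Ha⟩ := ha.cross hη
  obtain ⟨ρb, hρb, δb, hδb, Hb⟩ := hb.cross hη
  set ρ := min ρa ρb with hρ
  have hρp : 0 < ρ := lt_min hρa hρb
  have hra : ρ ≤ ρa := min_le_left _ _
  have hrb : ρ ≤ ρb := min_le_right _ _
  obtain ⟨δc, hδc, Hc⟩ := crossLog_regular hF (a + ρ / 2) (b - ρ / 2)
    (fun x hx => h0 x ⟨by linarith [hx.1], by linarith [hx.2]⟩) hη
  refine ⟨min (ρ / 2) (min δa (min δb δc)), by positivity, ?_⟩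
  intro x hx d hd y hbt hlt
  rw [lt_min_iff, lt_min_iff, lt_min_iff] at hlt
  obtain ⟨l1, l2, l3, l4⟩ := hlt
  rw [abs_lt] at l1
  by_cases c1 : x < a + ρ / 2 ∨ d < a + ρ / 2
  · refine Ha x ⟨hx.1, ?_⟩ d ⟨hd.1, ?_⟩ y hbt l2 <;> rcases c1 with c | c <;> linarith
  by_cases c2 : b - ρ / 2 < x ∨ b - ρ / 2 < d
  · have := Hb (-x) ⟨by linarith [hx.2], by rcases c2 with c | c <;> linarith⟩
      (-d) ⟨by linarith [hd.2], by rcases c2 with c | c <;> linarith⟩ (-y) hbt.neg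
      (by rw [show -d - -x = -(d - x) by ring, abs_neg]; exact l3)
    rw [crossLog_reflect, show -x - -y = -(x - y) by ring, abs_neg] at this
    exact this
  push Not at c1 c2
  exact Hc x ⟨c1.1, c2.1⟩ d ⟨c1.2, c2.2⟩ y hbt l4

lemma lap_log_deriv {F : ℝ → ℝ} {a b : ℝ} (hF : ContDiff ℝ 2 F)
    (h0 : ∀ x ∈ Ioo a b, deriv F x ≠ 0) (ha : PowRight F a) {δ : ℝ} (hδ : 0 < δ) :
    ∃ C ≥ 0, ∀ x y, a < x → x ≤ y → y ≤ b - δ →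
      -(C * (y - x)) ≤ Real.log (deriv F y) - Real.log (deriv F x) := by
  obtain ⟨ρ, hρ, C1, hC1, H1⟩ := ha.log_deriv
  obtain ⟨C2, hC2, H2⟩ := log_deriv_lipschitz hF (a + ρ / 2) (b - δ)
    (fun x hx => h0 x ⟨by linarith [hx.1], by linarith [hx.2]⟩)
  refine ⟨max C1 C2, le_max_of_le_left hC1, ?_⟩
  have A1 : ∀ x y, a < x → x ≤ y → y ≤ a + ρ / 2 →
      -(max C1 C2 * (y - x)) ≤ Real.log (deriv F y) - Real.log (deriv F x) := by
    intro x y hx hxy hy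
    have := H1 x ⟨hx, by linarith⟩ y ⟨by linarith, by linarith⟩ hxy
    have : C1 * (y - x) ≤ max C1 C2 * (y - x) :=
      mul_le_mul_of_nonneg_right (le_max_left _ _) (by linarith)
    linarith
  have A2 : ∀ x y, a + ρ / 2 ≤ x → x ≤ y → y ≤ b - δ →
      -(max C1 C2 * (y - x)) ≤ Real.log (deriv F y) - Real.log (deriv F x) := by
    intro x y hx hxy hy
    have := (abs_le.1 (H2 x ⟨hx, by linarith⟩ y ⟨by linarith, by linarith⟩)).1
    rw [abs_of_nonneg (by linarith : 0 ≤ y - x)] at this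
    have : C2 * (y - x) ≤ max C1 C2 * (y - x) :=
      mul_le_mul_of_nonneg_right (le_max_right _ _) (by linarith)
    linarith
  intro x y hx hxy hy
  by_cases c1 : y ≤ a + ρ / 2
  · exact A1 x y hx hxy c1
  by_cases c2 : a + ρ / 2 ≤ x
  · exact A2 x y c2 hxy hy
  push Not at c1 c2
  have h1 := A1 x (a + ρ / 2) hx c2.le le_rfl
  have h2 := A2 (a + ρ / 2) y le_rfl c1.le hy
  have : max C1 C2 * (y - x) = max C1 C2 * (a + ρ / 2 - x) + max C1 C2 * (y - (a + ρ / 2)) := by ring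
  linarith

lemma lap_crossLog_far {F : ℝ → ℝ} {a b : ℝ} (hF : ContDiff ℝ 2 F)
    (h0 : ∀ x ∈ Ioo a b, deriv F x ≠ 0) (ha : PowRight F a) {δ : ℝ} (hδ : 0 < δ) :
    ∃ C ≥ 0, ∀ x y d, a < x → x < y → d < b → y ≤ d - δ →
      -(C * |x - y|) ≤ crossLog F x y d := by
  obtain ⟨C, hC, H⟩ := lap_log_deriv hF h0 ha hδ
  refine ⟨C + 2 / δ, by positivity, ?_⟩
  intro x y d hx hxy hd hy
  have h1 := H x y hx hxy.le (by linarith)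
  have hdiff : Differentiable ℝ F := hF.differentiable (by norm_num)
  have hinj : |F d - F y| ≤ |F d - F x| ∧ 0 < |F d - F y| := by
    have hc : ContinuousOn (deriv F) (Ioo a b) :=
      (hF.contDiff_one_deriv.continuous).continuousOn
    have hs : (∀ z ∈ Ioo a b, 0 < deriv F z) ∨ (∀ z ∈ Ioo a b, deriv F z < 0) := by
      by_contra hcon
      push Not at hcon
      obtain ⟨⟨z1, hz1, h1⟩, z2, hz2, h2⟩ := hcon
      obtain ⟨z, hz, hz0⟩ := (isPreconnected_Ioo.intermediate_value hz1 hz2 hc) ⟨h1, h2⟩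
      exact h0 z hz hz0
    rcases hs with hs | hs
    · have sm : StrictMonoOn F (Ioo a b) := strictMonoOn_of_deriv_pos (convex_Ioo a b)
        hdiff.continuous.continuousOn (by simpa using hs)
      have m1 := sm ⟨hx, by linarith⟩ ⟨hx.trans hxy, by linarith⟩ hxy
      have m2 := sm (a := y) (b := d) ⟨hx.trans hxy, by linarith⟩ ⟨by linarith, hd⟩ (by linarith)
      rw [abs_of_pos (by linarith), abs_of_pos (by linarith)]
      constructor <;> linarith
    · have sm : StrictAntiOn F (Ioo a b) := strictAntiOn_of_deriv_neg (convex_Ioo a b)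
        hdiff.continuous.continuousOn (by simpa using hs)
      have m1 := sm ⟨hx, by linarith⟩ ⟨hx.trans hxy, by linarith⟩ hxy
      have m2 := sm (a := y) (b := d) ⟨hx.trans hxy, by linarith⟩ ⟨by linarith, hd⟩ (by linarith)
      rw [abs_of_neg (by linarith), abs_of_neg (by linarith)]
      constructor <;> linarith
  have h2 : Real.log (F d - F y) ≤ Real.log (F d - F x) := by
    rw [← Real.log_abs, ← Real.log_abs (F d - F x)]
    exact Real.log_le_log hinj.2 hinj.1
  have h3 : Real.log (d - x) - Real.log (d - y) ≤ (y - x) / δ := by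
    rw [← Real.log_div (by linarith) (by linarith)]
    refine (Real.log_le_sub_one_of_pos (div_pos (by linarith) (by linarith))).trans ?_
    have : (d - x) / (d - y) - 1 = (y - x) / (d - y) := by
      have : d - y ≠ 0 := by linarith
      field_simp; ring
    rw [this]
    exact div_le_div_of_nonneg_left (by linarith) hδ (by linarith)
  unfold crossLog
  rw [abs_sub_comm, abs_of_pos (by linarith : 0 < y - x)]
  have : (C + 2 / δ) * (y - x) = C * (y - x) + 2 * ((y - x) / δ) := by ring
  linarith

lemma lap_crossLog_right {F : ℝ → ℝ} {a b : ℝ} (hF : ContDiff ℝ 2 F)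
    (h0 : ∀ x ∈ Ioo a b, deriv F x ≠ 0) (ha : PowRight F a)
    (hb : PowRight (fun t => F (-t)) (-b)) :
    ∃ C ≥ 0, ∀ x y d, a < x → x < y → y < d → d < b → -(C * |x - y|) ≤ crossLog F x y d := by
  obtain ⟨δ, hδ, H1⟩ := lap_crossLog_small hF h0 ha hb one_pos
  obtain ⟨C, hC, H2⟩ := lap_crossLog_far hF h0 ha (half_pos hδ)
  refine ⟨C + 1, by linarith, ?_⟩
  intro x y d hx hxy hyd hd
  have near : ∀ z w, a < z → z < w → w < d → d - z < δ → -((C + 1) * |z - w|) ≤ crossLog F z w d := by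
    intro z w hz hzw hwd hlt
    have := H1 z ⟨hz, by linarith⟩ d ⟨by linarith, hd⟩ w (Or.inl ⟨hzw, hwd⟩)
      (by rw [abs_of_pos (by linarith)]; exact hlt)
    nlinarith [abs_nonneg (z - w)]
  have far : ∀ z w, a < z → z < w → w ≤ d - δ / 2 → -((C + 1) * |z - w|) ≤ crossLog F z w d := by
    intro z w hz hzw hwd
    have := H2 z w d hz hzw hd hwd
    nlinarith [abs_nonneg (z - w)]
  by_cases c1 : d - x < δ
  · exact near x y hx hxy hyd c1
  by_cases c2 : y ≤ d - δ / 2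
  · exact far x y hx hxy c2
  push Not at c1 c2
  have f1 := far x (d - δ / 2) hx (by linarith) le_rfl
  have f2 := near (d - δ / 2) y (by linarith) c2 hyd (by linarith)
  rw [crossLog_split F x (d - δ / 2) y d]
  rw [abs_sub_comm, abs_of_pos (by linarith)] at f1 f2 ⊢
  linarith

lemma lap_crossLog {F : ℝ → ℝ} {a b : ℝ} (hF : ContDiff ℝ 2 F)
    (h0 : ∀ x ∈ Ioo a b, deriv F x ≠ 0) (ha : PowRight F a)
    (hb : PowRight (fun t => F (-t)) (-b)) :
    ∃ C ≥ 0, ∀ x ∈ Ioo a b, ∀ d ∈ Ioo a b, ∀ y, Betw x y d → -(C * |x - y|) ≤ crossLog F x y d := by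
  obtain ⟨C1, hC1, H1⟩ := lap_crossLog_right hF h0 ha hb
  obtain ⟨C2, hC2, H2⟩ := lap_crossLog_right (F := fun t => F (-t)) (a := -b) (b := -a)
    (hF.comp contDiff_neg) (fun x hx => by
      rw [deriv_comp_neg]
      exact neg_ne_zero.2 (h0 (-x) ⟨by linarith [hx.2], by linarith [hx.1]⟩)) hb (by simpa using ha)
  refine ⟨max C1 C2, le_max_of_le_left hC1, ?_⟩
  intro x hx d hd y hbt
  have n := abs_nonneg (x - y)
  rcases hbt with h | h
  · have := H1 x y d hx.1 h.1 h.2 hd.2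
    have : C1 * |x - y| ≤ max C1 C2 * |x - y| := mul_le_mul_of_nonneg_right (le_max_left _ _) n
    linarith
  · have := H2 (-x) (-y) (-d) (by linarith [hx.2]) (by linarith) (by linarith) (by linarith [hd.1])
    rw [crossLog_reflect, show -x - -y = -(x - y) by ring, abs_neg] at this
    have : C2 * |x - y| ≤ max C1 C2 * |x - y| := mul_le_mul_of_nonneg_right (le_max_right _ _) n
    linarith

/-- The data of a bimodal lift used in the analysis on the line. -/
structure Bim where
  F : ℝ → ℝ
  p : ℝ
  q : ℝ
  dp : ℝ
  dq : ℝ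
  lift : ∀ x, F (x + 1) = F x + 1
  smooth : ContDiff ℝ 2 F
  hpq : p < q
  hqp : q < p + 1
  decr : ∀ x ∈ Ioo p q, deriv F x < 0
  incr : ∀ x ∈ Ioo q (p + 1), 0 < deriv F x
  hdp : dp ∈ Ioo q (p + 1)
  hdq : dq ∈ Ioo (q - 1) p
  avp : ∀ n : ℕ, 1 ≤ n → ∀ k : ℤ, F^[n] p - k ∉ Icc p dp
  avq : ∀ n : ℕ, 1 ≤ n → ∀ k : ℤ, F^[n] q - k ∉ Icc dq q
  rep : ∀ (x : ℝ) (n : ℕ), 1 ≤ n → (∃ m : ℤ, F^[n] x = x + m) → 1 < |deriv (F^[n]) x|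
  cross : ∃ E ≥ 0, ∀ x y d, (∀ z ∈ uIcc x d, deriv F z ≠ 0) → Betw x y d →
    -(E * |x - y|) ≤ crossLog F x y d
  cross_small : ∀ η > 0, ∃ δ > 0, ∀ x y d, (∀ z ∈ uIcc x d, deriv F z ≠ 0) → Betw x y d →
    |d - x| < δ → -(η * |x - y|) ≤ crossLog F x y d

lemma PowRight.of_nonflat {F ψ : ℝ → ℝ} {c l s : ℝ} (hl : 1 < l) (hs : s ≠ 0)
    (hψ : ContDiff ℝ 2 ψ) (hD : ∀ x, deriv ψ x ≠ 0) (h0 : ψ c = 0)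
    (h : ∀ᶠ x in nhds c, F x = F c + s * |ψ x| ^ l) : PowRight F c := by
  have hc : Continuous (deriv ψ) := hψ.contDiff_one_deriv.continuous
  obtain ⟨ρ, hρ, hball⟩ := Metric.eventually_nhds_iff.1 h
  have hmem : ∀ x ∈ Ioo c (c + ρ), F x = F c + s * |ψ x| ^ l := by
    intro x hx
    apply hball
    rw [Real.dist_eq, abs_of_pos (by linarith [hx.1])]; linarith [hx.2]
  by_cases hpos : ∀ x, 0 < deriv ψ x
  · refine ⟨l, ψ, s, ρ, hl, hψ, hpos, hs, hρ, fun x hx => ?_⟩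
    have : 0 < ψ x := by rw [← h0]; exact strictMono_of_deriv_pos hpos hx.1
    refine ⟨this, ?_⟩
    rw [hmem x hx, abs_of_pos this]
  · push Not at hpos
    obtain ⟨x0, hx0⟩ := hpos
    have hneg : ∀ x, deriv ψ x < 0 := by
      intro x
      by_contra hx
      push Not at hx
      obtain ⟨z, hz⟩ := mem_range_of_exists_le_of_exists_ge hc ⟨x0, hx0⟩ ⟨x, hx⟩
      exact hD z hz
    have hpos' : ∀ x, 0 < deriv (fun t => -ψ t) x := by
      intro x; rw [deriv.fun_neg]; linarith [hneg x]
    refine ⟨l, fun t => -ψ t, s, ρ, hl, hψ.neg, hpos', hs, hρ, fun x hx => ?_⟩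
    have : 0 < -ψ x := by
      have := strictMono_of_deriv_pos hpos' hx.1
      simpa [h0] using this
    refine ⟨this, ?_⟩
    rw [hmem x hx, abs_of_neg (by linarith)]

lemma PowRight.of_nonflat_left {F ψ : ℝ → ℝ} {c l s : ℝ} (hl : 1 < l) (hs : s ≠ 0)
    (hψ : ContDiff ℝ 2 ψ) (hD : ∀ x, deriv ψ x ≠ 0) (h0 : ψ c = 0)
    (h : ∀ᶠ x in nhds c, F x = F c + s * |ψ x| ^ l) : PowRight (fun t => F (-t)) (-c) := by
  refine PowRight.of_nonflat (ψ := fun t => ψ (-t)) hl hs (hψ.comp contDiff_neg) (fun x => ?_)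
    (by simpa using h0) ?_
  · rw [deriv_comp_neg]; exact neg_ne_zero.2 (hD _)
  · have : Tendsto (fun t : ℝ => -t) (nhds (-c)) (nhds c) := by
      simpa using (continuous_neg (G := ℝ)).tendsto (-c)
    simpa using this.eventually h

lemma nonflat_translate {F ψ : ℝ → ℝ} {c l s : ℝ} (hF : ∀ x, F (x + 1) = F x + 1)
    (h : ∀ᶠ x in nhds c, F x = F c + s * |ψ x| ^ l) :
    ∀ᶠ x in nhds (c + 1), F x = F (c + 1) + s * |ψ (x - 1)| ^ l := by
  have : Tendsto (fun t : ℝ => t - 1) (nhds (c + 1)) (nhds c) := by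
    have := (continuous_sub_right (1:ℝ)).tendsto (c + 1)
    simpa using this
  filter_upwards [this.eventually h] with x hx
  have := hF (x - 1)
  rw [sub_add_cancel] at this
  rw [this, hx, hF]; ring

lemma map_add_int_of_lift {F : ℝ → ℝ} (hF : ∀ x, F (x + 1) = F x + 1) (x : ℝ) (k : ℤ) :
    F (x + k) = F x + k := by
  induction k using Int.induction_on with
  | zero => simp
  | succ n ih => push_cast at *; rw [← add_assoc, hF, ih]; ring
  | pred n ih =>
    push_cast at *
    have := hF (x + (-n - 1))
    rw [show x + (-(n:ℝ) - 1) + 1 = x + -n by ring, ih] at this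
    linarith

lemma not_mem_flat {G : CircleDeg1Lift} {F : ℝ → ℝ} (hF : ∀ x, F (x + 1) = F x + 1) {a b x0 v : ℝ}
    (h1 : ∀ x ∈ Icc a b, G x = v) (h2 : ∀ x ∈ Icc b (a + 1), G x = F x) (hx0 : x0 ∈ Icc a b)
    (hv : F x0 = v) (hirr : Irrational G.translationNumber) (n : ℕ) (hn : 1 ≤ n) (k : ℤ) :
    F^[n] x0 - k ∉ Icc a b := by
  induction n using Nat.strong_induction_on generalizing k with
  | _ n ih =>
  have key : ∀ j, 1 ≤ j → j ≤ n → F^[j] x0 = G^[j] x0 := by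
    intro j hj
    induction j, hj using Nat.le_induction with
    | base => intro _; simp [hv, h1 x0 hx0]
    | succ j hj ihj =>
      intro hjn
      have e := ihj (by omega)
      rw [Function.iterate_succ_apply', Function.iterate_succ_apply', ← e]
      set y := F^[j] x0 with hy
      have hne := ih j (by omega) hj ⌊y - a⌋
      rw [← hy] at hne
      have f1 := Int.floor_le (y - a)
      have f2 := Int.lt_floor_add_one (y - a)
      have : y - ⌊y - a⌋ ∈ Icc b (a + 1) := by
        constructor
        · by_contra hc
          exact hne ⟨by linarith, by linarith⟩
        · linarith
      have h3 := h2 _ this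
      have e1 := map_add_int_of_lift hF (y - ⌊y - a⌋) ⌊y - a⌋
      have e2 := G.map_add_int (y - ⌊y - a⌋) ⌊y - a⌋
      rw [sub_add_cancel] at e1 e2
      rw [e1, e2, h3]
  intro hmem
  have e := key n hn le_rfl
  have e1 := h1 _ hmem
  rw [e] at e1
  have e2 := G.map_add_int (G^[n] x0 - k) k
  rw [sub_add_cancel, e1, ← h1 x0 hx0, ← Function.iterate_succ_apply' (⇑G), Function.iterate_succ_apply,
    ← CircleDeg1Lift.coe_pow] at e2
  have := CircleDeg1Lift.translationNumber_of_map_pow_eq_add_int G e2 hn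
  rw [this] at hirr
  exact hirr ⟨(k : ℚ) / n, by push_cast; rfl⟩

lemma deriv_translate {F : ℝ → ℝ} (hF : ∀ x, F (x + 1) = F x + 1) (x : ℝ) (k : ℤ) :
    deriv F (x + k) = deriv F x := by
  have : (fun y => F (y + k)) = fun y => F y + k := by
    ext y; exact map_add_int_of_lift hF y k
  rw [← deriv_comp_add_const F (k:ℝ) x, this, deriv_add_const]

lemma crossLog_translate {F : ℝ → ℝ} (hF : ∀ x, F (x + 1) = F x + 1) (x y d : ℝ) (k : ℤ) :
    crossLog F (x + k) (y + k) (d + k) = crossLog F x y d := by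
  unfold crossLog
  rw [deriv_translate hF, deriv_translate hF, map_add_int_of_lift hF, map_add_int_of_lift hF,
    map_add_int_of_lift hF]
  simp only [add_sub_add_right_eq_sub]

lemma deriv_eq_zero_of_sign {g : ℝ → ℝ} (hg : Continuous g) {a c b : ℝ} (hac : a < c) (hcb : c < b)
    (h1 : ∀ x ∈ Ioo a c, g x ≤ 0) (h2 : ∀ x ∈ Ioo c b, 0 ≤ g x) : g c = 0 := by
  apply le_antisymm
  · have : c ∈ closure (Ioo a c) := by rw [closure_Ioo hac.ne]; exact ⟨hac.le, le_rfl⟩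
    exact closure_minimal (fun x hx => h1 x hx) (isClosed_le hg continuous_const) this
  · have : c ∈ closure (Ioo c b) := by rw [closure_Ioo hcb.ne]; exact ⟨le_rfl, hcb.le⟩
    exact closure_minimal (fun x hx => h2 x hx) (isClosed_le continuous_const hg) this

lemma mem_lap_of_regular {F : ℝ → ℝ} (hF : ∀ x, F (x + 1) = F x + 1) {p q : ℝ}
    (hp : deriv F p = 0) (hq : deriv F q = 0) {x d : ℝ}
    (h : ∀ z ∈ uIcc x d, deriv F z ≠ 0) :
    ∃ k : ℤ, (x + k ∈ Ioo p q ∧ d + k ∈ Ioo p q) ∨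
      (x + k ∈ Ioo q (p + 1) ∧ d + k ∈ Ioo q (p + 1)) := by
  have hp' : ∀ k : ℤ, ∀ z ∈ uIcc x d, z + k ≠ p := by
    intro k z hz e
    exact h z hz (by rw [← deriv_translate hF z k, e, hp])
  have hq' : ∀ k : ℤ, ∀ z ∈ uIcc x d, z + k ≠ q := by
    intro k z hz e
    exact h z hz (by rw [← deriv_translate hF z k, e, hq])
  have side : ∀ (c : ℝ) (k : ℤ), (∀ z ∈ uIcc x d, z + k ≠ c) → (c < x + k ↔ c < d + k) := by
    intro c k hc
    have hxc := hc x left_mem_uIcc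
    have hdc := hc d right_mem_uIcc
    constructor
    · intro h1
      by_contra h2
      push Not at h2
      exact hc (c - k) (by rw [uIcc_of_ge (by linarith)]; exact ⟨by linarith, by linarith⟩) (by ring)
    · intro h1
      by_contra h2
      push Not at h2
      exact hc (c - k) (by rw [uIcc_of_le (by linarith)]; exact ⟨by linarith, by linarith⟩) (by ring)
  set k : ℤ := -⌊x - p⌋ with hk
  have f1 := Int.floor_le (x - p)
  have f2 := Int.lt_floor_add_one (x - p)
  have kk : (k : ℝ) = -(⌊x - p⌋ : ℝ) := by rw [hk]; push_cast; rfl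
  have hx1 : p < x + k := lt_of_le_of_ne (by linarith) (hp' k x left_mem_uIcc).symm
  have hx2 : x + k < p + 1 := by linarith
  have hd1 := (side p k (hp' k)).1 hx1
  have hp1 : ∀ z ∈ uIcc x d, z + k ≠ p + 1 := by
    intro z hz e
    exact hp' (k - 1) z hz (by push_cast; linarith)
  have hd2 : d + k < p + 1 := by
    by_contra hc
    push Not at hc
    have := (side (p + 1) k hp1).2 (lt_of_le_of_ne hc (hp1 d right_mem_uIcc).symm)
    linarith
  refine ⟨k, ?_⟩
  by_cases c : q < x + k
  · right; exact ⟨⟨c, hx2⟩, (side q k (hq' k)).1 c, hd2⟩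
  · left
    have c2 : ¬ q < d + k := fun h => c ((side q k (hq' k)).2 h)
    push Not at c c2
    exact ⟨⟨hx1, lt_of_le_of_ne c (hq' k x left_mem_uIcc)⟩,
      hd1, lt_of_le_of_ne c2 (hq' k d right_mem_uIcc)⟩

lemma Betw.add {x y d : ℝ} (h : Betw x y d) (k : ℝ) : Betw (x + k) (y + k) (d + k) := by
  rcases h with h | h
  · left; constructor <;> linarith [h.1, h.2]
  · right; constructor <;> linarith [h.1, h.2]

/-- The line data underlying a bimodal circle map. -/
def BimodData.toBim (B : BimodData) : Bim :=
  have hc : Continuous (deriv B.F) := B.hC2.contDiff_one_deriv.continuous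
  have hp0 : deriv B.F B.ctp = 0 := by
    have : (fun x => - deriv B.F x) B.ctp = 0 := by
      refine deriv_eq_zero_of_sign (g := fun x => -deriv B.F x) hc.neg (a := B.ctm - 1) (b := B.ctm) (by linarith [B.h0, B.h2]) B.h1 ?_ ?_
      · intro x hx
        have h := B.hincr (x + 1) ⟨by linarith [hx.1], by linarith [hx.2]⟩
        have e := deriv_translate B.hlift x 1
        push_cast at e
        rw [e] at h
        linarith
      · intro x hx
        have := B.hdecr x hx
        linarith
    simpa using this
  have hq0 : deriv B.F B.ctm = 0 :=
    deriv_eq_zero_of_sign hc (a := B.ctp) (b := B.ctp + 1) B.h1 (by linarith [B.h0, B.h2])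
      (fun x hx => (B.hdecr x hx).le) (fun x hx => (B.hincr x hx).le)
  have np : ∀ᶠ x in nhds B.ctp, B.F x = B.F B.ctp + (-1) * |B.psip x| ^ B.lp := by
    filter_upwards [B.hpsipEq] with x hx; rw [hx]; ring
  have nm : ∀ᶠ x in nhds B.ctm, B.F x = B.F B.ctm + 1 * |B.psim x| ^ B.lm := by
    filter_upwards [B.hpsimEq] with x hx; rw [hx]; ring
  have pR := PowRight.of_nonflat B.hlp (by norm_num) B.hpsipC2 B.hpsipD B.hpsip0 np
  have qR := PowRight.of_nonflat B.hlm (by norm_num) B.hpsimC2 B.hpsimD B.hpsim0 nm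
  have qL := PowRight.of_nonflat_left B.hlm (by norm_num) B.hpsimC2 B.hpsimD B.hpsim0 nm
  have pL : PowRight (fun t => B.F (-t)) (-(B.ctp + 1)) :=
    PowRight.of_nonflat_left (ψ := fun x => B.psip (x - 1)) B.hlp (by norm_num)
      (B.hpsipC2.comp (contDiff_id.sub contDiff_const))
      (fun x => by rw [deriv_comp_sub_const]; exact B.hpsipD _) (by simpa using B.hpsip0)
      (nonflat_translate B.hlift np)
  { F := B.F
    p := B.ctp
    q := B.ctm
    dp := B.dtp
    dq := B.dtm
    lift := B.hlift
    smooth := B.hC2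
    hpq := B.h1
    hqp := by linarith [B.h0, B.h2]
    decr := B.hdecr
    incr := B.hincr
    hdp := B.hdtp
    hdq := B.hdtm
    avp := fun n hn k => not_mem_flat B.hlift B.hFp1 B.hFp2 ⟨le_rfl, by linarith [B.h1, B.hdtp.1]⟩ rfl
      B.hirrp n hn k
    avq := fun n hn k => not_mem_flat B.hlift B.hFm1 B.hFm2 ⟨by linarith [B.h1, B.hdtm.2], le_rfl⟩ rfl
      B.hirrm n hn k
    rep := B.hA3
    cross := by
      obtain ⟨C1, hC1, H1⟩ := lap_crossLog B.hC2 (fun x hx => (B.hdecr x hx).ne) pR qL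
      obtain ⟨C2, hC2, H2⟩ := lap_crossLog B.hC2 (fun x hx => (B.hincr x hx).ne') qR pL
      refine ⟨max C1 C2, le_max_of_le_left hC1, fun x y d h hb => ?_⟩
      obtain ⟨k, hk⟩ := mem_lap_of_regular B.hlift hp0 hq0 h
      rw [← crossLog_translate B.hlift x y d k, ← add_sub_add_right_eq_sub x y (k:ℝ)]
      rcases hk with hk | hk
      · refine le_trans ?_ (H1 _ hk.1 _ hk.2 _ (hb.add k))
        exact neg_le_neg (mul_le_mul_of_nonneg_right (le_max_left _ _) (abs_nonneg _))
      · refine le_trans ?_ (H2 _ hk.1 _ hk.2 _ (hb.add k))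
        exact neg_le_neg (mul_le_mul_of_nonneg_right (le_max_right _ _) (abs_nonneg _))
    cross_small := by
      intro η hη
      obtain ⟨δ1, hδ1, H1⟩ := lap_crossLog_small B.hC2 (fun x hx => (B.hdecr x hx).ne) pR qL hη
      obtain ⟨δ2, hδ2, H2⟩ := lap_crossLog_small B.hC2 (fun x hx => (B.hincr x hx).ne') qR pL hη
      refine ⟨min δ1 δ2, lt_min hδ1 hδ2, fun x y d h hb hlt => ?_⟩
      obtain ⟨k, hk⟩ := mem_lap_of_regular B.hlift hp0 hq0 h
      rw [← crossLog_translate B.hlift x y d k, ← add_sub_add_right_eq_sub x y (k:ℝ)]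
      rw [← add_sub_add_right_eq_sub d x (k:ℝ)] at hlt
      rcases hk with hk | hk
      · exact H1 _ hk.1 _ hk.2 _ (hb.add k) (hlt.trans_le (min_le_left _ _))
      · exact H2 _ hk.1 _ hk.2 _ (hb.add k) (hlt.trans_le (min_le_right _ _)) }

namespace Bim

variable (B : Bim)

/-- The derivative of the `n`-th iterate. -/
def dn (n : ℕ) (x : ℝ) : ℝ := deriv (B.F^[n]) x

lemma iter_add_int (n : ℕ) (x : ℝ) (k : ℤ) : B.F^[n] (x + k) = B.F^[n] x + k := by
  induction n with
  | zero => rfl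
  | succ n ih => rw [Function.iterate_succ_apply', ih, map_add_int_of_lift B.lift,
      Function.iterate_succ_apply']

lemma iter_sub_int (n : ℕ) (x : ℝ) (k : ℤ) : B.F^[n] (x - k) = B.F^[n] x - k := by
  have := B.iter_add_int n x (-k)
  push_cast at this
  simpa [sub_eq_add_neg] using this

lemma contDiff_iter (n : ℕ) : ContDiff ℝ 2 (B.F^[n]) := by
  induction n with
  | zero => exact contDiff_id
  | succ n ih => rw [Function.iterate_succ]; exact ih.comp B.smooth

lemma differentiable (n : ℕ) : Differentiable ℝ (B.F^[n]) :=
  (B.contDiff_iter n).differentiable (by norm_num)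

lemma continuous_iter (n : ℕ) : Continuous (B.F^[n]) := (B.differentiable n).continuous

lemma continuous_dn (n : ℕ) : Continuous (B.dn n) :=
  (B.contDiff_iter n).contDiff_one_deriv.continuous

lemma hasDerivAt_iter (n : ℕ) (x : ℝ) : HasDerivAt (B.F^[n]) (B.dn n x) x :=
  (B.differentiable n x).hasDerivAt

@[simp] lemma dn_zero (x : ℝ) : B.dn 0 x = 1 := by simp [dn]

@[simp] lemma dn_one (x : ℝ) : B.dn 1 x = deriv B.F x := by simp [dn]

lemma iter_add (m n : ℕ) (x : ℝ) : B.F^[m + n] x = B.F^[m] (B.F^[n] x) :=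
  Function.iterate_add_apply _ _ _ _

lemma dn_add (m n : ℕ) (x : ℝ) : B.dn (m + n) x = B.dn m (B.F^[n] x) * B.dn n x := by
  unfold dn
  rw [Function.iterate_add]
  exact deriv_comp x (B.differentiable m _) (B.differentiable n x)

lemma dn_translate (n : ℕ) (x : ℝ) (k : ℤ) : B.dn n (x + k) = B.dn n x := by
  unfold dn
  have : (fun y => B.F^[n] (y + k)) = fun y => B.F^[n] y + k := by
    ext y; exact B.iter_add_int n y k
  rw [← deriv_comp_add_const (B.F^[n]) (k:ℝ) x, this, deriv_add_const]

lemma dn_ne_zero_of_le {m n : ℕ} (h : m ≤ n) {x : ℝ} (hx : B.dn n x ≠ 0) : B.dn m x ≠ 0 := by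
  obtain ⟨k, rfl⟩ := Nat.exists_eq_add_of_le' h
  rw [dn_add] at hx
  exact right_ne_zero_of_mul hx

lemma deriv_p : deriv B.F B.p = 0 := by
  have hc : Continuous (deriv B.F) := B.smooth.contDiff_one_deriv.continuous
  have : (fun x => - deriv B.F x) B.p = 0 := by
    refine deriv_eq_zero_of_sign (g := fun x => - deriv B.F x) hc.neg (a := B.q - 1) (b := B.q)
      (by linarith [B.hqp]) B.hpq ?_ ?_
    · intro x hx
      have h := B.incr (x + 1) ⟨by linarith [hx.1], by linarith [hx.2]⟩
      have e := deriv_translate B.lift x 1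
      push_cast at e
      rw [e] at h
      linarith
    · intro x hx
      have := B.decr x hx
      linarith
  simpa using this

lemma deriv_q : deriv B.F B.q = 0 :=
  deriv_eq_zero_of_sign B.smooth.contDiff_one_deriv.continuous (a := B.p) (b := B.p + 1) B.hpq B.hqp
    (fun x hx => (B.decr x hx).le) (fun x hx => (B.incr x hx).le)

lemma exists_lap (x : ℝ) : ∃ k : ℤ, x - k = B.p ∨ x - k ∈ Ioo B.p B.q ∨ x - k = B.q ∨
    x - k ∈ Ioo B.q (B.p + 1) := by
  refine ⟨⌊x - B.p⌋, ?_⟩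
  have f1 := Int.floor_le (x - B.p)
  have f2 := Int.lt_floor_add_one (x - B.p)
  rcases eq_or_lt_of_le (show B.p ≤ x - ⌊x - B.p⌋ by linarith) with h | h
  · left; exact h.symm
  rcases lt_trichotomy (x - ⌊x - B.p⌋) B.q with h1 | h1 | h1
  · right; left; exact ⟨h, h1⟩
  · right; right; left; exact h1
  · right; right; right; exact ⟨h1, by linarith⟩

lemma deriv_sub_int (x : ℝ) (k : ℤ) : deriv B.F (x - k) = deriv B.F x := by
  have := deriv_translate B.lift x (-k)
  push_cast at this
  simpa [sub_eq_add_neg] using this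

lemma deriv_eq_zero_iff (x : ℝ) : deriv B.F x = 0 ↔ ∃ k : ℤ, x - k = B.p ∨ x - k = B.q := by
  constructor
  · intro h
    obtain ⟨k, hk⟩ := B.exists_lap x
    rw [← B.deriv_sub_int x k] at h
    rcases hk with hk | hk | hk | hk
    · exact ⟨k, Or.inl hk⟩
    · exact absurd h (B.decr _ hk).ne
    · exact ⟨k, Or.inr hk⟩
    · exact absurd h (B.incr _ hk).ne'
  · rintro ⟨k, hk | hk⟩
    · rw [← B.deriv_sub_int x k, hk, deriv_p]
    · rw [← B.deriv_sub_int x k, hk, deriv_q]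

lemma deriv_neg_iff (x : ℝ) : deriv B.F x < 0 ↔ ∃ k : ℤ, x - k ∈ Ioo B.p B.q := by
  constructor
  · intro h
    obtain ⟨k, hk⟩ := B.exists_lap x
    rw [← B.deriv_sub_int x k] at h
    rcases hk with hk | hk | hk | hk
    · rw [hk, deriv_p] at h; exact absurd h (lt_irrefl _)
    · exact ⟨k, hk⟩
    · rw [hk, deriv_q] at h; exact absurd h (lt_irrefl _)
    · exact absurd h (B.incr _ hk).le.not_gt
  · rintro ⟨k, hk⟩
    rw [← B.deriv_sub_int x k]; exact B.decr _ hk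

/-- The `n`-th iterate has no critical point in `S`. -/
def Reg (n : ℕ) (S : Set ℝ) : Prop := ∀ x ∈ S, B.dn n x ≠ 0

variable {B}

lemma Reg.subset {n : ℕ} {S T : Set ℝ} (h : B.Reg n S) (hT : T ⊆ S) : B.Reg n T :=
  fun x hx => h x (hT hx)

lemma Reg.of_le {m n : ℕ} {S : Set ℝ} (h : B.Reg n S) (hm : m ≤ n) : B.Reg m S :=
  fun x hx => B.dn_ne_zero_of_le hm (h x hx)

lemma Reg.sign {n : ℕ} {a b : ℝ} (h : B.Reg n (Ioo a b)) :
    (∀ x ∈ Ioo a b, 0 < B.dn n x) ∨ (∀ x ∈ Ioo a b, B.dn n x < 0) := by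
  by_contra hcon
  push Not at hcon
  obtain ⟨⟨z1, hz1, h1⟩, z2, hz2, h2⟩ := hcon
  obtain ⟨z, hz, hz0⟩ := (isPreconnected_Ioo.intermediate_value hz1 hz2
    (B.continuous_dn n).continuousOn) ⟨h1, h2⟩
  exact h z hz hz0

lemma Reg.mono_or_anti {n : ℕ} {a b : ℝ} (h : B.Reg n (Ioo a b)) :
    StrictMonoOn (B.F^[n]) (Icc a b) ∨ StrictAntiOn (B.F^[n]) (Icc a b) := by
  rcases h.sign with h | h
  · left
    exact strictMonoOn_of_deriv_pos (convex_Icc a b) (B.continuous_iter n).continuousOn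
      (by simpa [dn] using h)
  · right
    exact strictAntiOn_of_deriv_neg (convex_Icc a b) (B.continuous_iter n).continuousOn
      (by simpa [dn] using h)

lemma Reg.injOn {n : ℕ} {a b : ℝ} (h : B.Reg n (Ioo a b)) : InjOn (B.F^[n]) (Icc a b) := by
  rcases h.mono_or_anti with h | h
  · exact h.injOn
  · exact h.injOn

variable (B)

/-- `F^n` maps `(a, b)` diffeomorphically onto `(A, C)`. -/
structure Pb (n : ℕ) (a b A C : ℝ) : Prop where
  lt : a < b
  reg : B.Reg n (Ioo a b)
  ends : (StrictMonoOn (B.F^[n]) (Icc a b) ∧ B.F^[n] a = A ∧ B.F^[n] b = C) ∨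
    (StrictAntiOn (B.F^[n]) (Icc a b) ∧ B.F^[n] a = C ∧ B.F^[n] b = A)

variable {B}

lemma Reg.exists_pb {n : ℕ} {a b : ℝ} (h : B.Reg n (Ioo a b)) (hab : a < b) :
    ∃ A C, B.Pb n a b A C := by
  rcases h.mono_or_anti with h1 | h1
  · exact ⟨_, _, hab, h, Or.inl ⟨h1, rfl, rfl⟩⟩
  · exact ⟨_, _, hab, h, Or.inr ⟨h1, rfl, rfl⟩⟩

namespace Pb

variable {n m : ℕ} {a b A C A' C' : ℝ}

lemma lt' (h : B.Pb n a b A C) : A < C := by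
  rcases h.ends with ⟨h1, rfl, rfl⟩ | ⟨h1, rfl, rfl⟩
  · exact h1 (left_mem_Icc.2 h.lt.le) (right_mem_Icc.2 h.lt.le) h.lt
  · exact h1 (left_mem_Icc.2 h.lt.le) (right_mem_Icc.2 h.lt.le) h.lt

lemma injOn (h : B.Pb n a b A C) : InjOn (B.F^[n]) (Icc a b) := h.reg.injOn

lemma image_Icc (h : B.Pb n a b A C) : B.F^[n] '' Icc a b = Icc A C := by
  rcases h.ends with ⟨h1, rfl, rfl⟩ | ⟨h1, rfl, rfl⟩
  · exact ContinuousOn.image_Icc_of_monotoneOn h.lt.le (B.continuous_iter n).continuousOn h1.monotoneOn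
  · exact ContinuousOn.image_Icc_of_antitoneOn h.lt.le (B.continuous_iter n).continuousOn h1.antitoneOn

lemma mem_Ioo (h : B.Pb n a b A C) {x : ℝ} (hx : x ∈ Ioo a b) : B.F^[n] x ∈ Ioo A C := by
  have hI := Ioo_subset_Icc_self hx
  rcases h.ends with ⟨h1, rfl, rfl⟩ | ⟨h1, rfl, rfl⟩
  · exact ⟨h1 (left_mem_Icc.2 h.lt.le) hI hx.1, h1 hI (right_mem_Icc.2 h.lt.le) hx.2⟩
  · exact ⟨h1 hI (right_mem_Icc.2 h.lt.le) hx.2, h1 (left_mem_Icc.2 h.lt.le) hI hx.1⟩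

lemma mem_Icc (h : B.Pb n a b A C) {x : ℝ} (hx : x ∈ Icc a b) : B.F^[n] x ∈ Icc A C := by
  rw [← h.image_Icc]; exact mem_image_of_mem _ hx

lemma left_mem (h : B.Pb n a b A C) : B.F^[n] a = A ∨ B.F^[n] a = C := by
  rcases h.ends with h1 | h1 <;> tauto

lemma right_mem (h : B.Pb n a b A C) : B.F^[n] b = A ∨ B.F^[n] b = C := by
  rcases h.ends with h1 | h1 <;> tauto

lemma exists_preimage (h : B.Pb n a b A C) {y : ℝ} (hy : y ∈ Ioo A C) :
    ∃ x ∈ Ioo a b, B.F^[n] x = y := by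
  have : y ∈ B.F^[n] '' Icc a b := by rw [h.image_Icc]; exact Ioo_subset_Icc_self hy
  obtain ⟨x, hx, rfl⟩ := this
  refine ⟨x, ⟨lt_of_le_of_ne hx.1 ?_, lt_of_le_of_ne hx.2 ?_⟩, rfl⟩
  · rintro rfl
    rcases h.left_mem with e | e <;> rw [e] at hy <;> [exact lt_irrefl _ hy.1; exact lt_irrefl _ hy.2]
  · rintro rfl
    rcases h.right_mem with e | e <;> rw [e] at hy <;> [exact lt_irrefl _ hy.1; exact lt_irrefl _ hy.2]

lemma image_Ioo (h : B.Pb n a b A C) : B.F^[n] '' Ioo a b = Ioo A C := by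
  ext y
  constructor
  · rintro ⟨x, hx, rfl⟩; exact h.mem_Ioo hx
  · intro hy; exact h.exists_preimage hy

lemma length (h : B.Pb n a b A C) : |B.F^[n] b - B.F^[n] a| = C - A := by
  have := h.lt'
  rcases h.ends with ⟨h1, e1, e2⟩ | ⟨h1, e1, e2⟩ <;> rw [e1, e2]
  · exact abs_of_pos (by linarith)
  · rw [abs_of_neg (by linarith)]; ring

lemma comp (h : B.Pb n a b A C) (h' : B.Pb m A C A' C') : B.Pb (m + n) a b A' C' := by
  refine ⟨h.lt, ?_, ?_⟩
  · intro x hx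
    rw [dn_add]
    exact mul_ne_zero (h'.reg _ (h.mem_Ioo hx)) (h.reg x hx)
  · have e : B.F^[m + n] = B.F^[m] ∘ B.F^[n] := Function.iterate_add _ _ _
    have hm : MapsTo (B.F^[n]) (Icc a b) (Icc A C) := fun x hx => h.mem_Icc hx
    rw [e]
    simp only [Function.comp]
    rcases h.ends with ⟨h1, e1, e2⟩ | ⟨h1, e1, e2⟩ <;> rcases h'.ends with ⟨h2, e3, e4⟩ | ⟨h2, e3, e4⟩ <;>
      rw [e1, e2, e3, e4]
    · exact Or.inl ⟨fun x hx y hy hxy => h2 (hm hx) (hm hy) (h1 hx hy hxy), rfl, rfl⟩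
    · exact Or.inr ⟨fun x hx y hy hxy => h2 (hm hx) (hm hy) (h1 hx hy hxy), rfl, rfl⟩
    · exact Or.inr ⟨fun x hx y hy hxy => h2 (hm hy) (hm hx) (h1 hx hy hxy), rfl, rfl⟩
    · exact Or.inl ⟨fun x hx y hy hxy => h2 (hm hy) (hm hx) (h1 hx hy hxy), rfl, rfl⟩

lemma pullback (h : B.Pb n a b A C) (h1 : A ≤ A') (h2 : A' < C') (h3 : C' ≤ C) :
    ∃ a' b', a ≤ a' ∧ b' ≤ b ∧ B.Pb n a' b' A' C' := by
  have m1 : A' ∈ B.F^[n] '' Icc a b := by rw [h.image_Icc]; exact ⟨h1, by linarith⟩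
  have m2 : C' ∈ B.F^[n] '' Icc a b := by rw [h.image_Icc]; exact ⟨by linarith, h3⟩
  obtain ⟨u, hu, rfl⟩ := m1
  obtain ⟨v, hv, rfl⟩ := m2
  rcases h.ends with ⟨hs, -, -⟩ | ⟨hs, -, -⟩
  · have huv : u < v := (hs.lt_iff_lt hu hv).1 h2
    refine ⟨u, v, hu.1, hv.2, huv, h.reg.subset (Ioo_subset_Ioo hu.1 hv.2), ?_⟩
    exact Or.inl ⟨hs.mono (Icc_subset_Icc hu.1 hv.2), rfl, rfl⟩
  · have huv : v < u := (hs.lt_iff_gt hu hv).1 h2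
    refine ⟨v, u, hv.1, hu.2, huv, h.reg.subset (Ioo_subset_Ioo hv.1 hu.2), ?_⟩
    exact Or.inr ⟨hs.mono (Icc_subset_Icc hv.1 hu.2), rfl, rfl⟩

/-- a point of `(a,b)` whose image is in `(A',C')` lies in any sub-pull-back -/
lemma mem_of_image (h : B.Pb n a b A C) {a' b' : ℝ} (ha : a ≤ a') (hb : b' ≤ b)
    (h' : B.Pb n a' b' A' C') {x : ℝ} (hx : x ∈ Icc a b) (hx' : B.F^[n] x ∈ Ioo A' C') :
    x ∈ Ioo a' b' := by
  obtain ⟨y, hy, e⟩ := h'.exists_preimage hx'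
  have : y = x := h.injOn ⟨ha.trans hy.1.le, hy.2.le.trans hb⟩ hx e
  rwa [← this]

lemma split (h : B.Pb (m + n) a b A C) : ∃ A1 C1, B.Pb n a b A1 C1 ∧ B.Pb m A1 C1 A C := by
  have hr : B.Reg n (Ioo a b) := h.reg.of_le (Nat.le_add_left _ _)
  obtain ⟨A1, C1, h1⟩ := hr.exists_pb h.lt
  have hr2 : B.Reg m (Ioo A1 C1) := by
    intro y hy
    obtain ⟨x, hx, rfl⟩ := h1.exists_preimage hy
    have := h.reg x hx
    rw [dn_add] at this
    exact left_ne_zero_of_mul this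
  obtain ⟨A2, C2, h2⟩ := hr2.exists_pb h1.lt'
  have h3 := h1.comp h2
  have : Icc A2 C2 = Icc A C := by rw [← h.image_Icc, ← h3.image_Icc]
  rw [Icc_eq_Icc_iff h2.lt'.le] at this
  obtain ⟨rfl, rfl⟩ := this
  exact ⟨A1, C1, h1, h2⟩

lemma translate (h : B.Pb n a b A C) (k : ℤ) : B.Pb n (a + k) (b + k) (A + k) (C + k) := by
  have e : ∀ x, x + (k : ℝ) - k = x := fun x => by ring
  have e' : ∀ x, B.F^[n] x = B.F^[n] (x - k) + k := by
    intro x; rw [B.iter_sub_int]; ring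
  refine ⟨by linarith [h.lt], ?_, ?_⟩
  · intro x hx
    have := h.reg (x - k) ⟨by linarith [hx.1], by linarith [hx.2]⟩
    rwa [← B.dn_translate n _ k, sub_add_cancel] at this
  · rw [B.iter_add_int, B.iter_add_int]
    rcases h.ends with ⟨h1, e1, e2⟩ | ⟨h1, e1, e2⟩ <;> rw [e1, e2]
    · refine Or.inl ⟨?_, rfl, rfl⟩
      intro x hx y hy hxy
      rw [e' x, e' y]
      have := h1 (a := x - k) (b := y - k) ⟨by linarith [hx.1], by linarith [hx.2]⟩
        ⟨by linarith [hy.1], by linarith [hy.2]⟩ (by linarith)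
      linarith
    · refine Or.inr ⟨?_, rfl, rfl⟩
      intro x hx y hy hxy
      rw [e' x, e' y]
      have := h1 (a := x - k) (b := y - k) ⟨by linarith [hx.1], by linarith [hx.2]⟩
        ⟨by linarith [hy.1], by linarith [hy.2]⟩ (by linarith)
      linarith

lemma translate_sub (h : B.Pb n a b A C) (k : ℤ) : B.Pb n (a - k) (b - k) (A - k) (C - k) := by
  have := h.translate (-k)
  push_cast at this
  simpa [sub_eq_add_neg] using this

end Pb

lemma exists_fixed_of_mapsTo {h : ℝ → ℝ} {a b : ℝ} (hab : a < b) (hc : ContinuousOn h (Icc a b))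
    (ha : a ≤ h a) (hb : h b < b) : ∃ z ∈ Ico a b, h z = z ∧ ∀ t ∈ Ioc z b, h t < t := by
  set S := {t | t ∈ Icc a b ∧ t ≤ h t} with hS
  have hSne : S.Nonempty := ⟨a, ⟨le_rfl, hab.le⟩, ha⟩
  have hclosed : IsClosed S := isClosed_Icc.isClosed_le continuousOn_id hc
  have hSb : BddAbove S := ⟨b, fun t ht => ht.1.2⟩
  have hz := hclosed.csSup_mem hSne hSb
  set z := sSup S with hzdef
  have hzb : z < b := lt_of_le_of_ne hz.1.2 (by intro e; have := hz.2; rw [e] at this; linarith)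
  have hgt : ∀ t ∈ Ioc z b, h t < t := by
    intro t ht
    by_contra hcon
    push Not at hcon
    have : t ≤ z := le_csSup hSb ⟨⟨hz.1.1.trans ht.1.le, ht.2⟩, hcon⟩
    linarith [ht.1]
  refine ⟨z, ⟨hz.1.1, hzb⟩, le_antisymm ?_ hz.2, hgt⟩
  have hcz : ContinuousOn h (Icc z b) := hc.mono (Icc_subset_Icc hz.1.1 le_rfl)
  have hcl : IsClosed {t | t ∈ Icc z b ∧ h t ≤ t} := isClosed_Icc.isClosed_le hcz continuousOn_id
  have : closure (Ioc z b) ⊆ {t | t ∈ Icc z b ∧ h t ≤ t} :=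
    closure_minimal (fun t ht => ⟨⟨ht.1.le, ht.2⟩, (hgt t ht).le⟩) hcl
  rw [closure_Ioc hzb.ne] at this
  exact (this ⟨le_rfl, hzb.le⟩).2

/-- A regular interval cannot be mapped into a translate of itself. -/
lemma Pb.not_trap {n : ℕ} {a b A C : ℝ} (h : B.Pb n a b A C) (hn : 1 ≤ n) (k : ℤ) (h1 : a + k ≤ A)
    (h2 : C ≤ b + k) : False := by
  have hmaps : ∀ x ∈ Ioo a b, B.F^[n] x - k ∈ Ioo a b := by
    intro x hx
    have := h.mem_Ioo hx
    exact ⟨by linarith [this.1], by linarith [this.2]⟩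
  have hmapsC : ∀ x ∈ Icc a b, B.F^[n] x - k ∈ Icc a b := by
    intro x hx
    have := h.mem_Icc hx
    exact ⟨by linarith [this.1], by linarith [this.2]⟩
  set g : ℝ → ℝ := fun x => B.F^[n + n] x - (2 * k : ℤ) with hg
  have gval : ∀ x, g x = B.F^[n] (B.F^[n] x - k) - k := by
    intro x; rw [hg]; simp only; rw [B.iter_add, B.iter_sub_int]; push_cast; ring
  have gmaps : ∀ x ∈ Icc a b, g x ∈ Icc a b := by
    intro x hx; rw [gval]; exact hmapsC _ (hmapsC x hx)
  have gd : ∀ x, HasDerivAt g (B.dn (n + n) x) x := fun x => (B.hasDerivAt_iter (n + n) x).sub_const _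
  have gpos : ∀ x ∈ Ioo a b, 0 < B.dn (n + n) x := by
    intro x hx
    have e : B.dn n (B.F^[n] x) = B.dn n (B.F^[n] x - k) := by
      rw [← B.dn_translate n (B.F^[n] x - k) k, sub_add_cancel]
    rw [B.dn_add, e]
    rcases h.reg.sign with hs | hs
    · exact mul_pos (hs _ (hmaps x hx)) (hs x hx)
    · exact mul_pos_of_neg_of_neg (hs _ (hmaps x hx)) (hs x hx)
  have gc : Continuous g := (B.continuous_iter _).sub continuous_const
  have gm : StrictMonoOn g (Icc a b) := strictMonoOn_of_deriv_pos (convex_Icc a b) gc.continuousOn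
    (fun x hx => by rw [interior_Icc] at hx; rw [(gd x).deriv]; exact gpos x hx)
  have gfix : ∀ z, g z = z → 1 < |B.dn (n + n) z| := by
    intro z hz
    exact B.rep z (n + n) (by omega) ⟨2 * k, by rw [hg] at hz; simp only at hz; linarith⟩
  -- a good right end point
  obtain ⟨c, hca, hcb, hgc⟩ : ∃ c, a < c ∧ c ≤ b ∧ g c < c := by
    rcases lt_or_eq_of_le (gmaps b ⟨h.lt.le, le_rfl⟩).2 with hlt | heq
    · exact ⟨b, h.lt, le_rfl, hlt⟩
    · have hb1 := gfix b heq
      have hb0 : 0 ≤ B.dn (n + n) b := by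
        have : b ∈ closure (Ioo a b) := by rw [closure_Ioo h.lt.ne]; exact ⟨h.lt.le, le_rfl⟩
        exact closure_minimal (fun x hx => (gpos x hx).le)
          (isClosed_le continuous_const (B.continuous_dn _)) this
      rw [abs_of_nonneg hb0] at hb1
      have hd := (gd b).hasDerivWithinAt (s := Iio b)
      rw [hasDerivWithinAt_iff_tendsto_slope' (by simp)] at hd
      have ev := hd.eventually (lt_mem_nhds hb1)
      have ev2 : ∀ᶠ t in nhdsWithin b (Iio b), t ∈ Ioo a b := Ioo_mem_nhdsLT h.lt
      obtain ⟨c, hc1, hc2⟩ := (ev.and ev2).exists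
      refine ⟨c, hc2.1, hc2.2.le, ?_⟩
      rw [slope_def_field, heq, lt_div_iff_of_neg (by linarith [hc2.2])] at hc1
      linarith
  obtain ⟨z, hz, hzf, hzt⟩ := exists_fixed_of_mapsTo (h := g) hca gc.continuousOn
    (gmaps a ⟨le_rfl, h.lt.le⟩).1 hgc
  have h3 := gfix z hzf
  have hd := (gd z).hasDerivWithinAt (s := Ioi z)
  rw [hasDerivWithinAt_iff_tendsto_slope' (by simp)] at hd
  have ev2 : ∀ᶠ t in nhdsWithin z (Ioi z), t ∈ Ioc z c :=
    mem_of_superset (Ioo_mem_nhdsGT hz.2) Ioo_subset_Ioc_self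
  have b1 : B.dn (n + n) z ≤ 1 := by
    refine le_of_tendsto hd ?_
    filter_upwards [ev2] with t ht
    rw [slope_def_field, hzf, div_le_one (by linarith [ht.1])]
    linarith [hzt t ht]
  have b0 : 0 ≤ B.dn (n + n) z := by
    refine ge_of_tendsto hd ?_
    filter_upwards [ev2] with t ht
    rw [slope_def_field]
    refine div_nonneg ?_ (by linarith [ht.1])
    have := gm (a := z) (b := t) ⟨hz.1, by linarith [hz.2]⟩ ⟨by linarith [hz.1, ht.1], by linarith [ht.2]⟩ ht.1
    linarith
  rw [abs_of_nonneg b0] at h3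
  linarith

end Bim

namespace Bim

lemma mirror_iter_aux (F : ℝ → ℝ) (n : ℕ) (x : ℝ) :
    (fun t => -F (-t))^[n] x = -F^[n] (-x) := by
  induction n with
  | zero => simp
  | succ n ih => rw [Function.iterate_succ_apply', ih, Function.iterate_succ_apply', neg_neg]

lemma mirror_deriv_aux (F : ℝ → ℝ) (x : ℝ) : deriv (fun t => -F (-t)) x = deriv F (-x) := by
  rw [deriv.fun_neg, deriv_comp_neg, neg_neg]

lemma mirror_deriv_iter_aux (F : ℝ → ℝ) (n : ℕ) (x : ℝ) :
    deriv ((fun t => -F (-t))^[n]) x = deriv (F^[n]) (-x) := by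
  have : (fun t => -F (-t))^[n] = fun x => -F^[n] (-x) := by ext x; exact mirror_iter_aux F n x
  rw [this, mirror_deriv_aux]

lemma mirror_cross_aux (F : ℝ → ℝ) (x y d : ℝ) :
    crossLog (fun t => -F (-t)) x y d = crossLog F (-x) (-y) (-d) := by
  rw [crossLog_neg (fun t => F (-t)), ← crossLog_reflect F (-x), neg_neg, neg_neg, neg_neg]

lemma mirror_reg_aux {F : ℝ → ℝ} {x d : ℝ} (h : ∀ z ∈ uIcc x d, deriv (fun t => -F (-t)) z ≠ 0) :
    ∀ z ∈ uIcc (-x) (-d), deriv F z ≠ 0 := by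
  intro z hz
  have := h (-z) (by
    rw [uIcc, mem_Icc] at hz ⊢
    rw [min_neg_neg, max_neg_neg] at hz
    exact ⟨by linarith [hz.2], by linarith [hz.1]⟩)
  rwa [mirror_deriv_aux, neg_neg] at this

/-- The conjugate of the map by `x ↦ -x`. -/
def mirror (B : Bim) : Bim where
  F x := -B.F (-x)
  p := -B.q
  q := -B.p
  dp := -B.dq
  dq := -B.dp
  lift x := by
    have := B.lift (-(x + 1))
    rw [show -(x + 1) + 1 = -x by ring] at this
    linarith
  smooth := (B.smooth.comp contDiff_neg).neg
  hpq := by linarith [B.hpq]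
  hqp := by linarith [B.hqp]
  decr x hx := by
    rw [mirror_deriv_aux]
    exact B.decr _ ⟨by linarith [hx.2], by linarith [hx.1]⟩
  incr x hx := by
    rw [mirror_deriv_aux, ← B.deriv_sub_int (-x) (-1)]
    push_cast
    exact B.incr _ ⟨by linarith [hx.2], by linarith [hx.1]⟩
  hdp := ⟨by linarith [B.hdq.2], by linarith [B.hdq.1]⟩
  hdq := ⟨by linarith [B.hdp.2], by linarith [B.hdp.1]⟩
  avp n hn k h := by
    rw [mirror_iter_aux, neg_neg] at h
    refine B.avq n hn (-k) ⟨?_, ?_⟩ <;> push_cast <;> linarith [h.1, h.2]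
  avq n hn k h := by
    rw [mirror_iter_aux, neg_neg] at h
    refine B.avp n hn (-k) ⟨?_, ?_⟩ <;> push_cast <;> linarith [h.1, h.2]
  rep x n hn h := by
    rw [mirror_deriv_iter_aux]
    obtain ⟨m, hm⟩ := h
    rw [mirror_iter_aux] at hm
    exact B.rep _ n hn ⟨-m, by push_cast; linarith⟩
  cross := by
    obtain ⟨E, hE, H⟩ := B.cross
    refine ⟨E, hE, fun x y d h hb => ?_⟩
    have := H (-x) (-y) (-d) (mirror_reg_aux h) hb.neg
    rwa [mirror_cross_aux, ← abs_neg, show -(x - y) = -x - -y by ring]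
  cross_small η hη := by
    obtain ⟨δ, hδ, H⟩ := B.cross_small η hη
    refine ⟨δ, hδ, fun x y d h hb hl => ?_⟩
    have := H (-x) (-y) (-d) (mirror_reg_aux h) hb.neg
      (by rwa [show -d - -x = -(d - x) by ring, abs_neg])
    rwa [mirror_cross_aux, ← abs_neg, show -(x - y) = -x - -y by ring]

lemma mirror_mirror (B : Bim) : B.mirror.mirror = B := by
  cases B
  simp [mirror]

variable {B : Bim}

lemma mirror_iter (n : ℕ) (x : ℝ) : B.mirror.F^[n] x = -B.F^[n] (-x) := mirror_iter_aux B.F n x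

lemma mirror_dn (n : ℕ) (x : ℝ) : B.mirror.dn n x = B.dn n (-x) := mirror_deriv_iter_aux B.F n x

lemma Pb.mirror {n : ℕ} {a b A C : ℝ} (h : B.Pb n a b A C) : B.mirror.Pb n (-b) (-a) (-C) (-A) := by
  refine ⟨by linarith [h.lt], ?_, ?_⟩
  · intro x hx
    rw [mirror_dn]
    exact h.reg _ ⟨by linarith [hx.2], by linarith [hx.1]⟩
  · have hm : ∀ x ∈ Icc (-b) (-a), -x ∈ Icc a b := fun x hx => ⟨by linarith [hx.2], by linarith [hx.1]⟩
    simp only [mirror_iter, neg_neg, neg_inj]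
    rcases h.ends with ⟨h1, h2, h3⟩ | ⟨h1, h2, h3⟩
    · refine Or.inl ⟨fun x hx y hy hxy => ?_, h3, h2⟩
      rw [mirror_iter, mirror_iter]
      have := h1 (hm y hy) (hm x hx) (by linarith)
      linarith
    · refine Or.inr ⟨fun x hx y hy hxy => ?_, h3, h2⟩
      rw [mirror_iter, mirror_iter]
      have := h1 (hm y hy) (hm x hx) (by linarith)
      linarith

lemma Pb.of_mirror {n : ℕ} {a b A C : ℝ} (h : B.mirror.Pb n a b A C) :
    B.Pb n (-b) (-a) (-C) (-A) := by
  have := h.mirror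
  rwa [mirror_mirror] at this

variable (B)

/-- `y` is a lift of a point of the interior of the decreasing lap. -/
def InI (y : ℝ) : Prop := ∃ k : ℤ, y - k ∈ Ioo B.p B.q

lemma not_inI_iter_p (n : ℕ) (hn : 1 ≤ n) : ¬ B.InI (B.F^[n] B.p) := by
  rintro ⟨k, hk⟩
  exact B.avp n hn k ⟨hk.1.le, by linarith [hk.2, B.hdp.1]⟩

lemma not_inI_iter_q (n : ℕ) (hn : 1 ≤ n) : ¬ B.InI (B.F^[n] B.q) := by
  rintro ⟨k, hk⟩
  exact B.avq n hn k ⟨by linarith [hk.1, B.hdq.2], hk.2.le⟩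

lemma dn_succ' (m : ℕ) (x : ℝ) : B.dn (m + 1) x = deriv B.F (B.F^[m] x) * B.dn m x := by
  rw [add_comm, dn_add, dn_one]

lemma dn_nonneg_of_not_inI {x : ℝ} (m : ℕ) (h : ∀ i < m, ¬ B.InI (B.F^[i] x)) : 0 ≤ B.dn m x := by
  induction m with
  | zero => simp
  | succ m ih =>
    rw [dn_succ']
    refine mul_nonneg ?_ (ih fun i hi => h i (by omega))
    by_contra hc
    push Not at hc
    exact h m (by omega) ((B.deriv_neg_iff _).1 hc)

lemma dn_Fp_nonneg (m : ℕ) : 0 ≤ B.dn m (B.F B.p) :=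
  B.dn_nonneg_of_not_inI m fun i _ => by
    rw [← Function.iterate_succ_apply]; exact B.not_inI_iter_p _ (by omega)

lemma dn_Fq_nonneg (m : ℕ) : 0 ≤ B.dn m (B.F B.q) :=
  B.dn_nonneg_of_not_inI m fun i _ => by
    rw [← Function.iterate_succ_apply]; exact B.not_inI_iter_q _ (by omega)

variable {B}

lemma Pb.mono_of_dn_nonneg {n : ℕ} {a b A C y : ℝ} (h : B.Pb n a b A C) (hy : y ∈ Ioo a b)
    (h0 : 0 ≤ B.dn n y) : StrictMonoOn (B.F^[n]) (Icc a b) := by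
  have hpos : 0 < B.dn n y := lt_of_le_of_ne h0 (h.reg y hy).symm
  rcases h.reg.sign with hs | hs
  · exact strictMonoOn_of_deriv_pos (convex_Icc a b) (B.continuous_iter n).continuousOn
      (by simpa [dn] using hs)
  · linarith [hs y hy]

/-- The critical values of `p` cannot lie between a point returning above `p` and the right end. -/
lemma Pb.excl_p {m : ℕ} {α β A k w : ℝ} {K j : ℤ} (hk : k = K) (h : B.Pb m α β A (B.dp + k))
    (hw : w ∈ Ioo α β) (hp : B.p + k ≤ B.F^[m] w) (h1 : w < B.F B.p + j) : β ≤ B.F B.p + j := by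
  by_contra hc
  push Not at hc
  have hy : B.F B.p + j ∈ Ioo α β := ⟨hw.1.trans h1, hc⟩
  have hm := h.mono_of_dn_nonneg hy (by rw [dn_translate]; exact B.dn_Fp_nonneg m)
  have h2 := hm (Ioo_subset_Icc_self hw) (Ioo_subset_Icc_self hy) h1
  have h3 := h.mem_Ioo hy
  rw [B.iter_add_int] at h2 h3
  rw [← Function.iterate_succ_apply] at h2 h3
  refine B.avp (m + 1) (by omega) (K - j) ⟨?_, ?_⟩ <;> push_cast <;> linarith [h3.2]

lemma Pb.excl_q {m : ℕ} {α β C k w : ℝ} {K j : ℤ} (hk : k = K) (h : B.Pb m α β (B.dq + k) C)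
    (hw : w ∈ Ioo α β) (hq : B.F^[m] w ≤ B.q + k) (h1 : B.F B.q + j < w) : B.F B.q + j ≤ α := by
  by_contra hc
  push Not at hc
  have hy : B.F B.q + j ∈ Ioo α β := ⟨hc, h1.trans hw.2⟩
  have hm := h.mono_of_dn_nonneg hy (by rw [dn_translate]; exact B.dn_Fq_nonneg m)
  have h2 := hm (Ioo_subset_Icc_self hy) (Ioo_subset_Icc_self hw) h1
  have h3 := h.mem_Ioo hy
  rw [B.iter_add_int] at h2 h3
  rw [← Function.iterate_succ_apply] at h2 h3
  refine B.avq (m + 1) (by omega) (K - j) ⟨?_, ?_⟩ <;> push_cast <;> linarith [h3.1]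

lemma Pb.zero {a b : ℝ} (h : a < b) : B.Pb 0 a b a b :=
  ⟨h, fun x _ => by simp, Or.inl ⟨fun x _ y _ hxy => hxy, rfl, rfl⟩⟩

lemma pb_lap_decr (k : ℤ) : B.Pb 1 (B.p + k) (B.q + k) (B.F B.q + k) (B.F B.p + k) := by
  have : B.Pb 1 B.p B.q (B.F B.q) (B.F B.p) := by
    refine ⟨B.hpq, fun x hx => by rw [dn_one]; exact (B.decr x hx).ne, Or.inr ⟨?_, rfl, rfl⟩⟩
    exact strictAntiOn_of_deriv_neg (convex_Icc _ _) (B.continuous_iter 1).continuousOn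
      (fun x hx => by rw [interior_Icc] at hx; simpa using B.decr x hx)
  exact this.translate k

lemma pb_lap_incr (k : ℤ) : B.Pb 1 (B.q + k) (B.p + 1 + k) (B.F B.q + k) (B.F B.p + 1 + k) := by
  have : B.Pb 1 B.q (B.p + 1) (B.F B.q) (B.F B.p + 1) := by
    refine ⟨B.hqp, fun x hx => by rw [dn_one]; exact (B.incr x hx).ne',
      Or.inl ⟨?_, rfl, B.lift _⟩⟩
    exact strictMonoOn_of_deriv_pos (convex_Icc _ _) (B.continuous_iter 1).continuousOn
      (fun x hx => by rw [interior_Icc] at hx; simpa using B.incr x hx)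
  exact this.translate k

/-- One step of pulling back an interval avoiding the critical values. -/
lemma Pb.step {m : ℕ} {α β A C x : ℝ} (h : B.Pb m α β A C) (hx : B.F x ∈ Ioo α β)
    (h0 : deriv B.F x ≠ 0) (hp : ∀ j : ℤ, B.F x < B.F B.p + j → β ≤ B.F B.p + j)
    (hq : ∀ j : ℤ, B.F B.q + j < B.F x → B.F B.q + j ≤ α) :
    ∃ α' β', x ∈ Ioo α' β' ∧ B.Pb (m + 1) α' β' A C := by
  have key : ∀ {a b A1 C1 : ℝ}, B.Pb 1 a b A1 C1 → x ∈ Ioo a b → A1 ≤ α → β ≤ C1 →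
      ∃ α' β', x ∈ Ioo α' β' ∧ B.Pb (m + 1) α' β' A C := by
    intro a b A1 C1 h1 hxI l1 l2
    obtain ⟨α', β', i1, i2, h2⟩ := h1.pullback l1 h.lt l2
    exact ⟨α', β', h1.mem_of_image i1 i2 h2 (Ioo_subset_Icc_self hxI) hx, h2.comp h⟩
  obtain ⟨k, hk⟩ := B.exists_lap x
  rcases hk with hk | hk | hk | hk
  · exact absurd ((B.deriv_eq_zero_iff x).2 ⟨k, Or.inl hk⟩) h0
  · have hxI : x ∈ Ioo (B.p + k) (B.q + k) := ⟨by linarith [hk.1], by linarith [hk.2]⟩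
    have h1 := B.pb_lap_decr k
    have h2 := h1.mem_Ioo hxI
    exact key h1 hxI (hq k h2.1) (hp k h2.2)
  · exact absurd ((B.deriv_eq_zero_iff x).2 ⟨k, Or.inr hk⟩) h0
  · have hxI : x ∈ Ioo (B.q + k) (B.p + 1 + k) := ⟨by linarith [hk.1], by linarith [hk.2]⟩
    have h1 := B.pb_lap_incr k
    have h2 := h1.mem_Ioo hxI
    have h3 := hp (k + 1)
    push_cast at h3
    rw [add_comm (k:ℝ) 1, ← add_assoc] at h3
    exact key h1 hxI (hq k h2.1) (h3 h2.2)

lemma deriv_ne_zero_of_inI {m : ℕ} {x : ℝ} (hx : B.InI (B.F^[m + 1] x)) : deriv B.F x ≠ 0 := by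
  intro h0
  obtain ⟨k, hk⟩ := hx
  obtain ⟨l, hl | hl⟩ := (B.deriv_eq_zero_iff x).1 h0
  · apply B.not_inI_iter_p (m + 1) (by omega)
    have e : B.F^[m + 1] B.p = B.F^[m + 1] x - l := by rw [← hl, B.iter_sub_int]
    refine ⟨k - l, ?_⟩
    rw [e]; push_cast
    exact ⟨by linarith [hk.1], by linarith [hk.2]⟩
  · apply B.not_inI_iter_q (m + 1) (by omega)
    have e : B.F^[m + 1] B.q = B.F^[m + 1] x - l := by rw [← hl, B.iter_sub_int]
    refine ⟨k - l, ?_⟩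
    rw [e]; push_cast
    exact ⟨by linarith [hk.1], by linarith [hk.2]⟩

/-- Visits to the decreasing lap have pull-backs with definite space around. -/
theorem exists_extension (m : ℕ) (x : ℝ) (k : ℤ) (hx : B.F^[m] x - k ∈ Ioo B.p B.q) :
    ∃ α β, x ∈ Ioo α β ∧ B.Pb m α β (B.dq + k) (B.dp + k) := by
  induction m generalizing x with
  | zero =>
    refine ⟨B.dq + k, B.dp + k, ⟨?_, ?_⟩, Pb.zero ?_⟩
    · have := hx.1; simp only [Function.iterate_zero, id] at this; linarith [B.hdq.2]
    · have := hx.2; simp only [Function.iterate_zero, id] at this; linarith [B.hdp.1]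
    · linarith [B.hdq.2, B.hdp.1, B.hpq]
  | succ m ih =>
    obtain ⟨α, β, hm, h⟩ := ih (B.F x) (by rwa [← Function.iterate_succ_apply])
    rw [Function.iterate_succ_apply] at hx
    refine h.step hm (deriv_ne_zero_of_inI (m := m) ⟨k, by rwa [Function.iterate_succ_apply]⟩) ?_ ?_
    · intro j hj
      exact h.excl_p rfl hm (by linarith [hx.1]) hj
    · intro j hj
      exact h.excl_q rfl hm (by linarith [hx.2]) hj

/-- Closest approaches to `q` from the right have pull-backs with definite space around. -/
theorem exists_extension_record (m : ℕ) (x : ℝ) (κ : ℕ → ℤ)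
    (hu : ∀ i ≤ m, B.F^[i] x - κ i ∈ Ioo B.q (B.p + 1))
    (hrec : ∀ i < m, B.F^[m] x - κ m < B.F^[i] x - κ i) (hd : B.F^[m] x - κ m < B.dp) :
    ∃ α β, x ∈ Ioo α β ∧ B.Pb m α β (B.dq + κ m) (B.dp + κ m) := by
  induction m generalizing x κ with
  | zero =>
    have h0 := hu 0 le_rfl
    simp only [Function.iterate_zero, id] at h0 hd
    refine ⟨B.dq + κ 0, B.dp + κ 0, ⟨?_, ?_⟩, Pb.zero ?_⟩
    · linarith [B.hdq.2, B.hpq, h0.1]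
    · linarith
    · linarith [B.hdq.2, B.hdp.1, B.hpq]
  | succ m ih =>
    obtain ⟨α, β, hm, h⟩ := ih (B.F x) (fun i => κ (i + 1))
      (fun i hi => by rw [← Function.iterate_succ_apply]; exact hu (i + 1) (by omega))
      (fun i hi => by
        rw [← Function.iterate_succ_apply, ← Function.iterate_succ_apply]
        exact hrec (i + 1) (by omega)) (by rw [← Function.iterate_succ_apply]; exact hd)
    have hum := hu (m + 1) le_rfl
    have hu0 := hu 0 (by omega)
    have hr0 := hrec 0 (by omega)
    rw [Function.iterate_succ_apply] at hum hd hr0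
    simp only [Function.iterate_zero, id] at hu0 hr0
    have hxI : x ∈ Ioo (B.q + κ 0) (B.p + 1 + κ 0) := ⟨by linarith [hu0.1], by linarith [hu0.2]⟩
    have hlap := B.pb_lap_incr (κ 0)
    have hFx := hlap.mem_Ioo hxI
    rw [Function.iterate_one] at hFx
    have cp : β ≤ B.F B.p + 1 + κ 0 := by
      have := h.excl_p rfl hm (j := κ 0 + 1) (by linarith [hum.1, B.hpq])
      push_cast at this
      rw [add_comm (κ 0 : ℝ) 1, ← add_assoc] at this
      exact this hFx.2
    have cq : B.F B.q + κ 0 ≤ α := by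
      by_contra hc
      push Not at hc
      have hy : B.F B.q + κ 0 ∈ Ioo α β := ⟨hc, hFx.1.trans hm.2⟩
      have hmono := h.mono_of_dn_nonneg hy (by rw [dn_translate]; exact B.dn_Fq_nonneg m)
      have hsub : B.Pb m (B.F B.q + κ 0) (B.F x) (B.F^[m] (B.F B.q + κ 0)) (B.F^[m] (B.F x)) :=
        ⟨hFx.1, h.reg.subset (Ioo_subset_Ioo hy.1.le hm.2.le),
          Or.inl ⟨hmono.mono (Icc_subset_Icc hy.1.le hm.2.le), rfl, rfl⟩⟩
      have hlt := hsub.lt'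
      have h3 := (h.mem_Ioo hy).1
      have hq : B.q + κ (m + 1) < B.F^[m] (B.F B.q + κ 0) := by
        by_contra hcon
        push Not at hcon
        rw [B.iter_add_int, ← Function.iterate_succ_apply] at h3 hcon
        refine B.avq (m + 1) (by omega) (κ (m + 1) - κ 0) ⟨?_, ?_⟩ <;> push_cast <;> linarith
      have h1 : B.Pb 1 (B.q + κ 0) x (B.F B.q + κ 0) (B.F x) := by
        rcases hlap.ends with ⟨hs, e1, e2⟩ | ⟨hs, e1, e2⟩
        · exact ⟨hxI.1, hlap.reg.subset (Ioo_subset_Ioo le_rfl hxI.2.le),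
            Or.inl ⟨hs.mono (Icc_subset_Icc le_rfl hxI.2.le), e1, rfl⟩⟩
        · have := hlap.lt'
          rw [B.iter_add_int, Function.iterate_one] at e1
          linarith
      refine (h1.comp hsub).not_trap (by omega) (κ (m + 1) - κ 0) ?_ ?_ <;> push_cast <;> linarith
    obtain ⟨α', β', i1, i2, h2⟩ := hlap.pullback cq h.lt cp
    exact ⟨α', β', hlap.mem_of_image i1 i2 h2 (Ioo_subset_Icc_self hxI) hm, h2.comp h⟩

/-- Closest approaches to `p + 1` from the left have pull-backs with definite space around. -/
theorem exists_extension_record' (m : ℕ) (x : ℝ) (κ : ℕ → ℤ)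
    (hu : ∀ i ≤ m, B.F^[i] x - κ i ∈ Ioo B.q (B.p + 1))
    (hrec : ∀ i < m, B.F^[i] x - κ i < B.F^[m] x - κ m) (hd : B.dq + 1 < B.F^[m] x - κ m) :
    ∃ α β, x ∈ Ioo α β ∧ B.Pb m α β (B.dq + 1 + κ m) (B.dp + 1 + κ m) := by
  obtain ⟨α, β, hx, h⟩ := B.mirror.exists_extension_record m (-x) (fun i => -κ i - 1) (by
      intro i hi
      have := hu i hi
      rw [mirror_iter, neg_neg]
      simp only [mirror]
      push_cast
      exact ⟨by linarith [this.2], by linarith [this.1]⟩) (by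
      intro i hi
      have := hrec i hi
      rw [mirror_iter, mirror_iter, neg_neg]
      push_cast
      linarith) (by
      rw [mirror_iter, neg_neg]
      simp only [mirror]
      push_cast
      linarith)
  refine ⟨-β, -α, ⟨by linarith [hx.2], by linarith [hx.1]⟩, ?_⟩
  have h1 := h.of_mirror
  simp only [mirror] at h1
  push_cast at h1
  convert h1 using 1 <;> ring

end Bim

namespace Bim

variable {B : Bim}

variable (B) in
/-- `c` bounds the cross-ratio distortion of `F` at scales below `δ`. -/
def CrossBound (c δ : ℝ) : Prop :=
  0 ≤ c ∧ ∀ x y d, (∀ z ∈ uIcc x d, deriv B.F z ≠ 0) → Betw x y d → |d - x| < δ →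
    -(c * |x - y|) ≤ crossLog B.F x y d

variable (B) in
lemma exists_crossBound : ∃ E, B.CrossBound E 2 := by
  obtain ⟨E, hE, h⟩ := B.cross
  exact ⟨E, hE, fun x y d h1 h2 _ => h x y d h1 h2⟩

variable (B) in
lemma exists_crossBound_small {η : ℝ} (hη : 0 < η) : ∃ δ > 0, B.CrossBound η δ := by
  obtain ⟨δ, hδ, h⟩ := B.cross_small η hη
  exact ⟨δ, hδ, hη.le, h⟩

variable (B) in
/-- The total length of the first `m` iterates of the interval between `a` and `b`. -/
def csum (m : ℕ) (a b : ℝ) : ℝ := ∑ i ∈ Finset.range m, |B.F^[i] b - B.F^[i] a|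

lemma csum_nonneg (m : ℕ) (a b : ℝ) : 0 ≤ B.csum m a b :=
  Finset.sum_nonneg fun _ _ => abs_nonneg _

lemma csum_comm (m : ℕ) (a b : ℝ) : B.csum m a b = B.csum m b a :=
  Finset.sum_congr rfl fun _ _ => abs_sub_comm _ _

lemma csum_succ (m : ℕ) (a b : ℝ) :
    B.csum (m + 1) a b = B.csum m a b + |B.F^[m] b - B.F^[m] a| := Finset.sum_range_succ _ _

lemma csum_add (m n : ℕ) (a b : ℝ) :
    B.csum (m + n) a b = B.csum m a b + B.csum n (B.F^[m] a) (B.F^[m] b) := by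
  unfold csum
  rw [Finset.sum_range_add]
  simp only [← iter_add, Nat.add_comm m]

lemma Reg.comp_iter {m n : ℕ} {S : Set ℝ} (h : B.Reg (m + n) S) : B.Reg m (B.F^[n] '' S) := by
  rintro _ ⟨x, hx, rfl⟩ h0
  exact h x hx (by rw [dn_add, h0, zero_mul])

lemma Reg.betw {n : ℕ} {a b x y d : ℝ} (h : B.Reg n (Ioo a b)) (hx : x ∈ Icc a b)
    (hy : y ∈ Icc a b) (hd : d ∈ Icc a b) :
    Betw (B.F^[n] x) (B.F^[n] y) (B.F^[n] d) ↔ Betw x y d := by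
  unfold Betw
  rcases h.mono_or_anti with h | h
  · rw [h.lt_iff_lt hx hy, h.lt_iff_lt hy hd, h.lt_iff_lt hd hy, h.lt_iff_lt hy hx]
  · rw [h.lt_iff_gt hx hy, h.lt_iff_gt hy hd, h.lt_iff_gt hd hy, h.lt_iff_gt hy hx]
    tauto

/-- The Koebe principle: accumulated cross-ratio distortion. -/
theorem koebe {c δ : ℝ} (hc : B.CrossBound c δ) {m : ℕ} {α β x y d : ℝ}
    (h : B.Reg m (Ioo α β)) (hx : x ∈ Ioo α β) (hd : d ∈ Ioo α β) (hb : Betw x y d)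
    (hδ : ∀ i < m, |B.F^[i] d - B.F^[i] x| < δ) :
    -(c * B.csum m x y) ≤ crossLog (B.F^[m]) x y d := by
  have hy : y ∈ Ioo α β := by
    rcases hb with h | h
    · exact ⟨hx.1.trans h.1, h.2.trans hd.2⟩
    · exact ⟨hd.1.trans h.1, h.2.trans hx.2⟩
  induction m with
  | zero =>
    simp [csum, crossLog]
  | succ m ih =>
    have hm := h.of_le (Nat.le_succ m)
    have ih := ih hm fun i hi => hδ i (by omega)
    have hne : ∀ z ∈ Ioo α β, deriv B.F (B.F^[m] z) ≠ 0 := by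
      intro z hz h0
      exact h z hz (by rw [dn_succ', h0, zero_mul])
    rw [csum_succ, Function.iterate_succ', crossLog_comp (B.differentiable m x)
      (B.differentiable m y) ((B.smooth.differentiable (by norm_num)) _)
      ((B.smooth.differentiable (by norm_num)) _) (hm x hx) (hm y hy) (hne x hx) (hne y hy)]
    have h1 := hc.2 (B.F^[m] x) (B.F^[m] y) (B.F^[m] d) (by
      intro z hz
      obtain ⟨w, hw, rfl⟩ := intermediate_value_uIcc (B.continuous_iter m).continuousOn hz
      refine hne w ?_
      rw [mem_uIcc] at hw
      rcases hw with hw | hw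
      · exact ⟨hx.1.trans_le hw.1, hw.2.trans_lt hd.2⟩
      · exact ⟨hd.1.trans_le hw.1, hw.2.trans_lt hx.2⟩)
      ((hm.betw (Ioo_subset_Icc_self hx) (Ioo_subset_Icc_self hy) (Ioo_subset_Icc_self hd)).2 hb)
      (hδ m (by omega))
    rw [abs_sub_comm] at h1
    linarith

variable (B) in
/-- `F^m` has distortion at most `exp K` on `(a, b)`. -/
def Dst (m : ℕ) (a b K : ℝ) : Prop :=
  ∀ u ∈ Ioo a b, ∀ v ∈ Ioo a b, |B.dn m v| ≤ Real.exp K * |B.dn m u|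

lemma Dst.mono {m : ℕ} {a b a' b' K K' : ℝ} (h : B.Dst m a b K) (ha : a ≤ a') (hb : b' ≤ b)
    (hK : K ≤ K') : B.Dst m a' b' K' := by
  intro u hu v hv
  have := h u ⟨ha.trans_lt hu.1, hu.2.trans_le hb⟩ v ⟨ha.trans_lt hv.1, hv.2.trans_le hb⟩
  exact this.trans (mul_le_mul_of_nonneg_right (Real.exp_le_exp.2 hK) (abs_nonneg _))

lemma Dst.of_log {m : ℕ} {a b K : ℝ} (hr : B.Reg m (Ioo a b))
    (h : ∀ u ∈ Ioo a b, ∀ v ∈ Ioo a b, Real.log (B.dn m u) - Real.log (B.dn m v) ≤ K) :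
    B.Dst m a b K := by
  intro u hu v hv
  have hu0 := abs_pos.2 (hr u hu)
  have hv0 := abs_pos.2 (hr v hv)
  have h1 := h v hv u hu
  rw [← Real.log_abs, ← Real.log_abs (B.dn m u)] at h1
  rw [← Real.exp_log hu0, ← Real.exp_add, ← Real.exp_log hv0, Real.exp_le_exp]
  linarith

lemma exists_mvt (m : ℕ) {s t : ℝ} (hst : s < t) :
    ∃ ξ ∈ Ioo s t, |B.F^[m] t - B.F^[m] s| = |B.dn m ξ| * (t - s) := by
  obtain ⟨ξ, hξ, h⟩ := exists_deriv_eq_slope (B.F^[m]) hst (B.continuous_iter m).continuousOn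
    (B.differentiable m).differentiableOn
  refine ⟨ξ, hξ, ?_⟩
  have h0 : 0 < t - s := by linarith
  have : B.F^[m] t - B.F^[m] s = B.dn m ξ * (t - s) := by
    unfold dn; rw [h]; field_simp
  rw [this, abs_mul, abs_of_pos h0]

lemma Dst.ratio {m : ℕ} {a b K s t s' t' : ℝ} (h : B.Dst m a b K) (hs : a ≤ s) (hst : s < t)
    (ht : t ≤ b) (hs' : a ≤ s') (hst' : s' < t') (ht' : t' ≤ b) :
    (t - s) * |B.F^[m] t' - B.F^[m] s'| ≤
      Real.exp K * |B.F^[m] t - B.F^[m] s| * (t' - s') := by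
  obtain ⟨ξ, hξ, e1⟩ := B.exists_mvt m hst
  obtain ⟨ζ, hζ, e2⟩ := B.exists_mvt m hst'
  have := h ξ ⟨hs.trans_lt hξ.1, hξ.2.trans_le ht⟩ ζ ⟨hs'.trans_lt hζ.1, hζ.2.trans_le ht'⟩
  rw [e1, e2]
  calc (t - s) * (|B.dn m ζ| * (t' - s')) = |B.dn m ζ| * ((t - s) * (t' - s')) := by ring
    _ ≤ (Real.exp K * |B.dn m ξ|) * ((t - s) * (t' - s')) :=
      mul_le_mul_of_nonneg_right this (mul_nonneg (by linarith) (by linarith))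
    _ = _ := by ring

/-- Distortion on the part of a pull-back whose image has space `r` on both sides. -/
theorem log_distortion {c δ r : ℝ} (hc : B.CrossBound c δ) (hr : 0 < r) {m : ℕ}
    {α β A C u v : ℝ} (h : B.Pb m α β A C) (hδ : ∀ i < m, |B.F^[i] β - B.F^[i] α| ≤ δ)
    (hv : B.F^[m] v ∈ Ioo (A + r) (C - r))
    (hu' : u ∈ Ioo α β) (hv' : v ∈ Ioo α β) :
    Real.log (B.dn m u) - Real.log (B.dn m v) ≤
      2 / r * |B.F^[m] u - B.F^[m] v| + c * B.csum m u v := by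
  set h' := B.F^[m] with hh
  rcases eq_or_ne u v with rfl | huv
  · have := B.csum_nonneg m u u
    have := mul_nonneg hc.1 this
    simp [this]
  have hne : h' u ≠ h' v := fun e => huv (h.injOn (Ioo_subset_Icc_self hu')
    (Ioo_subset_Icc_self hv') e)
  obtain ⟨d, hd, hdd⟩ : ∃ d ∈ Ioo α β, Betw (h' u) (h' v) (h' d) ∧ |h' d - h' v| = r := by
    rcases lt_or_gt_of_ne hne with hlt | hlt
    · obtain ⟨d, hd, e⟩ := h.exists_preimage (y := h' v + r) ⟨by linarith [hv.1], by linarith [hv.2]⟩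
      rw [← hh] at e
      refine ⟨d, hd, Or.inl ⟨hlt, ?_⟩, ?_⟩
      · rw [e]; linarith
      · rw [e]; simp [hr.le]
    · obtain ⟨d, hd, e⟩ := h.exists_preimage (y := h' v - r) ⟨by linarith [hv.1], by linarith [hv.2]⟩
      rw [← hh] at e
      refine ⟨d, hd, Or.inr ⟨?_, hlt⟩, ?_⟩
      · rw [e]; linarith
      · rw [e]; simp [hr.le]
  have hb : Betw u v d := (h.reg.betw (Ioo_subset_Icc_self hu') (Ioo_subset_Icc_self hv')
    (Ioo_subset_Icc_self hd)).1 hdd.1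
  have hk := koebe hc h.reg hu' hd hb (by
    intro i hi
    refine lt_of_lt_of_le ?_ (hδ i hi)
    have hri := h.reg.of_le hi.le
    have mα : α ∈ Icc α β := ⟨le_rfl, h.lt.le⟩
    have mβ : β ∈ Icc α β := ⟨h.lt.le, le_rfl⟩
    obtain ⟨A1, C1, h1⟩ := hri.exists_pb h.lt
    rw [h1.length]
    have x1 := h1.mem_Ioo hu'
    have x2 := h1.mem_Ioo hd
    rw [abs_lt]; constructor <;> linarith [x1.1, x1.2, x2.1, x2.2])
  have key : Real.log (B.dn m u) - Real.log (B.dn m v) =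
      - crossLog h' u v d + 2 * (Real.log |h' d - h' u| - Real.log |h' d - h' v|) -
      2 * (Real.log |d - u| - Real.log |d - v|) := by
    unfold crossLog dn
    simp only [Real.log_abs]
    ring
  have e0 : |h' d - h' u| = r + |h' u - h' v| := by
    rcases hdd.1 with hb | hb
    · rw [abs_of_pos (by linarith), abs_of_neg (by linarith), ← hdd.2, abs_of_pos (by linarith)]; ring
    · rw [abs_of_neg (by linarith), abs_of_pos (by linarith), ← hdd.2, abs_of_neg (by linarith)]; ring
  have e1 : Real.log |h' d - h' u| - Real.log |h' d - h' v| ≤ 1 / r * |h' u - h' v| := by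
    rw [e0, hdd.2, ← Real.log_div (by positivity) hr.ne']
    have := Real.log_le_sub_one_of_pos (x := (r + |h' u - h' v|) / r) (by positivity)
    refine this.trans (le_of_eq ?_)
    field_simp; ring
  have e2 : Real.log |d - v| ≤ Real.log |d - u| := by
    apply Real.log_le_log
    · rw [abs_pos]; rcases hb with hb | hb
      · linarith [hb.2]
      · linarith [hb.1]
    · rcases hb with hb | hb
      · rw [abs_of_pos (by linarith), abs_of_pos (by linarith)]; linarith
      · rw [abs_of_neg (by linarith), abs_of_neg (by linarith)]; linarith
  have e3 : 2 / r * |h' u - h' v| = 2 * (1 / r * |h' u - h' v|) := by ring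
  linarith

lemma exists_crit_of_one_lt {a b : ℝ} (h : 1 < b - a) : ∃ z ∈ Ioo a b, deriv B.F z = 0 := by
  refine ⟨B.p + (⌊a - B.p⌋ + 1 : ℤ), ⟨?_, ?_⟩, ?_⟩
  · push_cast; linarith [Int.lt_floor_add_one (a - B.p)]
  · push_cast; linarith [Int.floor_le (a - B.p)]
  · rw [deriv_eq_zero_iff]; exact ⟨⌊a - B.p⌋ + 1, Or.inl (by push_cast; ring)⟩

lemma Reg.length_le_one {n i : ℕ} {a b : ℝ} (h : B.Reg n (Ioo a b)) (hab : a < b) (hi : i < n) :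
    |B.F^[i] b - B.F^[i] a| ≤ 1 := by
  obtain ⟨A, C, hp⟩ := (h.of_le hi.le).exists_pb hab
  rw [hp.length]
  by_contra hc
  push Not at hc
  obtain ⟨z, hz, h0⟩ := B.exists_crit_of_one_lt hc
  obtain ⟨x, hx, rfl⟩ := hp.exists_preimage hz
  exact h.of_le (Nat.succ_le_of_lt hi) x hx (by rw [dn_succ', h0, zero_mul])

end Bim

/-- Intervals of length at most one which are disjoint modulo `ℤ` have bounded total length. -/
theorem sum_length_le_two {ι : Type*} (s : Finset ι) (a b : ι → ℝ)
    (hab : ∀ i ∈ s, a i ≤ b i) (h1 : ∀ i ∈ s, b i - a i ≤ 1)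
    (hd : ∀ i ∈ s, ∀ j ∈ s, i ≠ j → ∀ k : ℤ, ∀ x ∈ Ioo (a i) (b i), x + k ∉ Ioo (a j) (b j)) :
    ∑ i ∈ s, (b i - a i) ≤ 2 := by
  set I : ι → Set ℝ := fun i => Ioo (a i - ⌊a i⌋) (b i - ⌊a i⌋) with hI
  have hdis : (s : Set ι).PairwiseDisjoint I := by
    intro i hi j hj hij
    rw [Function.onFun, Set.disjoint_left]
    intro x hx hx'
    refine hd i hi j hj hij (⌊a j⌋ - ⌊a i⌋) (x + ⌊a i⌋) ⟨by linarith [hx.1], by linarith [hx.2]⟩ ?_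
    push_cast
    exact ⟨by linarith [hx'.1], by linarith [hx'.2]⟩
  have hsub : ⋃ i ∈ s, I i ⊆ Icc (0 : ℝ) 2 := by
    intro x hx
    simp only [mem_iUnion] at hx
    obtain ⟨i, hi, hx⟩ := hx
    have := h1 i hi
    exact ⟨by linarith [hx.1, Int.floor_le (a i)], by linarith [hx.2, Int.lt_floor_add_one (a i)]⟩
  have hm := measure_biUnion_finset (μ := volume) hdis fun i _ => measurableSet_Ioo
  have hle : ∑ i ∈ s, volume (I i) ≤ ENNReal.ofReal 2 := by
    rw [← hm]; refine (measure_mono hsub).trans ?_; simp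
  have he : ∑ i ∈ s, volume (I i) = ENNReal.ofReal (∑ i ∈ s, (b i - a i)) := by
    rw [ENNReal.ofReal_sum_of_nonneg fun i hi => by linarith [hab i hi]]
    refine Finset.sum_congr rfl fun i _ => ?_
    rw [hI, Real.volume_Ioo]; congr 1; ring
  rw [he] at hle
  exact (ENNReal.ofReal_le_ofReal_iff (by norm_num)).1 hle

namespace Bim

variable {B : Bim}

/-- Iterates of an interval which are disjoint modulo `ℤ` have bounded total length. -/
theorem sum_iter_le_two {n : ℕ} {a b : ℝ} (h : B.Reg n (Ioo a b)) (hab : a < b) (s : Finset ℕ)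
    (hs : ∀ i ∈ s, i < n)
    (hd : ∀ i ∈ s, ∀ j ∈ s, i < j → ∀ k : ℤ, ∀ x ∈ Ioo a b, ∀ y ∈ Ioo a b,
      B.F^[i] x + k ≠ B.F^[j] y) :
    ∑ i ∈ s, |B.F^[i] b - B.F^[i] a| ≤ 2 := by
  have hp : ∀ i, ∃ A C, i ∈ s → B.Pb i a b A C := by
    intro i
    by_cases hi : i ∈ s
    · obtain ⟨A, C, hp⟩ := (h.of_le (hs i hi).le).exists_pb hab
      exact ⟨A, C, fun _ => hp⟩
    · exact ⟨0, 0, fun h => absurd h hi⟩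
  choose A C hp using hp
  have e : ∑ i ∈ s, |B.F^[i] b - B.F^[i] a| = ∑ i ∈ s, (C i - A i) :=
    Finset.sum_congr rfl fun i hi => (hp i hi).length
  rw [e]
  refine sum_length_le_two s A C (fun i hi => (hp i hi).lt'.le) (fun i hi => ?_) ?_
  · rw [← (hp i hi).length]; exact h.length_le_one hab (hs i hi)
  · intro i hi j hj hij k x hx hx'
    obtain ⟨u, hu, rfl⟩ := (hp i hi).exists_preimage hx
    obtain ⟨v, hv, e⟩ := (hp j hj).exists_preimage hx'
    rcases lt_or_gt_of_ne hij with hlt | hlt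
    · exact hd i hi j hj hlt k u hu v hv e.symm
    · exact hd j hj i hi hlt (-k) v hv u hu (by rw [e]; push_cast; ring)

theorem csum_le_two {n : ℕ} {a b : ℝ} (h : B.Reg n (Ioo a b)) (hab : a < b)
    (hd : ∀ i j, i < j → j < n → ∀ k : ℤ, ∀ x ∈ Ioo a b, ∀ y ∈ Ioo a b,
      B.F^[i] x + k ≠ B.F^[j] y) : B.csum n a b ≤ 2 :=
  sum_iter_le_two h hab _ (fun _ hi => Finset.mem_range.1 hi)
    fun i _ j hj hij => hd i j hij (Finset.mem_range.1 hj)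

end Bim

namespace Bim

variable {B : Bim}

lemma koebe_ratio {E : ℝ} (hE : B.CrossBound E 2) {m : ℕ} {α β x y d S : ℝ}
    (h : B.Reg m (Ioo α β)) (hx : x ∈ Ioo α β) (hd : d ∈ Ioo α β) (hb : Betw x y d)
    (hS : B.csum m x y ≤ S)
    (hle : |B.F^[m] x - B.F^[m] y| ≤ |B.F^[m] d - B.F^[m] y|) :
    2 * Real.log (|d - x| / |d - y|) ≤
      Real.log (B.dn m y) - Real.log (B.dn m x) + E * S + 2 * Real.log 2 := by
  have hy : y ∈ Ioo α β := by
    rcases hb with h | h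
    · exact ⟨hx.1.trans h.1, h.2.trans hd.2⟩
    · exact ⟨hd.1.trans h.1, h.2.trans hx.2⟩
  have hαβ : α < β := hx.1.trans hx.2
  have hk := koebe hE h hx hd hb (by
    intro i hi
    have h1 := h.length_le_one hαβ hi
    obtain ⟨A1, C1, h2⟩ := (h.of_le hi.le).exists_pb hαβ
    rw [h2.length] at h1
    have x1 := h2.mem_Ioo hx
    have x2 := h2.mem_Ioo hd
    rw [abs_lt]; constructor <;> linarith [x1.1, x1.2, x2.1, x2.2])
  have hES : E * B.csum m x y ≤ E * S := mul_le_mul_of_nonneg_left hS hE.1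
  have hbF := (h.betw (Ioo_subset_Icc_self hx) (Ioo_subset_Icc_self hy)
    (Ioo_subset_Icc_self hd)).2 hb
  have p1 : 0 < |d - x| := by
    rw [abs_pos]; rcases hb with hb | hb
    · linarith
    · linarith
  have p2 : 0 < |d - y| := by
    rw [abs_pos]; rcases hb with hb | hb
    · linarith
    · linarith
  have p3 : 0 < |B.F^[m] d - B.F^[m] y| := by
    rw [abs_pos]; rcases hbF with hb | hb
    · linarith
    · linarith
  have p4 : 0 < |B.F^[m] d - B.F^[m] x| := by
    rw [abs_pos]; rcases hbF with hb | hb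
    · linarith
    · linarith
  have hlog : Real.log |B.F^[m] d - B.F^[m] x| ≤ Real.log 2 + Real.log |B.F^[m] d - B.F^[m] y| := by
    rw [← Real.log_mul (by norm_num) p3.ne']
    apply Real.log_le_log p4
    have := abs_sub_le (B.F^[m] d) (B.F^[m] y) (B.F^[m] x)
    rw [abs_sub_comm (B.F^[m] y) (B.F^[m] x)] at this
    linarith
  rw [Real.log_div p1.ne' p2.ne']
  unfold crossLog at hk
  simp only [Real.log_abs] at *
  unfold dn
  linarith

variable (B) in
/-- The points whose orbit hits a critical point. -/
def Zset : Set ℝ := {z | ∃ n, B.dn n z = 0}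

lemma mem_Zset_add_int {z : ℝ} (k : ℤ) : z + k ∈ B.Zset ↔ z ∈ B.Zset := by
  simp only [Zset, mem_ofPred_eq, dn_translate]

lemma iter_mem_Zset {z : ℝ} {n : ℕ} (h : B.F^[n] z ∈ B.Zset) : z ∈ B.Zset := by
  obtain ⟨m, hm⟩ := h
  exact ⟨m + n, by rw [dn_add, hm, zero_mul]⟩

lemma crit_mem_Zset {z : ℝ} (h : deriv B.F z = 0) : z ∈ B.Zset := ⟨1, by rwa [dn_one]⟩

variable (B) in
/-- `(a, b)` is a connected component of the interior of the complement of `Zset`. -/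
structure Hom (a b : ℝ) : Prop where
  lt : a < b
  free : ∀ x ∈ Ioo a b, x ∉ B.Zset
  left : ∀ τ > 0, ∃ z ∈ B.Zset, z ∈ Ioc (a - τ) a
  right : ∀ τ > 0, ∃ z ∈ B.Zset, z ∈ Ico b (b + τ)

lemma exists_hom {s t : ℝ} (hst : s < t) (h : ∀ x ∈ Ioo s t, x ∉ B.Zset) :
    ∃ a b, a ≤ s ∧ t ≤ b ∧ B.Hom a b := by
  set y := (s + t) / 2
  have hy : y ∈ Ioo s t := ⟨by simp only [y]; linarith, by simp only [y]; linarith⟩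
  set L := B.Zset ∩ Iic y
  set R := B.Zset ∩ Ici y
  have hp : ∀ k : ℤ, B.p + k ∈ B.Zset := fun k => crit_mem_Zset (by
    rw [deriv_eq_zero_iff]; exact ⟨k, Or.inl (by ring)⟩)
  have hLn : L.Nonempty := ⟨B.p + ⌊y - B.p⌋, hp _, by
    simp only [mem_Iic]; linarith [Int.floor_le (y - B.p)]⟩
  have hRn : R.Nonempty := ⟨B.p + ⌈y - B.p⌉, hp _, by
    simp only [mem_Ici]; linarith [Int.le_ceil (y - B.p)]⟩
  have hLs : ∀ z ∈ L, z ≤ s := fun z hz => by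
    by_contra hc; push Not at hc
    exact h z ⟨hc, (show z ≤ y from hz.2).trans_lt hy.2⟩ hz.1
  have hRt : ∀ z ∈ R, t ≤ z := fun z hz => by
    by_contra hc; push Not at hc
    exact h z ⟨hy.1.trans_le (show y ≤ z from hz.2), hc⟩ hz.1
  have bL : BddAbove L := ⟨s, hLs⟩
  have bR : BddBelow R := ⟨t, hRt⟩
  have ha := csSup_le hLn hLs
  have hb := le_csInf hRn hRt
  refine ⟨sSup L, sInf R, ha, hb, by linarith, ?_, ?_, ?_⟩
  · intro x hx hz
    rcases le_total x y with hxy | hxy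
    · exact (le_csSup bL ⟨hz, hxy⟩).not_gt hx.1
    · exact (csInf_le bR ⟨hz, hxy⟩).not_gt hx.2
  · intro τ hτ
    obtain ⟨z, hz, h1⟩ := exists_lt_of_lt_csSup hLn (show sSup L - τ < sSup L by linarith)
    exact ⟨z, hz.1, h1, le_csSup bL hz⟩
  · intro τ hτ
    obtain ⟨z, hz, h1⟩ := exists_lt_of_csInf_lt hRn (show sInf R < sInf R + τ by linarith)
    exact ⟨z, hz.1, csInf_le bR hz, h1⟩

namespace Hom

variable {a b : ℝ}

lemma reg (h : B.Hom a b) (n : ℕ) : B.Reg n (Ioo a b) := fun x hx h0 => h.free x hx ⟨n, h0⟩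

/-- Components are maximal. -/
lemma absorb (h : B.Hom a b) {A C x : ℝ} {k : ℤ} (hf : ∀ x ∈ Ioo A C, x ∉ B.Zset)
    (hx : x ∈ Ioo a b) (hx' : x + k ∈ Ioo A C) : a + k ≤ A ∧ C ≤ b + k := by
  constructor
  · by_contra hc; push Not at hc
    obtain ⟨z, hz, h1, h2⟩ := h.left (a + k - A) (by linarith)
    exact hf (z + k) ⟨by linarith, by linarith [hx.1, hx'.2]⟩ ((mem_Zset_add_int k).2 hz)
  · by_contra hc; push Not at hc
    obtain ⟨z, hz, h1, h2⟩ := h.right (C - (b + k)) (by linarith)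
    exact hf (z + k) ⟨by linarith [hx.2, hx'.1], by linarith⟩ ((mem_Zset_add_int k).2 hz)

lemma image_free (h : B.Hom a b) {n : ℕ} {A C : ℝ} (hp : B.Pb n a b A C) :
    ∀ x ∈ Ioo A C, x ∉ B.Zset := by
  intro x hx hz
  obtain ⟨w, hw, rfl⟩ := hp.exists_preimage hx
  exact h.free w hw (iter_mem_Zset hz)

lemma disjoint (h : B.Hom a b) {i j : ℕ} (hij : i < j) (k : ℤ) {x y : ℝ} (hx : x ∈ Ioo a b)
    (hy : y ∈ Ioo a b) : B.F^[i] x + k ≠ B.F^[j] y := by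
  intro e
  obtain ⟨n, rfl⟩ := Nat.exists_eq_add_of_lt hij
  obtain ⟨A, C, hi⟩ := (h.reg i).exists_pb h.lt
  obtain ⟨a', b', ha', hb', h'⟩ := B.exists_hom hi.lt' (h.image_free hi)
  obtain ⟨A', C', hn⟩ := (h'.reg (n + 1)).exists_pb h'.lt
  have hsub : Ioo A C ⊆ Ioo a' b' := Ioo_subset_Ioo ha' hb'
  have := h'.absorb (k := k) (h'.image_free hn) (hsub (hi.mem_Ioo hx)) (by
    rw [e, show i + n + 1 = (n + 1) + i by ring, iter_add]
    exact hn.mem_Ioo (hsub (hi.mem_Ioo hy)))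
  exact hn.not_trap (by omega) k this.1 this.2

lemma csum_le (h : B.Hom a b) (n : ℕ) : B.csum n a b ≤ 2 :=
  csum_le_two (h.reg n) h.lt fun _ _ hij _ k _ hx _ hy => h.disjoint hij k hx hy

lemma csum_le' (h : B.Hom a b) (n : ℕ) {x y : ℝ} (hx : x ∈ Ioo a b) (hy : y ∈ Ioo a b) :
    B.csum n x y ≤ 2 := by
  refine le_trans (Finset.sum_le_sum fun i _ => ?_) (h.csum_le n)
  obtain ⟨A, C, hi⟩ := (h.reg i).exists_pb h.lt
  rw [hi.length]
  have h1 := hi.mem_Ioo hx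
  have h2 := hi.mem_Ioo hy
  rw [abs_le]; constructor <;> linarith [h1.1, h1.2, h2.1, h2.2]

lemma length_small (h : B.Hom a b) {ε : ℝ} (hε : 0 < ε) :
    ∃ N, ∀ n ≥ N, |B.F^[n] b - B.F^[n] a| < ε := by
  have hs : Summable fun i => |B.F^[i] b - B.F^[i] a| :=
    summable_of_sum_range_le (fun _ => abs_nonneg _) (fun n => h.csum_le n)
  have := hs.tendsto_atTop_zero
  obtain ⟨N, hN⟩ := (Metric.tendsto_atTop.1 this) ε hε
  exact ⟨N, fun n hn => by simpa using hN n hn⟩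

lemma abs_iter_lt (h : B.Hom a b) {n : ℕ} {ε : ℝ} (hl : |B.F^[n] b - B.F^[n] a| ≤ ε) {x y : ℝ}
    (hx : x ∈ Ioo a b) (hy : y ∈ Ioo a b) : |B.F^[n] x - B.F^[n] y| < ε := by
  obtain ⟨A, C, hi⟩ := (h.reg n).exists_pb h.lt
  rw [hi.length] at hl
  have h1 := hi.mem_Ioo hx
  have h2 := hi.mem_Ioo hy
  rw [abs_lt]; constructor <;> linarith [h1.1, h1.2, h2.1, h2.2]

lemma log_unbounded (K : ℝ) {D : ℝ} (hD : 0 < D) : ∃ τ > 0, τ < D ∧ K < Real.log (D / τ) := by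
  refine ⟨D / Real.exp (|K| + 1), by positivity, ?_, ?_⟩
  · apply div_lt_self hD
    apply Real.one_lt_exp_iff.2; positivity
  · rw [div_div_cancel₀ hD.ne', Real.log_exp]
    linarith [le_abs_self K]

/-- A component cannot have infinitely many images with definite space around. -/
theorem not_extensible (h : B.Hom a b) {x0 r : ℝ} (hx0 : x0 ∈ Ioo a b) (hr : 0 < r)
    (hext : ∀ N, ∃ m ≥ N, ∃ α β A C, B.Pb m α β A C ∧ x0 ∈ Ioo α β ∧
      A + r < B.F^[m] x0 ∧ B.F^[m] x0 < C - r) : False := by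
  obtain ⟨E, hE⟩ := B.exists_crossBound
  have hab : 0 < b - a := sub_pos.2 h.lt
  obtain ⟨τ, hτ, hτ', hlog⟩ := log_unbounded (E * 2 + 2 * Real.log 2) (D := (b - a) / 4)
    (by linarith)
  obtain ⟨N, hN⟩ := h.length_small (ε := r / 4) (by linarith)
  obtain ⟨z1, ⟨n1, hz1⟩, hz1'⟩ := h.left τ hτ
  obtain ⟨z2, ⟨n2, hz2⟩, hz2'⟩ := h.right τ hτ
  obtain ⟨m, hm, α, β, A, C, hp, hx0', hA, hC⟩ := hext (N + n1 + n2)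
  have hclose : ∀ x ∈ Ioo a b, |B.F^[m] x - B.F^[m] x0| < r / 4 := fun x hx =>
    h.abs_iter_lt (hN m (by omega)).le hx hx0
  have hαa : α ≤ a := by
    by_contra hc; push Not at hc
    have h1 := hclose α ⟨hc, hx0'.1.trans hx0.2⟩
    rw [abs_lt] at h1
    rcases hp.left_mem with e | e <;> rw [e] at h1 <;> linarith
  have hβb : b ≤ β := by
    by_contra hc; push Not at hc
    have h1 := hclose β ⟨hx0.1.trans hx0'.2, hc⟩
    rw [abs_lt] at h1
    rcases hp.right_mem with e | e <;> rw [e] at h1 <;> linarith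
  have hα : a - τ ≤ α := by
    by_contra hc; push Not at hc
    rcases eq_or_lt_of_le hz1'.2 with e | e
    · rcases eq_or_lt_of_le hαa with e' | e'
      · linarith
      · exact hp.reg.of_le (by omega : n1 ≤ m) z1 ⟨by linarith [hz1'.1], by linarith [h.lt]⟩ hz1
    · exact hp.reg.of_le (by omega : n1 ≤ m) z1 ⟨by linarith [hz1'.1], by linarith [h.lt]⟩ hz1
  have hβ : β ≤ b + τ := by
    by_contra hc; push Not at hc
    exact hp.reg.of_le (by omega : n2 ≤ m) z2 ⟨by linarith [hz2'.1, h.lt], by linarith [hz2'.2]⟩ hz2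
  set x := a + τ
  set y := b - τ
  have hx : x ∈ Ioo a b := ⟨by simp only [x]; linarith, by simp only [x]; linarith⟩
  have hy : y ∈ Ioo a b := ⟨by simp only [y]; linarith, by simp only [y]; linarith⟩
  have hxy : x < y := by simp only [x, y]; linarith
  have hsub : Ioo a b ⊆ Ioo α β := Ioo_subset_Ioo hαa hβb
  have hxy' : |B.F^[m] x - B.F^[m] y| < r / 2 := by
    have := abs_sub_le (B.F^[m] x) (B.F^[m] x0) (B.F^[m] y)
    rw [abs_sub_comm (B.F^[m] x0)] at this
    linarith [hclose x hx, hclose y hy]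
  have hx4 := abs_lt.1 (hclose x hx)
  have hy4 := abs_lt.1 (hclose y hy)
  obtain ⟨d1, hd1, e1⟩ := hp.exists_preimage (y := B.F^[m] y + r / 2)
    ⟨by linarith [hy4.1], by linarith [hy4.2]⟩
  obtain ⟨d2, hd2, e2⟩ := hp.exists_preimage (y := B.F^[m] y - r / 2)
    ⟨by linarith [hy4.1], by linarith [hy4.2]⟩
  obtain ⟨d3, hd3, e3⟩ := hp.exists_preimage (y := B.F^[m] x + r / 2)
    ⟨by linarith [hx4.1], by linarith [hx4.2]⟩
  obtain ⟨d4, hd4, e4⟩ := hp.exists_preimage (y := B.F^[m] x - r / 2)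
    ⟨by linarith [hx4.1], by linarith [hx4.2]⟩
  have hxI := Ioo_subset_Icc_self (hsub hx)
  have hyI := Ioo_subset_Icc_self (hsub hy)
  have hne : B.F^[m] x ≠ B.F^[m] y := fun e => hxy.ne (hp.injOn hxI hyI e)
  -- a point beyond `y`
  obtain ⟨d, hd, hdb, hdl⟩ : ∃ d ∈ Ioo α β, Betw x y d ∧
      |B.F^[m] x - B.F^[m] y| ≤ |B.F^[m] d - B.F^[m] y| := by
    rcases lt_or_gt_of_ne hne with hlt | hlt
    · refine ⟨d1, hd1, (hp.reg.betw hxI hyI (Ioo_subset_Icc_self hd1)).1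
        (Or.inl ⟨hlt, by linarith⟩), ?_⟩
      rw [e1, add_sub_cancel_left, abs_of_pos (show 0 < r / 2 by linarith)]; exact hxy'.le
    · refine ⟨d2, hd2, (hp.reg.betw hxI hyI (Ioo_subset_Icc_self hd2)).1
        (Or.inr ⟨by linarith, hlt⟩), ?_⟩
      rw [e2, show B.F^[m] y - r / 2 - B.F^[m] y = -(r / 2) by ring, abs_neg,
        abs_of_pos (show 0 < r / 2 by linarith)]; exact hxy'.le
  obtain ⟨d', hd', hdb', hdl'⟩ : ∃ d ∈ Ioo α β, Betw y x d ∧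
      |B.F^[m] y - B.F^[m] x| ≤ |B.F^[m] d - B.F^[m] x| := by
    rw [abs_sub_comm] at hxy'
    rcases lt_or_gt_of_ne hne with hlt | hlt
    · refine ⟨d4, hd4, (hp.reg.betw hyI hxI (Ioo_subset_Icc_self hd4)).1
        (Or.inr ⟨by linarith, hlt⟩), ?_⟩
      rw [e4, show B.F^[m] x - r / 2 - B.F^[m] x = -(r / 2) by ring, abs_neg,
        abs_of_pos (show 0 < r / 2 by linarith)]; exact hxy'.le
    · refine ⟨d3, hd3, (hp.reg.betw hyI hxI (Ioo_subset_Icc_self hd3)).1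
        (Or.inl ⟨hlt, by linarith⟩), ?_⟩
      rw [e3, add_sub_cancel_left, abs_of_pos (show 0 < r / 2 by linarith)]; exact hxy'.le
  have k1 := koebe_ratio hE hp.reg (hsub hx) hd hdb (h.csum_le' m hx hy) hdl
  have k2 := koebe_ratio hE hp.reg (hsub hy) hd' hdb' (h.csum_le' m hy hx) hdl'
  have hdy : y < d := by
    rcases hdb with hh | hh
    · exact hh.2
    · linarith [hh.2]
  have hdx : d' < x := by
    rcases hdb' with hh | hh
    · linarith [hh.1]
    · exact hh.1
  have l1 : Real.log ((b - a) / 4 / τ) ≤ Real.log (|d - x| / |d - y|) := by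
    apply Real.log_le_log (by positivity)
    rw [abs_of_pos (by linarith), abs_of_pos (by linarith), div_le_div_iff₀ hτ (by linarith)]
    have : d - y ≤ 2 * τ := by simp only [y]; linarith [hd.2]
    have : (b - a) / 2 ≤ d - x := by simp only [x, y] at hdy ⊢; linarith [hd.2]
    nlinarith
  have l2 : Real.log ((b - a) / 4 / τ) ≤ Real.log (|d' - y| / |d' - x|) := by
    apply Real.log_le_log (by positivity)
    rw [abs_of_neg (by linarith), abs_of_neg (by linarith), div_le_div_iff₀ hτ (by linarith)]
    have : x - d' ≤ 2 * τ := by simp only [x]; linarith [hd'.1]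
    have : (b - a) / 2 ≤ y - d' := by simp only [x, y] at hdx ⊢; linarith [hd'.1]
    nlinarith
  linarith [hE.1, Real.log_pos (show (1 : ℝ) < 2 by norm_num)]

end Hom

end Bim

/-- A sequence accumulating at a lower bound has arbitrarily late strict records. -/
lemma exists_strict_record {u : ℕ → ℝ} {q : ℝ} (hq : ∀ i, q < u i)
    (h : ∀ ε > 0, ∃ i, u i < q + ε) {ε : ℝ} (hε : 0 < ε) (N : ℕ) :
    ∃ m ≥ N, u m < q + ε ∧ ∀ i < m, u m < u i := by
  obtain ⟨j, -, hj⟩ := (Finset.range (N + 1)).exists_min_image u ⟨0, by simp⟩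
  have hε' : 0 < min ε (u j - q) := lt_min hε (by linarith [hq j])
  classical
  have hex := h _ hε'
  set m := Nat.find hex with hm
  have hms := Nat.find_spec hex
  refine ⟨m, ?_, by linarith [min_le_left ε (u j - q)], fun i hi => ?_⟩
  · by_contra hc
    have := hj m (by simp; omega)
    linarith [min_le_right ε (u j - q)]
  · have := Nat.find_min hex hi
    push Not at this
    exact hms.trans_le this

namespace Bim

variable {B : Bim}

/-- Orbits avoiding the closed decreasing lap stay in translates of the increasing lap. -/
lemma exists_lap_seq {x : ℝ} (hz : x ∉ B.Zset) (hI : ∀ i, ¬ B.InI (B.F^[i] x)) :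
    ∃ κ : ℕ → ℤ, ∀ i, B.F^[i] x - κ i ∈ Ioo B.q (B.p + 1) := by
  have : ∀ i, ∃ k : ℤ, B.F^[i] x - k ∈ Ioo B.q (B.p + 1) := by
    intro i
    obtain ⟨k, h | h | h | h⟩ := B.exists_lap (B.F^[i] x)
    · exact absurd (iter_mem_Zset (crit_mem_Zset ((B.deriv_eq_zero_iff _).2 ⟨k, Or.inl h⟩))) hz
    · exact absurd ⟨k, h⟩ (hI i)
    · exact absurd (iter_mem_Zset (crit_mem_Zset ((B.deriv_eq_zero_iff _).2 ⟨k, Or.inr h⟩))) hz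
    · exact ⟨k, h⟩
  choose κ hκ using this
  exact ⟨κ, hκ⟩

lemma log_dn_le {s t C : ℝ} (h0 : ∀ x ∈ Icc s t, deriv B.F x ≠ 0)
    (hC : ∀ x ∈ Icc s t, ∀ y ∈ Icc s t,
      |Real.log (deriv B.F y) - Real.log (deriv B.F x)| ≤ C * |y - x|)
    {m : ℕ} {x y : ℝ} {κ : ℕ → ℤ} (hx : ∀ i < m, B.F^[i] x - κ i ∈ Icc s t)
    (hy : ∀ i < m, B.F^[i] y - κ i ∈ Icc s t) :
    |Real.log (B.dn m y) - Real.log (B.dn m x)| ≤ C * B.csum m x y ∧ B.dn m x ≠ 0 ∧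
      B.dn m y ≠ 0 := by
  induction m with
  | zero => simp [csum]
  | succ m ih =>
    obtain ⟨ih, ix, iy⟩ := ih (fun i hi => hx i (by omega)) (fun i hi => hy i (by omega))
    have h1 := hC _ (hx m (by omega)) _ (hy m (by omega))
    have nx := h0 _ (hx m (by omega))
    have ny := h0 _ (hy m (by omega))
    rw [deriv_sub_int] at nx ny
    rw [deriv_sub_int, deriv_sub_int, sub_sub_sub_cancel_right] at h1
    refine ⟨?_, by rw [dn_succ']; exact mul_ne_zero nx ix, by rw [dn_succ']; exact mul_ne_zero ny iy⟩
    rw [dn_succ', dn_succ', Real.log_mul nx ix, Real.log_mul ny iy, csum_succ, mul_add]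
    calc _ = |(Real.log (B.dn m y) - Real.log (B.dn m x)) +
        (Real.log (deriv B.F (B.F^[m] y)) - Real.log (deriv B.F (B.F^[m] x)))| := by congr 1; ring
      _ ≤ _ := (abs_add_le _ _).trans (add_le_add ih h1)

lemma not_crit_of_mem_Ioo {z : ℝ} {k : ℤ} (h : z - k ∈ Ioo B.q (B.p + 1)) : deriv B.F z ≠ 0 := by
  rw [← B.deriv_sub_int z k]; exact (B.incr _ h).ne'

namespace Hom

variable {a b : ℝ}

/-- A component with small images staying away from the critical points is impossible. -/
theorem not_away (h : B.Hom a b) {y ε : ℝ} (hy : y ∈ Ioo a b) (hε : 0 < ε) {κ : ℕ → ℤ}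
    (hκ : ∀ i, B.F^[i] y - κ i ∈ Icc (B.q + ε) (B.p + 1 - ε))
    (hl : ∀ i, |B.F^[i] b - B.F^[i] a| ≤ ε / 4) : False := by
  obtain ⟨E, hE⟩ := B.exists_crossBound
  have h0 : ∀ x ∈ Icc (B.q + ε / 2) (B.p + 1 - ε / 2), deriv B.F x ≠ 0 := fun x hx =>
    (B.incr x ⟨by linarith [hx.1], by linarith [hx.2]⟩).ne'
  obtain ⟨C, hC0, hC⟩ := log_deriv_lipschitz B.smooth _ _ h0
  have hcl : ∀ i, ∀ x ∈ Icc a b, |B.F^[i] x - B.F^[i] y| ≤ ε / 4 := by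
    intro i x hx
    obtain ⟨A, C, hi⟩ := (h.reg i).exists_pb h.lt
    have := hl i
    rw [hi.length] at this
    have h1 := hi.mem_Icc hx
    have h2 := hi.mem_Ioo hy
    rw [abs_le]; constructor <;> linarith [h1.1, h1.2, h2.1, h2.2]
  have hin : ∀ x ∈ Icc a b, ∀ i, B.F^[i] x - κ i ∈ Icc (B.q + ε / 2) (B.p + 1 - ε / 2) := by
    intro x hx i
    have h1 := abs_le.1 (hcl i x hx)
    have h2 := hκ i
    exact ⟨by linarith [h2.1], by linarith [h2.2]⟩
  have hab : 0 < b - a := sub_pos.2 h.lt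
  obtain ⟨τ, hτ, hτ', hlog⟩ := log_unbounded (C + E + Real.log 2) (D := (b - a) / 8) (by linarith)
  have hbz : b ∉ B.Zset := by
    rintro ⟨n, hn⟩
    exact (log_dn_le h0 hC (fun i (_ : i < n) => hin b ⟨h.lt.le, le_rfl⟩ i)
      (fun i _ => hin b ⟨h.lt.le, le_rfl⟩ i)).2.1 hn
  classical
  have hex : ∃ n, ∃ z ∈ Ioo b (b + τ), B.dn n z = 0 := by
    obtain ⟨z, ⟨n, hz⟩, hz'⟩ := h.right τ hτ
    refine ⟨n, z, ⟨lt_of_le_of_ne hz'.1 ?_, hz'.2⟩, hz⟩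
    rintro rfl
    exact hbz ⟨n, hz⟩
  obtain ⟨z, hz, hz0⟩ := Nat.find_spec hex
  have hmin := fun m hm => Nat.find_min (H := hex) (m := m) hm
  set n := Nat.find hex
  obtain ⟨m, hm⟩ : ∃ m, n = m + 1 := by
    refine ⟨n - 1, ?_⟩
    have : n ≠ 0 := by intro e; rw [e] at hz0; simp at hz0
    omega
  have hmin := hmin m (by omega)
  push Not at hmin
  have hreg : B.Reg m (Ioo a (b + τ)) := by
    intro x hx h0
    rcases lt_trichotomy x b with hxb | rfl | hxb
    · exact h.free x ⟨hx.1, hxb⟩ ⟨m, h0⟩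
    · exact hbz ⟨m, h0⟩
    · exact hmin x ⟨hxb, hx.2⟩ h0
  have hzc : deriv B.F (B.F^[m] z) = 0 := by
    rw [hm, dn_succ'] at hz0
    exact (mul_eq_zero.1 hz0).resolve_right (hmin z hz)
  set x := (a + b) / 2
  set y' := b - τ
  have hx : x ∈ Ioo a b := ⟨by simp only [x]; linarith, by simp only [x]; linarith⟩
  have hy' : y' ∈ Ioo a b := ⟨by simp only [y']; linarith, by simp only [y']; linarith⟩
  have hxy : x < y' := by simp only [x, y']; linarith
  have k1 := koebe_ratio hE hreg (x := x) (y := y') (d := z) ⟨hx.1, by linarith [hx.2]⟩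
    ⟨by linarith [hz.1], hz.2⟩ (Or.inl ⟨hxy, hy'.2.trans hz.1⟩) (h.csum_le' m hx hy') (by
      have e1 := (h.abs_iter_lt (hl m) hx hy').le
      refine e1.trans ?_
      by_contra hc
      push Not at hc
      have e2 := abs_lt.1 hc
      have e3 := hin y' (Ioo_subset_Icc_self hy') m
      exact not_crit_of_mem_Ioo (k := κ m) ⟨by linarith [e3.1], by linarith [e3.2]⟩ hzc)
  have k2 := (log_dn_le h0 hC (fun i (_ : i < m) => hin x (Ioo_subset_Icc_self hx) i)
    (fun i _ => hin y' (Ioo_subset_Icc_self hy') i)).1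
  have k3 := (le_abs_self _).trans k2
  have k4 : C * B.csum m x y' ≤ C * 2 := mul_le_mul_of_nonneg_left (h.csum_le' m hx hy') hC0
  have l1 : Real.log ((b - a) / 8 / τ) ≤ Real.log (|z - x| / |z - y'|) := by
    apply Real.log_le_log (by positivity)
    have hzx : 0 < z - x := by linarith [hx.2, hz.1]
    have hzy : 0 < z - y' := by linarith [hy'.2, hz.1]
    rw [abs_of_pos hzx, abs_of_pos hzy, div_le_div_iff₀ hτ hzy]
    have : z - y' ≤ 2 * τ := by simp only [y']; linarith [hz.2]
    have : (b - a) / 2 ≤ z - x := by simp only [x]; linarith [hz.1]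
    nlinarith
  linarith

/-- There are no components: critical preimages are dense. -/
theorem false (h : B.Hom a b) : False := by
  have hdp := B.hdp
  have hdq := B.hdq
  have hpq := B.hpq
  set y := (a + b) / 2
  have hy : y ∈ Ioo a b := ⟨by simp only [y]; linarith [h.lt], by simp only [y]; linarith [h.lt]⟩
  by_cases hinf : ∀ N, ∃ m ≥ N, B.InI (B.F^[m] y)
  · refine h.not_extensible hy (r := min (B.p - B.dq) (B.dp - B.q))
      (lt_min (by linarith [hdq.2]) (by linarith [hdp.1])) fun N => ?_
    obtain ⟨m, hm, k, hk⟩ := hinf N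
    obtain ⟨α, β, hx, hp⟩ := B.exists_extension m y k hk
    refine ⟨m, hm, α, β, _, _, hp, hx, ?_, ?_⟩
    · linarith [hk.1, min_le_left (B.p - B.dq) (B.dp - B.q)]
    · linarith [hk.2, min_le_right (B.p - B.dq) (B.dp - B.q)]
  push Not at hinf
  obtain ⟨N, hN⟩ := hinf
  -- components of the iterates
  have hcomp : ∀ l, ∃ A C, B.Hom A C ∧ B.F^[l] y ∈ Ioo A C := by
    intro l
    obtain ⟨A, C, hi⟩ := (h.reg l).exists_pb h.lt
    obtain ⟨a', b', ha', hb', h'⟩ := B.exists_hom hi.lt' (h.image_free hi)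
    exact ⟨a', b', h', Ioo_subset_Ioo ha' hb' (hi.mem_Ioo hy)⟩
  choose A C hH hmem using hcomp
  have hsub : ∀ i n, ∀ A' C', B.Pb n (A i) (C i) A' C' → A (n + i) ≤ A' ∧ C' ≤ C (n + i) := by
    intro i n A' C' hp
    have := (hH (n + i)).absorb (k := 0) ((hH i).image_free hp) (hmem (n + i)) (by
      rw [Int.cast_zero, add_zero, iter_add]; exact hp.mem_Ioo (hmem i))
    simpa using this
  have hdis : ∀ i j, i < j → ∀ k : ℤ, ∀ x ∈ Ioo (A i) (C i), x + k ∉ Ioo (A j) (C j) := by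
    intro i j hij k x hx hx'
    obtain ⟨n, rfl⟩ := Nat.exists_eq_add_of_lt hij
    obtain ⟨A', C', hp⟩ := ((hH i).reg (n + 1)).exists_pb (hH i).lt
    have h1 := hsub i (n + 1) A' C' hp
    rw [show n + 1 + i = i + n + 1 by ring] at h1
    have h2 := (hH i).absorb (k := k) (hH (i + n + 1)).free hx hx'
    exact hp.not_trap (by omega) k (by linarith) (by linarith)
  have hs : Summable fun i => C i - A i := by
    refine summable_of_sum_range_le (c := 2) (fun i => by linarith [(hH i).lt]) fun n => ?_
    refine sum_length_le_two _ A C (fun i _ => (hH i).lt.le) (fun i _ => ?_) ?_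
    · have := ((hH i).reg 1).length_le_one (hH i).lt (i := 0) (by omega)
      simp only [Function.iterate_zero, id] at this
      exact (le_abs_self _).trans this
    · intro i _ j _ hij k x hx hx'
      rcases lt_or_gt_of_ne hij with hlt | hlt
      · exact hdis i j hlt k x hx hx'
      · exact hdis j i hlt (-k) _ hx' (by push_cast; rwa [add_neg_cancel_right])
  have hlen := Metric.tendsto_atTop.1 hs.tendsto_atTop_zero
  have hy'z : B.F^[N] y ∉ B.Zset := (hH N).free _ (hmem N)
  obtain ⟨κ, hκ⟩ := B.exists_lap_seq (x := B.F^[N] y) hy'z fun i => by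
    rw [← iter_add]; exact hN _ (by omega)
  by_cases h1 : ∀ ε > 0, ∃ i, B.F^[i] (B.F^[N] y) - κ i < B.q + ε
  · refine (hH N).not_extensible (hmem N) (r := min ((B.dp - B.q) / 2) (B.q - B.dq))
      (lt_min (by linarith [hdp.1]) (by linarith [hdq.2])) fun M => ?_
    obtain ⟨m, hm, hε, hrec⟩ := exists_strict_record (fun i => (hκ i).1) h1
      (ε := (B.dp - B.q) / 2) (by linarith [hdp.1]) M
    obtain ⟨α, β, hx, hp⟩ := B.exists_extension_record m _ κ (fun i _ => hκ i) hrec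
      (by linarith [hdp.1])
    refine ⟨m, hm, α, β, _, _, hp, hx, ?_, ?_⟩
    · linarith [(hκ m).1, min_le_right ((B.dp - B.q) / 2) (B.q - B.dq)]
    · linarith [min_le_left ((B.dp - B.q) / 2) (B.q - B.dq)]
  by_cases h2 : ∀ ε > 0, ∃ i, B.p + 1 - ε < B.F^[i] (B.F^[N] y) - κ i
  · refine (hH N).not_extensible (hmem N) (r := min ((B.p - B.dq) / 2) (B.dp - B.p))
      (lt_min (by linarith [hdq.2]) (by linarith [hdp.1])) fun M => ?_
    obtain ⟨m, hm, hε, hrec⟩ := exists_strict_record (u := fun i => -(B.F^[i] (B.F^[N] y) - κ i))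
      (q := -(B.p + 1)) (fun i => by linarith [(hκ i).2])
      (fun ε hε => by obtain ⟨i, hi⟩ := h2 ε hε; exact ⟨i, by linarith⟩)
      (ε := (B.p - B.dq) / 2) (by linarith [hdq.2]) M
    obtain ⟨α, β, hx, hp⟩ := B.exists_extension_record' m _ κ (fun i _ => hκ i)
      (fun i hi => by linarith [hrec i hi]) (by linarith [hdq.2])
    refine ⟨m, hm, α, β, _, _, hp, hx, ?_, ?_⟩
    · linarith [min_le_left ((B.p - B.dq) / 2) (B.dp - B.p)]
    · linarith [(hκ m).2, min_le_right ((B.p - B.dq) / 2) (B.dp - B.p)]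
  push Not at h1 h2
  obtain ⟨ε1, hε1, h1⟩ := h1
  obtain ⟨ε2, hε2, h2⟩ := h2
  set ε := min ε1 ε2
  have hε : 0 < ε := lt_min hε1 hε2
  obtain ⟨M, hM⟩ := hlen (ε / 4) (by linarith)
  have hM' : ∀ n ≥ M, C n - A n ≤ ε / 4 := fun n hn => by
    have := hM n hn
    rw [Real.dist_eq, sub_zero] at this
    exact (le_abs_self _).trans this.le
  refine (hH (M + N)).not_away (hmem (M + N)) hε (κ := fun i => κ (i + M)) (fun i => ?_) fun i => ?_
  · rw [iter_add, ← B.iter_add i M]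
    exact ⟨by linarith [h1 (i + M), min_le_left ε1 ε2], by linarith [h2 (i + M), min_le_right ε1 ε2]⟩
  · obtain ⟨A', C', hp⟩ := ((hH (M + N)).reg i).exists_pb (hH (M + N)).lt
    rw [hp.length]
    have := hsub _ _ _ _ hp
    linarith [hM' (i + (M + N)) (by omega)]

end Hom

/-- Critical preimages are dense. -/
theorem exists_mem_Zset {s t : ℝ} (h : s < t) : ∃ z ∈ Ioo s t, z ∈ B.Zset := by
  by_contra hc
  push Not at hc
  obtain ⟨a, b, -, -, hh⟩ := B.exists_hom h hc
  exact hh.false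

/-- A long interval contains a translate of a cell of a fine grid. -/
lemma exists_cell {M : ℕ} (hM0 : (0 : ℝ) < M) {δ a b : ℝ} (hcell : 1 / (M : ℝ) < δ / 2)
    (hlen : δ < b - a) :
    ∃ i < M, ∃ K : ℤ, a ≤ (i : ℝ) / M + K ∧ ((i : ℝ) + 1) / M + K ≤ b := by
  set t := a - ⌊a⌋ with ht
  have ht0 : 0 ≤ t := by rw [ht]; linarith [Int.floor_le a]
  have ht1 : t < 1 := by rw [ht]; linarith [Int.lt_floor_add_one a]
  set j := ⌊t * M⌋₊ + 1 with hj
  have hj1 : t < (j : ℝ) / M := by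
    rw [lt_div_iff₀ hM0, hj]; push_cast; exact Nat.lt_floor_add_one _
  have hj2 : ((j : ℝ)) / M ≤ t + 1 / M := by
    rw [div_le_iff₀ hM0, add_mul, one_div_mul_cancel hM0.ne', hj]; push_cast
    linarith [Nat.floor_le (mul_nonneg ht0 hM0.le)]
  have hjM : j ≤ M := by
    have : ⌊t * M⌋₊ < M := by
      rw [Nat.floor_lt (mul_nonneg ht0 hM0.le)]; nlinarith
    omega
  obtain ⟨i, hi, c, hc⟩ : ∃ i < M, ∃ c : ℤ, (j : ℝ) / M = i / M + c := by
    rcases Nat.lt_or_eq_of_le hjM with hlt | heq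
    · exact ⟨j, hlt, 0, by simp⟩
    · refine ⟨0, by omega, 1, ?_⟩
      rw [heq, div_self hM0.ne']; simp
  have e2 : ((i : ℝ) + 1) / M = i / M + 1 / M := by ring
  exact ⟨i, hi, c + ⌊a⌋, by push_cast; linarith, by push_cast; linarith⟩

variable (B) in
/-- Uniformity: long regular intervals have bounded time and large images. -/
theorem exists_uniform {δ : ℝ} (hδ : 0 < δ) : ∃ r > 0, ∃ N : ℕ, ∀ n a b, a < b →
    B.Reg n (Ioo a b) → (N ≤ n ∨ |B.F^[n] b - B.F^[n] a| ≤ r) → b - a ≤ δ := by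
  obtain ⟨M, hM⟩ := exists_nat_gt (2 / δ)
  have hM0 : (0 : ℝ) < M := lt_trans (by positivity) hM
  have hcell : 1 / (M : ℝ) < δ / 2 := by
    rw [div_lt_div_iff₀ hM0 (by norm_num)]
    rw [div_lt_iff₀ hδ] at hM; linarith
  have hz : ∀ i : ℕ, ∃ z ∈ Ioo ((i : ℝ) / M) ((i + 1 : ℝ) / M), ∃ n, B.dn n z = 0 := by
    intro i
    exact exists_mem_Zset (by rw [div_lt_div_iff_of_pos_right hM0]; linarith)
  choose z hz n hn using hz
  set N := ∑ i ∈ Finset.range M, n i with hN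
  have hnN : ∀ i < M, n i ≤ N := fun i hi =>
    Finset.single_le_sum (f := n) (fun _ _ => Nat.zero_le _) (Finset.mem_range.2 hi)
  have hfind : ∀ n a b, a < b → δ < b - a → N ≤ n → ¬ B.Reg n (Ioo a b) := by
    intro n' a b hab hlen hn' hreg
    obtain ⟨i, hi, K, b1, b2⟩ := exists_cell hM0 hcell hlen
    refine hreg.of_le ((hnN i hi).trans hn') (z i + K) ?_ (by rw [dn_translate]; exact hn i)
    exact ⟨by linarith [(hz i).1], by linarith [(hz i).2]⟩
  -- minimal expansion of long intervals in bounded time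
  have hshort : ∀ n : ℕ, ∃ r > 0, ∀ a b, δ < b - a → B.Reg n (Ioo a b) →
      r < |B.F^[n] b - B.F^[n] a| := by
    intro n
    have hstep : ∀ i : ℕ, ∃ r > 0, (∀ x ∈ Ioo ((i : ℝ) / M) ((i + 1 : ℝ) / M), B.dn n x ≠ 0) →
        r ≤ |B.F^[n] ((i + 1 : ℝ) / M) - B.F^[n] ((i : ℝ) / M)| := by
      intro i
      by_cases hr : ∀ x ∈ Ioo ((i : ℝ) / M) ((i + 1 : ℝ) / M), B.dn n x ≠ 0
      · obtain ⟨A, C, hp⟩ := Reg.exists_pb hr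
          (by rw [div_lt_div_iff_of_pos_right hM0]; linarith)
        refine ⟨C - A, by linarith [hp.lt'], fun _ => hp.length.ge⟩
      · exact ⟨1, one_pos, fun h => absurd h hr⟩
    choose ρ hρ0 hρ using hstep
    have hMn : (Finset.range M).Nonempty := by
      rw [Finset.nonempty_range_iff]; rintro rfl; simp at hM0
    obtain ⟨i0, hi0, hmin⟩ := (Finset.range M).exists_min_image ρ hMn
    refine ⟨ρ i0 / 2, by linarith [hρ0 i0], fun a b hlen hreg => ?_⟩
    obtain ⟨i, hi, K, b1, b2⟩ := exists_cell hM0 hcell hlen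
    have hM1 : 0 < 1 / (M : ℝ) := by positivity
    have e2 : ((i : ℝ) + 1) / M = i / M + 1 / M := by ring
    have b3 : (i : ℝ) / M + K < ((i : ℝ) + 1) / M + K := by rw [e2]; linarith
    have h1 := hρ i (fun x hx => by
      rw [← B.dn_translate n x K]
      exact hreg _ ⟨by linarith [hx.1], by linarith [hx.2]⟩)
    have h2 := hmin i (Finset.mem_range.2 hi)
    have hab : a < b := by linarith
    obtain ⟨A, C, hp⟩ := hreg.exists_pb hab
    have m1 := hp.mem_Icc (x := (i : ℝ) / M + K) ⟨b1, by linarith⟩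
    have m2 := hp.mem_Icc (x := ((i : ℝ) + 1) / M + K) ⟨by linarith, b2⟩
    rw [iter_add_int] at m1 m2
    rw [hp.length]
    have h3 : |B.F^[n] (((i : ℝ) + 1) / M) - B.F^[n] ((i : ℝ) / M)| ≤ C - A := by
      rw [abs_le]; constructor <;> linarith [m1.1, m1.2, m2.1, m2.2]
    linarith [hρ0 i0]
  choose ρ hρ0 hρ using hshort
  obtain ⟨i0, -, hmin⟩ := (Finset.range (N + 1)).exists_min_image ρ ⟨0, by simp⟩
  refine ⟨ρ i0, hρ0 i0, N, fun n a b hab hreg hor => ?_⟩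
  by_contra hc
  push Not at hc
  rcases hor with h | h
  · exact hfind n a b hab hc h hreg
  · by_cases hn : N ≤ n
    · exact hfind n a b hab hc hn hreg
    · linarith [hρ n a b hc hreg, hmin n (by simp; omega)]

end Bim

namespace Bim

variable {B : Bim}

namespace Pb

variable {n m : ℕ} {a b A C A' C' : ℝ}

lemma abs_iter (h : B.Pb n a b A C) (j : ℕ) :
    |B.F^[j + n] b - B.F^[j + n] a| = |B.F^[j] C - B.F^[j] A| := by
  rw [iter_add, iter_add]
  rcases h.ends with ⟨-, e1, e2⟩ | ⟨-, e1, e2⟩ <;> rw [e1, e2]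
  exact abs_sub_comm _ _

lemma csum_add (h : B.Pb n a b A C) (j : ℕ) :
    B.csum (n + j) a b = B.csum n a b + B.csum j A C := by
  rw [Bim.csum_add]
  rcases h.ends with ⟨-, e1, e2⟩ | ⟨-, e1, e2⟩ <;> rw [e1, e2]
  rw [csum_comm j]

/-- A pull-back of a smaller interval through a common point is smaller. -/
lemma nest (h : B.Pb n a b A C) {a' b' x : ℝ} (h' : B.Pb n a' b' A' C') (hx : x ∈ Ioo a b)
    (hx' : x ∈ Ioo a' b') (hA : A ≤ A') (hC : C' ≤ C) : a ≤ a' ∧ b' ≤ b := by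
  constructor
  · by_contra hc; push Not at hc
    have := h'.mem_Ioo (x := a) ⟨hc, hx.1.trans hx'.2⟩
    rcases h.left_mem with e | e <;> rw [e] at this <;> linarith [this.1, this.2]
  · by_contra hc; push Not at hc
    have := h'.mem_Ioo (x := b) ⟨hx'.1.trans hx.2, hc⟩
    rcases h.right_mem with e | e <;> rw [e] at this <;> linarith [this.1, this.2]

end Pb

variable (B) in
/-- `(a, b)` is a monotonicity interval of `F^n`. -/
structure Piece (n : ℕ) (a b : ℝ) : Prop where
  lt : a < b
  one_le : 1 ≤ n
  left : B.dn n a = 0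
  right : B.dn n b = 0
  reg : B.Reg n (Ioo a b)

/-- `y` belongs to `(a, b)` modulo `ℤ`. -/
def InMod (a b y : ℝ) : Prop := ∃ k : ℤ, y ∈ Ioo (a + k) (b + k)

lemma InMod.add_int {a b y : ℝ} (h : InMod a b y) (j : ℤ) : InMod a b (y + j) := by
  obtain ⟨k, hk⟩ := h
  exact ⟨k + j, by push_cast; exact ⟨by linarith [hk.1], by linarith [hk.2]⟩⟩

variable (B) in
open Classical in
/-- The total length of the iterates at the visits of `x` to `(a, b)` before time `m`. -/
def vsum (a b : ℝ) (m : ℕ) (x u v : ℝ) : ℝ :=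
  ∑ i ∈ (Finset.range m).filter (fun i => InMod a b (B.F^[i] x)), |B.F^[i] v - B.F^[i] u|

lemma vsum_nonneg (a b : ℝ) (m : ℕ) (x u v : ℝ) : 0 ≤ B.vsum a b m x u v :=
  Finset.sum_nonneg fun _ _ => abs_nonneg _

lemma vsum_add (a b : ℝ) (T m : ℕ) (x : ℝ) {u v A C : ℝ} (h : B.Pb T u v A C) :
    B.vsum a b (T + m) x u v = B.vsum a b T x u v + B.vsum a b m (B.F^[T] x) A C := by
  classical
  unfold vsum
  simp only [Finset.sum_filter]
  rw [Finset.sum_range_add]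
  congr 1
  refine Finset.sum_congr rfl fun i _ => ?_
  rw [add_comm T i, h.abs_iter, iter_add]

namespace Piece

variable {n : ℕ} {a b : ℝ}

lemma length_le (h : B.Piece n a b) : b - a ≤ 1 := by
  have := h.reg.length_le_one h.lt (i := 0) h.one_le
  exact (le_abs_self _).trans this

lemma shift_unique (h : B.Piece n a b) {y : ℝ} {k l : ℤ} (hk : y ∈ Ioo (a + k) (b + k))
    (hl : y ∈ Ioo (a + l) (b + l)) : k = l := by
  have h1 := h.length_le
  have h2 : ((k : ℝ) - l) < 1 := by linarith [hk.1, hl.2]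
  have h3 : ((l : ℝ) - k) < 1 := by linarith [hl.1, hk.2]
  have h2' : k - l < 1 := by exact_mod_cast h2
  have h3' : l - k < 1 := by exact_mod_cast h3
  omega

/-- Monotonicity intervals are nice: pull-backs are nested or disjoint. -/
lemma nice (h : B.Piece n a b) {m : ℕ} {a0 b0 x : ℝ} {k l : ℤ}
    (hp : B.Pb m a0 b0 (a + k) (b + k)) (hx : x ∈ Ioo a0 b0) (hx' : x ∈ Ioo (a + l) (b + l)) :
    a + l ≤ a0 ∧ b0 ≤ b + l := by
  have key : ∀ z, B.dn n z = 0 → z + l ∉ Ioo a0 b0 := by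
    intro z hz hm
    have h1 := hp.mem_Ioo hm
    have h2 : B.dn n (B.F^[m] (z + l)) ≠ 0 := by
      have : B.F^[m] (z + l) = (B.F^[m] (z + l) - k) + k := by ring
      rw [this, dn_translate]
      exact h.reg _ ⟨by linarith [h1.1], by linarith [h1.2]⟩
    have h3 : B.dn (n + m) (z + l) ≠ 0 := by
      rw [dn_add]; exact mul_ne_zero h2 (hp.reg _ hm)
    apply h3
    rw [add_comm n m, dn_add, dn_translate, hz, mul_zero]
  constructor
  · by_contra hc; push Not at hc
    exact key a h.left ⟨hc, hx'.1.trans hx.2⟩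
  · by_contra hc; push Not at hc
    exact key b h.right ⟨hx.1.trans hx'.2, hc⟩

/-- Avoiding a monotonicity interval before returning to it is a property of the branch. -/
lemma first_of_point (h : B.Piece n a b) {t : ℕ} {a1 b1 x : ℝ} {k : ℤ}
    (hp : B.Pb t a1 b1 (a + k) (b + k)) (hx : x ∈ Ioo a1 b1)
    (hfirst : ∀ i, 0 < i → i < t → ¬ InMod a b (B.F^[i] x)) :
    ∀ z ∈ Ioo a1 b1, ∀ i, 0 < i → i < t → ¬ InMod a b (B.F^[i] z) := by
  rintro z hz i hi hit ⟨j, hj⟩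
  obtain ⟨s, rfl⟩ := Nat.exists_eq_add_of_lt hit
  rw [show i + s + 1 = (s + 1) + i by ring] at hp
  obtain ⟨A1, C1, hi1, hi2⟩ := hp.split
  obtain ⟨h3, h4⟩ := h.nice hi2 (hi1.mem_Ioo hz) hj
  have := hi1.mem_Ioo hx
  exact hfirst i hi (by omega) ⟨j, by linarith [this.1], by linarith [this.2]⟩

end Piece

lemma Pb.csum_le_of_first {t : ℕ} {a b a1 b1 : ℝ} {k : ℤ} (h : B.Pb t a1 b1 (a + k) (b + k))
    (first : ∀ z ∈ Ioo a1 b1, ∀ i, 0 < i → i < t → ¬ InMod a b (B.F^[i] z)) :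
    B.csum t a1 b1 ≤ 2 := by
  refine csum_le_two h.reg h.lt fun i j hij hjt c x hx y hy e => ?_
  refine first x hx (t - j + i) (by omega) (by omega) ?_
  have : B.F^[t - j + i] x = B.F^[t] y - c := by
    rw [iter_add, eq_sub_iff_add_eq, ← iter_add_int, e, ← iter_add]
    congr 2; omega
  rw [this, sub_eq_add_neg, ← Int.cast_neg]
  exact InMod.add_int ⟨k, h.mem_Ioo hy⟩ _

variable (B) in
/-- A first return branch to `(a, b)` modulo `ℤ`. -/
structure Letter (a b : ℝ) (t : ℕ) (a1 b1 : ℝ) (l k : ℤ) : Prop where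
  one_le : 1 ≤ t
  pb : B.Pb t a1 b1 (a + k) (b + k)
  left : a + l ≤ a1
  right : b1 ≤ b + l
  first : ∀ z ∈ Ioo a1 b1, ∀ i, 0 < i → i < t → ¬ InMod a b (B.F^[i] z)

namespace Letter

variable {n t : ℕ} {a b a1 b1 : ℝ} {l k : ℤ}

lemma of_point (hP : B.Piece n a b) (ht : 1 ≤ t) (hp : B.Pb t a1 b1 (a + k) (b + k)) {x : ℝ}
    (hx : x ∈ Ioo a1 b1) (hxl : x ∈ Ioo (a + l) (b + l))
    (hfirst : ∀ i, 0 < i → i < t → ¬ InMod a b (B.F^[i] x)) : B.Letter a b t a1 b1 l k := by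
  obtain ⟨h1, h2⟩ := hP.nice hp hx hxl
  exact ⟨ht, hp, h1, h2, hP.first_of_point hp hx hfirst⟩

lemma csum_le (h : B.Letter a b t a1 b1 l k) : B.csum t a1 b1 ≤ 2 := h.pb.csum_le_of_first h.first

lemma overlap (hP : B.Piece n a b) (h : B.Letter a b t a1 b1 l k) {t' : ℕ} {a1' b1' : ℝ} {l' k' : ℤ}
    (h' : B.Letter a b t' a1' b1' l' k') {z : ℝ} {j : ℤ} (hz : z ∈ Ioo a1 b1)
    (hz' : z + j ∈ Ioo a1' b1') : a1' = a1 + j ∧ b1' = b1 + j := by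
  have v1 : InMod a b (B.F^[t] z) := ⟨k, h.pb.mem_Ioo hz⟩
  have v2 : InMod a b (B.F^[t'] (z + j)) := ⟨k', h'.pb.mem_Ioo hz'⟩
  have ht : t = t' := by
    rcases lt_trichotomy t t' with hlt | heq | hlt
    · exfalso
      refine h'.first _ hz' t h.one_le hlt ?_
      rw [iter_add_int]; exact v1.add_int j
    · exact heq
    · exfalso
      refine h.first _ hz t' h'.one_le hlt ?_
      rw [iter_add_int] at v2
      have := v2.add_int (-j)
      push_cast at this
      rwa [add_neg_cancel_right] at this
  subst ht
  have hp := h.pb.translate j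
  have m1 := h'.pb.mem_Ioo hz'
  have hz2 : z + j ∈ Ioo (a1 + j) (b1 + j) := ⟨by linarith [hz.1], by linarith [hz.2]⟩
  have m2 := hp.mem_Ioo hz2
  have e : k' = k + j := hP.shift_unique (y := B.F^[t] (z + j)) m1 (by
    push_cast; exact ⟨by linarith [m2.1], by linarith [m2.2]⟩)
  have eA : a + (k' : ℝ) = a + k + j := by rw [e]; push_cast; ring
  have eC : b + (k' : ℝ) = b + k + j := by rw [e]; push_cast; ring
  have hq := h'.pb
  rw [eA, eC] at hq
  obtain ⟨n1, n2⟩ := hp.nest hq hz2 hz' le_rfl le_rfl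
  obtain ⟨n3, n4⟩ := hq.nest hp hz' hz2 le_rfl le_rfl
  exact ⟨le_antisymm n3 n1, le_antisymm n2 n4⟩

end Letter

variable (B) in
/-- A monotonicity interval together with a class of admissible orbit segments along which it can
be pulled back with controlled distortion. -/
structure Ret (n : ℕ) (a b : ℝ) (O : ℝ → ℕ → Prop) (κ c : ℝ) : Prop where
  piece : B.Piece n a b
  tail : ∀ x m i, O x (m + i) → O (B.F^[i] x) m
  truncate : ∀ x m i, O x m → i ≤ m → InMod a b (B.F^[i] x) → O x i
  ext : ∀ x m (k : ℤ), O x m → B.F^[m] x ∈ Ioo (a + k) (b + k) → ∃ a0 b0, x ∈ Ioo a0 b0 ∧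
    B.Pb m a0 b0 (a + k) (b + k) ∧ B.Dst m a0 b0 (κ + c * B.csum m a0 b0)
  c_nonneg : 0 ≤ c
  small : κ + 4 * c ≤ 1 / 20

lemma exp_small : Real.exp (1 / 20) ≤ 20 / 19 := by
  have h := Real.add_one_le_exp (-(1 / 20 : ℝ))
  rw [Real.exp_neg] at h
  have h1 : 0 < Real.exp (1 / 20) := Real.exp_pos _
  have := (inv_le_inv₀ (by positivity) (by norm_num)).2 h
  rw [inv_inv] at this
  linarith

namespace Ret

variable {n : ℕ} {a b κ c : ℝ} {O : ℝ → ℕ → Prop}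

lemma dst (R : B.Ret n a b O κ c) {x a0 b0 : ℝ} {m : ℕ} {k : ℤ} (hO : O x m)
    (hx : x ∈ Ioo a0 b0) (hp : B.Pb m a0 b0 (a + k) (b + k)) (hs : B.csum m a0 b0 ≤ 4) :
    B.Dst m a0 b0 (1 / 20) := by
  obtain ⟨a1, b1, hx1, hp1, hd⟩ := R.ext x m k hO (hp.mem_Ioo hx)
  obtain ⟨n1, n2⟩ := hp.nest hp1 hx hx1 le_rfl le_rfl
  obtain ⟨n3, n4⟩ := hp1.nest hp hx1 hx le_rfl le_rfl
  obtain rfl := le_antisymm n1 n3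
  obtain rfl := le_antisymm n2 n4
  have := mul_le_mul_of_nonneg_left hs R.c_nonneg
  exact hd.mono le_rfl le_rfl (by linarith [R.small])

variable (B) in
/-- A designated first return branch, or none if `ua = ub`, containing all long branches. -/
structure Big (a b : ℝ) (O : ℝ → ℕ → Prop) (kU : ℕ) (ua ub : ℝ) (j0 : ℤ) : Prop where
  one_le : 1 ≤ kU
  letter : ua < ub → B.Letter a b kU ua ub 0 j0
  small : ∀ y t a1 b1 l k, O y t → B.Letter a b t a1 b1 l k → y ∈ Ioo a1 b1 → ¬ InMod ua ub y →
    b1 - a1 ≤ (b - a) / 2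

lemma exists_big (R : B.Ret n a b O κ c) : ∃ kU ua ub j0, Big B a b O kU ua ub j0 := by
  by_cases h : ∃ y t a1 b1 l k, O y t ∧ B.Letter a b t a1 b1 l k ∧ y ∈ Ioo a1 b1 ∧
      (b - a) / 2 < b1 - a1
  · obtain ⟨y, t, a1, b1, l, k, hO, hL, hy, hbig⟩ := h
    have hU : B.Letter a b t (a1 - l) (b1 - l) 0 (k - l) := by
      refine ⟨hL.one_le, ?_, ?_, ?_, ?_⟩
      · have := hL.pb.translate_sub l
        push_cast
        rwa [add_sub_assoc, add_sub_assoc] at this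
      · push_cast; linarith [hL.left]
      · push_cast; linarith [hL.right]
      · intro z hz i hi hit hV
        refine hL.first (z + l) ⟨by linarith [hz.1], by linarith [hz.2]⟩ i hi hit ?_
        rw [iter_add_int]; exact hV.add_int l
    refine ⟨t, a1 - l, b1 - l, k - l, hL.one_le, fun _ => hU, ?_⟩
    intro y' t' a1' b1' l' k' hO' hL' hy' hnot
    by_contra hc
    push Not at hc
    apply hnot
    -- both long branches lie in the same interval, so they meet
    have e1 := hU.left
    have e2 := hU.right
    have e3 := hL'.left
    have e4 := hL'.right
    push_cast at e1 e2
    have hz : ∃ z ∈ Ioo (a1 - l) (b1 - (l : ℝ)), z + l' ∈ Ioo a1' b1' := by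
      have hlt : max (a1 - l) (a1' - l') < min (b1 - (l : ℝ)) (b1' - l') := by
        rw [max_lt_iff, lt_min_iff, lt_min_iff]
        refine ⟨⟨?_, ?_⟩, ?_, ?_⟩ <;> linarith [hL.pb.lt, hL'.pb.lt]
      obtain ⟨z, hz1, hz2⟩ := exists_between hlt
      rw [max_lt_iff] at hz1
      rw [lt_min_iff] at hz2
      exact ⟨z, ⟨hz1.1, hz2.1⟩, by linarith [hz1.2], by linarith [hz2.2]⟩
    obtain ⟨z, hz1, hz2⟩ := hz
    obtain ⟨f1, f2⟩ := hU.overlap R.piece hL' hz1 hz2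
    exact ⟨l', by rw [← f1, ← f2]; exact hy'⟩
  · push Not at h
    refine ⟨1, 0, 0, 0, le_rfl, fun h => absurd h (lt_irrefl _), ?_⟩
    intro y t a1 b1 l k hO hL hy _
    exact h y t a1 b1 l k hO hL hy

end Ret

end Bim

namespace Bim

variable {B : Bim}

lemma vsum_le_csum (a b : ℝ) (m : ℕ) (x u v : ℝ) : B.vsum a b m x u v ≤ B.csum m u v := by
  classical
  exact Finset.sum_le_sum_of_subset_of_nonneg (Finset.filter_subset _ _) fun _ _ _ => abs_nonneg _

lemma InMod.of_add_int {a b y : ℝ} {j : ℤ} (h : InMod a b (y + j)) : InMod a b y := by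
  have := h.add_int (-j)
  push_cast at this
  rwa [add_neg_cancel_right] at this

namespace Letter

variable {n t : ℕ} {a b a1 b1 : ℝ} {l k : ℤ}

lemma first_mod (h : B.Letter a b t a1 b1 l k) {x : ℝ} {s : ℤ} (hx : x ∈ Ioo (a1 + s) (b1 + s))
    {i : ℕ} (hi : 0 < i) (hit : i < t) : ¬ InMod a b (B.F^[i] x) := by
  intro hV
  refine h.first (x - s) ⟨by linarith [hx.1], by linarith [hx.2]⟩ i hi hit ?_
  have := hV.add_int (-s)
  rwa [B.iter_sub_int, sub_eq_add_neg, ← Int.cast_neg]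

lemma vsum_le (h : B.Letter a b t a1 b1 l k) {x u v : ℝ} {s : ℤ} (hx : x ∈ Ioo (a1 + s) (b1 + s))
    (huv : u ≤ v) : B.vsum a b t x u v ≤ v - u := by
  classical
  have : (Finset.range t).filter (fun i => InMod a b (B.F^[i] x)) ⊆ {0} := by
    intro i hi
    rw [Finset.mem_filter, Finset.mem_range] at hi
    by_contra h0
    exact h.first_mod hx (Nat.pos_of_ne_zero (by simpa using h0)) hi.1 hi.2
  refine (Finset.sum_le_sum_of_subset_of_nonneg this fun _ _ _ => abs_nonneg _).trans ?_
  rw [Finset.sum_singleton]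
  simp [abs_of_nonneg (sub_nonneg.2 huv)]

end Letter

namespace Ret

variable {n : ℕ} {a b κ c : ℝ} {O : ℝ → ℕ → Prop}

lemma exists_fixed {kU : ℕ} {ua ub : ℝ} {j0 : ℤ} (hL : B.Letter a b kU ua ub 0 j0) :
    ∃ z ∈ Icc ua ub, B.F^[kU] z = z + j0 := by
  have hl := hL.left
  have hr := hL.right
  push_cast at hl hr
  have lt := hL.pb.lt'
  have h1 : a + (j0 : ℝ) ∈ B.F^[kU] '' Icc ua ub := by
    rw [hL.pb.image_Icc]; exact left_mem_Icc.2 lt.le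
  have h2 : b + (j0 : ℝ) ∈ B.F^[kU] '' Icc ua ub := by
    rw [hL.pb.image_Icc]; exact right_mem_Icc.2 lt.le
  obtain ⟨u, hu, eu⟩ := h1
  obtain ⟨v, hv, ev⟩ := h2
  have hc : ContinuousOn (fun x => B.F^[kU] x - x) (Icc ua ub) :=
    ((B.continuous_iter kU).sub continuous_id).continuousOn
  obtain ⟨z, hz, e⟩ := isPreconnected_Icc.intermediate_value hu hv hc
    (show (j0 : ℝ) ∈ Icc _ _ from ⟨by rw [eu]; linarith [hu.1], by rw [ev]; linarith [hv.2]⟩)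
  exact ⟨z, hz, by simp only at e; linarith⟩

lemma pure_run (hP : B.Piece n a b) {kU : ℕ} {ua ub : ℝ} {j0 : ℤ}
    (hL : B.Letter a b kU ua ub 0 j0) : ∃ C, ∀ i x (k : ℤ) a0 b0,
    (∀ c < i, InMod ua ub (B.F^[c * kU] x)) → x ∈ Ioo a0 b0 →
    B.Pb (i * kU) a0 b0 (a + k) (b + k) → B.vsum a b (i * kU + 1) x a0 b0 ≤ C := by
  obtain ⟨z, hz, ez⟩ := exists_fixed hL
  have hl := hL.left
  have hr := hL.right
  push_cast at hl hr
  have hrep := B.rep z kU hL.one_le ⟨j0, ez⟩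
  change 1 < |B.dn kU z| at hrep
  obtain ⟨lam, h1lam, hlam⟩ := exists_between hrep
  obtain ⟨δ, hδ, hball⟩ := Metric.eventually_nhds_iff.1
    ((B.continuous_dn kU).abs.continuousAt.eventually (lt_mem_nhds hlam))
  obtain ⟨_, _, N, hN⟩ := B.exists_uniform (half_pos hδ)
  have hlam0 : 0 < 1 / (lam - 1) := by
    have : 0 < lam - 1 := by linarith
    positivity
  suffices H : ∀ i x (k : ℤ) a0 b0,
      (∀ c < i, InMod ua ub (B.F^[c * kU] x)) → x ∈ Ioo a0 b0 →
      B.Pb (i * kU) a0 b0 (a + k) (b + k) →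
      (∀ s : ℤ, x ∈ Ioo (a + s) (b + s) → z + s ∈ Icc a0 b0) ∧ b0 - a0 ≤ 1 ∧
      B.vsum a b (i * kU + 1) x a0 b0 ≤ i + 1 ∧
      B.vsum a b (i * kU + 1) x a0 b0 ≤ N + 1 + 1 / (lam - 1) * (1 - (b0 - a0)) by
    refine ⟨N + 1 + 1 / (lam - 1), fun i x k a0 b0 h1 h2 h3 => ?_⟩
    obtain ⟨-, -, -, h⟩ := H i x k a0 b0 h1 h2 h3
    have := mul_le_mul_of_nonneg_left (show 1 - (b0 - a0) ≤ 1 by linarith [h3.lt]) hlam0.le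
    linarith
  intro i
  induction i with
  | zero =>
    intro x k a0 b0 _ hx hp
    rw [Nat.zero_mul] at hp ⊢
    have e : a0 = a + k ∧ b0 = b + k := by
      rcases hp.ends with ⟨-, e1, e2⟩ | ⟨-, e1, e2⟩
      · exact ⟨e1, e2⟩
      · exfalso; simp only [Function.iterate_zero, id] at e1 e2; linarith [hp.lt, hp.lt']
    obtain ⟨rfl, rfl⟩ := e
    have hlen := hP.length_le
    have hv : B.vsum a b (0 + 1) x (a + k) (b + k) ≤ 1 := by
      refine (vsum_le_csum _ _ _ _ _ _).trans ?_
      rw [csum_succ]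
      simp only [csum, Finset.range_zero, Finset.sum_empty, Function.iterate_zero, id, zero_add]
      rw [abs_of_pos (by linarith [hp.lt])]; linarith
    refine ⟨fun s hs => ?_, by linarith, by simpa using hv, ?_⟩
    · rw [hP.shift_unique hs hx]
      exact ⟨by linarith [hz.1], by linarith [hz.2]⟩
    · have := mul_nonneg hlam0.le (show 0 ≤ 1 - (b + (k : ℝ) - (a + k)) by linarith)
      have := Nat.cast_nonneg (α := ℝ) N
      linarith
  | succ i ih =>
    intro x k a0 b0 hc hx hp
    have em : (i + 1) * kU = i * kU + kU := by ring
    rw [em] at hp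
    obtain ⟨A1, C1, hp1, hp2⟩ := hp.split
    have hx1 := hp1.mem_Ioo hx
    obtain ⟨s, hs⟩ := hc 0 (Nat.succ_pos i)
    simp only [Nat.zero_mul, Function.iterate_zero, id] at hs
    have hUs := hL.pb.translate s
    have hxV : x ∈ Ioo (a + s) (b + s) := ⟨by linarith [hs.1], by linarith [hs.2]⟩
    have hx1V : B.F^[kU] x ∈ Ioo (a + ((j0 + s : ℤ) : ℝ)) (b + ((j0 + s : ℤ) : ℝ)) := by
      have := hUs.mem_Ioo hs
      push_cast
      exact ⟨by linarith [this.1], by linarith [this.2]⟩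
    obtain ⟨n1, n2⟩ := hP.nice hp2 hx1 hx1V
    push_cast at n1 n2
    obtain ⟨u1, u2⟩ := hUs.nest hp1 hs hx (by linarith) (by linarith)
    obtain ⟨i1, i2, i3, i4⟩ := ih (B.F^[kU] x) k A1 C1 (fun c hci => by
      have := hc (c + 1) (by omega)
      rwa [show (c + 1) * kU = c * kU + kU by ring, iter_add] at this) hx1 hp2
    have i1' := i1 _ hx1V
    push_cast at i1'
    have hzs : z + s ∈ Icc a0 b0 := by
      have : z + (j0 + s) ∈ B.F^[kU] '' Icc a0 b0 := by rw [hp1.image_Icc]; exact i1'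
      obtain ⟨e, he, ee⟩ := this
      have : e = z + s := hUs.injOn ⟨u1.trans he.1, he.2.trans u2⟩
        ⟨by linarith [hz.1], by linarith [hz.2]⟩ (by rw [ee, iter_add_int, ez]; ring)
      rwa [← this]
    have hlen : b0 - a0 ≤ 1 := by linarith [hP.length_le]
    have hv : B.vsum a b ((i + 1) * kU + 1) x a0 b0 ≤
        (b0 - a0) + B.vsum a b (i * kU + 1) (B.F^[kU] x) A1 C1 := by
      rw [show (i + 1) * kU + 1 = kU + (i * kU + 1) by ring, vsum_add a b kU _ x hp1]
      linarith [hL.vsum_le hs hp.lt.le]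
    have hv3 : B.vsum a b ((i + 1) * kU + 1) x a0 b0 ≤ ((i + 1 : ℕ) : ℝ) + 1 := by
      push_cast; linarith
    refine ⟨fun s' hs' => by rwa [hP.shift_unique hs' hxV], hlen, hv3, ?_⟩
    rcases le_or_gt (i + 1) N with hiN | hiN
    · have h1 := mul_nonneg hlam0.le (show 0 ≤ 1 - (b0 - a0) by linarith)
      have h2 : ((i + 1 : ℕ) : ℝ) ≤ N := by exact_mod_cast hiN
      linarith
    · have hsm := hN _ a0 b0 hp.lt hp.reg (Or.inl (by nlinarith [hL.one_le]))
      obtain ⟨ξ, hξ, e⟩ := B.exists_mvt kU hp1.lt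
      rw [hp1.length] at e
      have hd : lam < |B.dn kU ξ| := by
        have : ξ = (ξ - s) + s := by ring
        rw [this, dn_translate]
        apply hball
        rw [Real.dist_eq, abs_lt]
        constructor <;> linarith [hξ.1, hξ.2, hzs.1, hzs.2]
      have hd2 : lam * (b0 - a0) ≤ C1 - A1 := by
        rw [e]; exact mul_le_mul_of_nonneg_right hd.le (by linarith [hp.lt])
      have hfin : b0 - a0 ≤ 1 / (lam - 1) * ((C1 - A1) - (b0 - a0)) := by
        rw [one_div, inv_mul_eq_div, le_div_iff₀ (by linarith)]; linarith
      have : 1 / (lam - 1) * (1 - (b0 - a0)) = 1 / (lam - 1) * (1 - (C1 - A1)) +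
        1 / (lam - 1) * ((C1 - A1) - (b0 - a0)) := by ring
      linarith

/-- An orbit segment following the designated branch `i` times and then leaving it. -/
lemma block (R : B.Ret n a b O κ c) {kU : ℕ} {ua ub : ℝ} {j0 : ℤ} (hB : Big B a b O kU ua ub j0)
    {x e0 e1 : ℝ} {i t : ℕ} {l k : ℤ} (hi : ∀ c < i, InMod ua ub (B.F^[c * kU] x))
    (hxl : x ∈ Ioo (a + l) (b + l)) (hy : ¬ InMod ua ub (B.F^[i * kU] x)) (ht : 1 ≤ t)
    (hfirst : ∀ r, 0 < r → r < t → ¬ InMod a b (B.F^[r] (B.F^[i * kU] x)))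
    (hO : O x (t + i * kU)) (hp : B.Pb (t + i * kU) e0 e1 (a + k) (b + k)) (hx : x ∈ Ioo e0 e1) :
    B.csum (t + i * kU) e0 e1 ≤ 4 ∧ e1 - e0 ≤ 20 / 39 * (b - a) := by
  have hP := R.piece
  have hlet : ∀ c < i, B.Letter a b kU ua ub 0 j0 := by
    intro c hc
    obtain ⟨s, hs⟩ := hi c hc
    exact hB.letter (by linarith [hs.1, hs.2])
  have visit : ∀ c ≤ i, InMod a b (B.F^[c * kU] x) := by
    intro c hc
    rcases Nat.eq_zero_or_pos c with rfl | h0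
    · simpa using ⟨l, hxl⟩
    · obtain ⟨d, rfl⟩ : ∃ d, c = d + 1 := ⟨c - 1, by omega⟩
      obtain ⟨s, hs⟩ := hi d hc
      have := ((hlet d hc).pb.translate s).mem_Ioo hs
      rw [← iter_add, show kU + d * kU = (d + 1) * kU by ring] at this
      exact ⟨j0 + s, by push_cast; exact ⟨by linarith [this.1], by linarith [this.2]⟩⟩
  -- intermediate images of the interval stay in the designated branch
  have P1 : ∀ c < i, ∃ s : ℤ, ∀ e ∈ Ioo e0 e1, B.F^[c * kU] e ∈ Ioo (ua + s) (ub + s) := by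
    intro c hc
    obtain ⟨s, hs⟩ := hi c hc
    have e : t + i * kU = (t + (i - (c + 1)) * kU + kU) + c * kU := by
      obtain ⟨d, rfl⟩ := Nat.exists_eq_add_of_lt hc
      rw [show c + d + 1 - (c + 1) = d by omega]; ring
    rw [e] at hp
    obtain ⟨A1, C1, q1, q2⟩ := hp.split
    obtain ⟨A2, C2, q3, q4⟩ := q2.split
    have x1 := q1.mem_Ioo hx
    have x2 := q3.mem_Ioo x1
    obtain ⟨s2, hs2⟩ := visit (c + 1) hc
    rw [show (c + 1) * kU = kU + c * kU by ring, iter_add] at hs2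
    obtain ⟨n1, n2⟩ := hP.nice q4 x2 hs2
    have hUs := (hlet c hc).pb.translate s
    have x3 := hUs.mem_Ioo hs
    have : s2 = j0 + s := hP.shift_unique hs2
      (by push_cast; exact ⟨by linarith [x3.1], by linarith [x3.2]⟩)
    rw [this] at n1 n2
    push_cast at n1 n2
    obtain ⟨m1, m2⟩ := hUs.nest q3 hs x1 (by linarith) (by linarith)
    refine ⟨s, fun e he => ?_⟩
    have := q1.mem_Ioo he
    exact ⟨by linarith [this.1], by linarith [this.2]⟩
  obtain ⟨g1, g2, hpi, hpt⟩ := hp.split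
  have hyg := hpi.mem_Ioo hx
  obtain ⟨s, hs⟩ := visit i le_rfl
  have hG := Letter.of_point hP ht hpt hyg hs hfirst
  have P2 : ∀ e ∈ Ioo e0 e1, ¬ InMod ua ub (B.F^[i * kU] e) := by
    rintro e he ⟨s', hs'⟩
    have hU := hB.letter (by linarith [hs'.1, hs'.2])
    have he' := hpi.mem_Ioo he
    obtain ⟨f1, f2⟩ := hU.overlap hP hG (z := B.F^[i * kU] e - s') (j := s')
      ⟨by linarith [hs'.1], by linarith [hs'.2]⟩ (by rwa [sub_add_cancel])
    exact hy ⟨s', by rwa [← f1, ← f2]⟩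
  have P3 : ∀ e ∈ Ioo e0 e1, ∀ r < i * kU, InMod a b (B.F^[r] e) → InMod ua ub (B.F^[r] e) := by
    intro e he r hr hV
    have hk := hB.one_le
    have hc : r / kU < i := Nat.div_lt_of_lt_mul (by rwa [mul_comm])
    obtain ⟨s', hs'⟩ := P1 _ hc
    have h1 := hs' e he
    have h2 : r = r % kU + r / kU * kU := by rw [mul_comm]; exact (Nat.mod_add_div r kU).symm
    rcases Nat.eq_zero_or_pos (r % kU) with h0 | h0
    · rw [h0, zero_add] at h2
      rw [h2]; exact ⟨s', h1⟩
    · exfalso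
      rw [h2, iter_add] at hV
      exact (hlet _ hc).first_mod h1 h0 (Nat.mod_lt _ hk) hV
  have P4 : ∀ r r', r < r' → r' ≤ i * kU → ∀ j : ℤ, ∀ e ∈ Ioo e0 e1, ∀ e' ∈ Ioo e0 e1,
      B.F^[r] e + j ≠ B.F^[r'] e' := by
    intro r r' hrr hr' j e he e' he' heq
    have h1 : B.F^[i * kU - r' + r] e + j = B.F^[i * kU] e' := by
      rw [iter_add, ← iter_add_int, heq, ← iter_add]
      congr 2; omega
    have h2 : InMod a b (B.F^[i * kU] e') := by
      have := hpi.mem_Ioo he'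
      have l1 := hG.left
      have l2 := hG.right
      exact ⟨s, by linarith [this.1], by linarith [this.2]⟩
    rw [← h1] at h2
    refine P2 e' he' ?_
    rw [← h1]
    exact (P3 e he _ (by omega) h2.of_add_int).add_int j
  have hsum : B.csum (t + i * kU) e0 e1 ≤ 4 := by
    rw [add_comm, hpi.csum_add]
    have := csum_le_two hpi.reg hpi.lt fun r r' h1 h2 => P4 r r' h1 h2.le
    linarith [hG.csum_le]
  refine ⟨hsum, ?_⟩
  rcases Nat.eq_zero_or_pos i with rfl | h0
  · have hlen : e1 - e0 = g2 - g1 := by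
      rw [← hpi.length]; simp [abs_of_pos (sub_pos.2 hp.lt)]
    rw [zero_mul, add_zero] at hO
    have := hB.small x t g1 g2 s k hO hG (by simpa using hyg) (by simpa using hy)
    linarith [hP.lt]
  · -- the interval and its image under the designated branch are disjoint
    obtain ⟨i, rfl⟩ : ∃ d, i = d + 1 := ⟨i - 1, by omega⟩
    have hU := hlet 0 h0
    obtain ⟨s0, hs0⟩ := P1 0 h0
    simp only [zero_mul, Function.iterate_zero, id] at hs0
    rw [show t + (i + 1) * kU = (t + i * kU) + kU by ring] at hp
    obtain ⟨f0, f1, q1, q2⟩ := hp.split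
    obtain ⟨s1, hs1⟩ := visit 1 (by omega)
    rw [one_mul] at hs1
    obtain ⟨n1, n2⟩ := hP.nice q2 (q1.mem_Ioo hx) hs1
    obtain ⟨n3, n4⟩ := hP.nice hp hx hxl
    have hdisj : e1 - l ≤ f0 - s1 ∨ f1 - s1 ≤ e0 - l := by
      by_contra hc
      push Not at hc
      have hlt : max (e0 - l) (f0 - s1) < min (e1 - l) (f1 - (s1 : ℝ)) := by
        rw [max_lt_iff, lt_min_iff, lt_min_iff]
        refine ⟨⟨?_, ?_⟩, ?_, ?_⟩ <;> linarith [hp.lt, q1.lt']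
      obtain ⟨z, hz1, hz2⟩ := exists_between hlt
      rw [max_lt_iff] at hz1
      rw [lt_min_iff] at hz2
      obtain ⟨e', he', ee⟩ := q1.exists_preimage (y := z + s1)
        ⟨by linarith [hz1.2], by linarith [hz2.2]⟩
      refine P4 0 kU hB.one_le (by nlinarith) (s1 - l) (z + l)
        ⟨by linarith [hz1.1], by linarith [hz2.1]⟩ e' he' ?_
      rw [ee]; push_cast; simp
    have hOU : O x kU := R.truncate x _ kU hO (by nlinarith) ⟨s1, hs1⟩
    have hxU := hs0 x hx
    have hUs := hU.pb.translate s0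
    rw [add_assoc, add_assoc, ← Int.cast_add] at hUs
    have hD : B.Dst kU (ua + s0) (ub + s0) (1 / 20) := by
      refine R.dst hOU hxU hUs ?_
      have hU2 : B.Letter a b kU (ua + s0) (ub + s0) s0 (j0 + s0) :=
        Letter.of_point hP hB.one_le hUs hxU
          ⟨by have := hU.left; push_cast at this; linarith [hxU.1],
           by have := hU.right; push_cast at this; linarith [hxU.2]⟩
          fun r h1 h2 => hU.first_mod hxU h1 h2
      linarith [hU2.csum_le]
    have u1 : ua + s0 ≤ e0 := by
      by_contra hc
      push Not at hc
      obtain ⟨w, w1, w2⟩ := exists_between (lt_min hc hp.lt)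
      rw [lt_min_iff] at w2
      linarith [(hs0 w ⟨w1, w2.2⟩).1]
    have u2 : e1 ≤ ub + s0 := by
      by_contra hc
      push Not at hc
      obtain ⟨w, w1, w2⟩ := exists_between (max_lt hc hp.lt)
      rw [max_lt_iff] at w1
      linarith [(hs0 w ⟨w1.2, w2⟩).2]
    have hrat := hD.ratio u1 hp.lt u2 le_rfl hUs.lt le_rfl
    rw [q1.length, hUs.length] at hrat
    have v1 := hU.left
    have v2 := hU.right
    push_cast at v1 v2
    have hV := hP.lt
    have h4 : (e1 - e0) * (b - a) ≤ 20 / 19 * (f1 - f0) * (b - a) := by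
      calc (e1 - e0) * (b - a) = (e1 - e0) * (b + ((j0 + s0 : ℤ) : ℝ) - (a + ((j0 + s0 : ℤ) : ℝ))) := by
            ring
        _ ≤ _ := hrat
        _ ≤ 20 / 19 * (f1 - f0) * (b - a) := by
            have := q1.lt'
            have := hUs.lt
            refine mul_le_mul (mul_le_mul_of_nonneg_right exp_small (by linarith)) (by linarith)
              (by linarith) (by linarith)
    have h5 := le_of_mul_le_mul_right h4 (by linarith)
    rcases hdisj with h | h <;> linarith

/-- The visits of a pulled back monotonicity interval have bounded total length. -/
theorem exists_bound (R : B.Ret n a b O κ c) : ∃ A, ∀ x m (k : ℤ) a0 b0, O x m →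
    B.Pb m a0 b0 (a + k) (b + k) → x ∈ Ioo a0 b0 → B.vsum a b (m + 1) x a0 b0 ≤ A := by
  have hP := R.piece
  have hV := hP.lt
  obtain ⟨kU, ua, ub, j0, hB⟩ := R.exists_big
  obtain ⟨C, hC⟩ : ∃ C, ∀ i x (k : ℤ) a0 b0,
    (∀ c < i, InMod ua ub (B.F^[c * kU] x)) → x ∈ Ioo a0 b0 →
    B.Pb (i * kU) a0 b0 (a + k) (b + k) → B.vsum a b (i * kU + 1) x a0 b0 ≤ C := by
    by_cases hU : ua < ub
    · exact pure_run hP (hB.letter hU)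
    · refine ⟨1, fun i x k a0 b0 h1 h2 h3 => ?_⟩
      rcases Nat.eq_zero_or_pos i with rfl | h0
      · refine (vsum_le_csum _ _ _ _ _ _).trans ?_
        rw [zero_mul] at h3 ⊢
        rw [csum_succ, h3.length]
        simp only [csum, Finset.range_zero, Finset.sum_empty]
        linarith [hP.length_le]
      · obtain ⟨s, hs⟩ := h1 0 h0
        exact absurd (by linarith [hs.1, hs.2]) hU
  set D := 10 / (b - a) with hDdef
  have hD0 : 0 < D := by have : 0 < b - a := by linarith
                         positivity
  have main : ∀ m x (k l : ℤ) a0 b0, O x m → B.Pb m a0 b0 (a + k) (b + k) → x ∈ Ioo a0 b0 →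
      x ∈ Ioo (a + l) (b + l) →
      B.vsum a b (m + 1) x a0 b0 ≤ C + D * ((b - a) - (b0 - a0)) := by
    intro m
    induction m using Nat.strong_induction_on with
    | _ m ih =>
    intro x k l a0 b0 hO hp hx hxl
    obtain ⟨n1, n2⟩ := hP.nice hp hx hxl
    classical
    have hex : ∃ i, ¬ InMod ua ub (B.F^[i * kU] x) ∨ m ≤ i * kU :=
      ⟨m, Or.inr (by nlinarith [hB.one_le])⟩
    set i := Nat.find hex with hidef
    have hi1 := Nat.find_spec hex
    have hi2 : ∀ c < i, InMod ua ub (B.F^[c * kU] x) ∧ c * kU < m := by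
      intro c hc
      have := Nat.find_min hex hc
      push Not at this
      exact this
    have him : i * kU ≤ m := by
      rcases Nat.eq_zero_or_pos i with h0 | h0
      · rw [h0, zero_mul]; exact Nat.zero_le _
      · obtain ⟨h1, h2⟩ := hi2 (i - 1) (by omega)
        by_contra hc
        push Not at hc
        obtain ⟨s, hs⟩ := h1
        have hU := hB.letter (by linarith [hs.1, hs.2])
        refine hU.first_mod hs (i := m - (i - 1) * kU) (by omega) ?_ ?_
        · have : i * kU = (i - 1) * kU + kU := by
            conv_lhs => rw [show i = (i - 1) + 1 by omega]
            ring
          omega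
        · rw [← iter_add, Nat.sub_add_cancel h2.le]
          exact ⟨k, hp.mem_Ioo hx⟩
    rcases eq_or_lt_of_le him with heq | hlt
    · rw [← heq] at hp ⊢
      have := hC i x k a0 b0 (fun c hc => (hi2 c hc).1) hx hp
      have := mul_nonneg hD0.le (show 0 ≤ (b - a) - (b0 - a0) by linarith)
      linarith
    · have hy : ¬ InMod ua ub (B.F^[i * kU] x) := hi1.resolve_right (by rw [← hidef]; omega)
      have hex2 : ∃ t, 0 < t ∧ InMod a b (B.F^[t] (B.F^[i * kU] x)) := by
        refine ⟨m - i * kU, by omega, ?_⟩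
        rw [← iter_add, Nat.sub_add_cancel him]
        exact ⟨k, hp.mem_Ioo hx⟩
      set t := Nat.find hex2 with htdef
      obtain ⟨ht0, htV⟩ := Nat.find_spec hex2
      rw [← htdef] at ht0 htV
      have htm : t + i * kU ≤ m := by
        have : t ≤ m - i * kU := Nat.find_min' hex2 ⟨by omega, by
          rw [← iter_add, Nat.sub_add_cancel him]
          exact ⟨k, hp.mem_Ioo hx⟩⟩
        omega
      have hfirst : ∀ r, 0 < r → r < t → ¬ InMod a b (B.F^[r] (B.F^[i * kU] x)) :=
        fun r h1 h2 h3 => Nat.find_min hex2 h2 ⟨h1, h3⟩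
      rw [← iter_add] at htV
      set T := t + i * kU with hT
      have hOT : O x T := R.truncate x m T hO htm htV
      obtain ⟨k', hk'⟩ := htV
      obtain ⟨e0, e1, hxe, hpe, -⟩ := R.ext x T k' hOT hk'
      obtain ⟨hs4, hlen⟩ := R.block hB (fun c hc => (hi2 c hc).1) hxl hy ht0 hfirst hOT hpe hxe
      rw [← hT] at hs4
      clear_value T t i
      obtain ⟨m', rfl⟩ := Nat.exists_eq_add_of_le' htm
      obtain ⟨A1, C1, q1, q2⟩ := hp.split
      have hx1 := q1.mem_Ioo hx
      obtain ⟨w1, w2⟩ := hP.nice q2 hx1 hk'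
      obtain ⟨z1, z2⟩ := hpe.nest q1 hxe hx w1 w2
      have hih := ih m' (by omega) (B.F^[T] x) k k' A1 C1 (R.tail x m' T hO) q2 hx1 hk'
      have hrat : ∀ r < T, |B.F^[r] b0 - B.F^[r] a0| * (b - a) ≤
          20 / 19 * (C1 - A1) * |B.F^[r] e1 - B.F^[r] e0| := by
        intro r hr
        obtain ⟨d, hd⟩ := Nat.exists_eq_add_of_le' hr.le
        have hpe' := hpe
        have q1' := q1
        rw [hd] at hpe' q1'
        obtain ⟨E0, E1, v1, v2⟩ := hpe'.split
        obtain ⟨F0, F1, v3, v4⟩ := q1'.split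
        have hdst : B.Dst d E0 E1 (1 / 20) := by
          refine R.dst (x := B.F^[r] x) (R.tail x d r (by rwa [← hd])) (v1.mem_Ioo hxe) v2 ?_
          have := v1.csum_add d
          rw [add_comm r d, ← hd] at this
          linarith [B.csum_nonneg r e0 e1]
        obtain ⟨y1, y2⟩ := v2.nest v4 (v1.mem_Ioo hxe) (v3.mem_Ioo hx) w1 w2
        have := hdst.ratio y1 v4.lt y2 le_rfl v2.lt le_rfl
        rw [v2.length, v4.length] at this
        rw [v1.length, v3.length]
        have h1 := exp_small
        have h2 := v4.lt'
        have h3 := v2.lt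
        calc _ = (F1 - F0) * (b + (k' : ℝ) - (a + k')) := by ring
          _ ≤ _ := this
          _ ≤ _ := by gcongr
      have hbl : B.vsum a b T x a0 b0 * (b - a) ≤ 20 / 19 * (C1 - A1) * 4 := by
        calc B.vsum a b T x a0 b0 * (b - a) ≤ B.csum T a0 b0 * (b - a) :=
              mul_le_mul_of_nonneg_right (vsum_le_csum _ _ _ _ _ _) (by linarith)
          _ ≤ 20 / 19 * (C1 - A1) * B.csum T e0 e1 := by
              unfold csum
              rw [Finset.sum_mul, Finset.mul_sum]
              exact Finset.sum_le_sum fun r hr => hrat r (Finset.mem_range.1 hr)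
          _ ≤ _ := by
              have := q1.lt'
              exact mul_le_mul_of_nonneg_left hs4 (by linarith)
      have h0 := hrat 0 (by omega)
      simp only [Function.iterate_zero, id] at h0
      rw [abs_of_pos (by linarith [hp.lt]), abs_of_pos (by linarith [hpe.lt])] at h0
      have h1 : b0 - a0 ≤ 14 / 25 * (C1 - A1) := by
        have h2 : 20 / 19 * (C1 - A1) * (e1 - e0) ≤ 20 / 19 * (C1 - A1) * (20 / 39 * (b - a)) :=
          mul_le_mul_of_nonneg_left hlen (by linarith [q1.lt'])
        have h3 : (b0 - a0) * (b - a) ≤ (20 / 19 * (C1 - A1) * (20 / 39)) * (b - a) := by linarith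
        have := le_of_mul_le_mul_right h3 (by linarith)
        linarith [q1.lt']
      have h2 : B.vsum a b T x a0 b0 ≤ D * ((C1 - A1) - (b0 - a0)) := by
        rw [hDdef, div_mul_eq_mul_div, le_div_iff₀ (by linarith)]
        linarith [q1.lt']
      rw [show m' + T + 1 = T + (m' + 1) by ring, vsum_add a b T _ x q1]
      have : D * ((b - a) - (b0 - a0)) = D * ((C1 - A1) - (b0 - a0)) +
        D * ((b - a) - (C1 - A1)) := by ring
      linarith
  refine ⟨C + D * (b - a), fun x m k a0 b0 hO hp hx => ?_⟩
  -- pass to the first visit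
  classical
  have hex : ∃ r, InMod a b (B.F^[r] x) := ⟨m, k, hp.mem_Ioo hx⟩
  set r := Nat.find hex with hr
  obtain ⟨l, hl⟩ := Nat.find_spec hex
  rw [← hr] at hl
  obtain ⟨d, rfl⟩ := Nat.exists_eq_add_of_le' (Nat.find_min' hex ⟨k, hp.mem_Ioo hx⟩)
  rw [← hr] at hO hp ⊢
  obtain ⟨A1, C1, q1, q2⟩ := hp.split
  have h1 := main d (B.F^[r] x) k l A1 C1 (R.tail x d r hO) q2 (q1.mem_Ioo hx) hl
  rw [show d + r + 1 = r + (d + 1) by ring, vsum_add a b r _ x q1]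
  have h2 : B.vsum a b r x a0 b0 = 0 := by
    unfold vsum
    rw [Finset.filter_eq_empty_iff.2, Finset.sum_empty]
    intro j hj
    exact Nat.find_min hex (Finset.mem_range.1 hj)
  have := mul_nonneg hD0.le (sub_nonneg.2 q1.lt'.le)
  have : D * ((b - a) - (C1 - A1)) = D * (b - a) - D * (C1 - A1) := by ring
  linarith

end Ret

end Bim

namespace Bim

variable {B : Bim}

lemma Reg.abs_iter_le {n i : ℕ} {a b u v : ℝ} (h : B.Reg n (Ioo a b)) (hab : a < b) (hi : i ≤ n)
    (hu : u ∈ Icc a b) (hv : v ∈ Icc a b) :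
    |B.F^[i] v - B.F^[i] u| ≤ |B.F^[i] b - B.F^[i] a| := by
  obtain ⟨A, C, hp⟩ := (h.of_le hi).exists_pb hab
  rw [hp.length, abs_le]
  have h1 := hp.mem_Icc hu
  have h2 := hp.mem_Icc hv
  constructor <;> linarith [h1.1, h1.2, h2.1, h2.2]

lemma Reg.csum_le {m : ℕ} {a b u v : ℝ} (h : B.Reg m (Ioo a b)) (hab : a < b)
    (hu : u ∈ Icc a b) (hv : v ∈ Icc a b) : B.csum m u v ≤ B.csum m a b :=
  Finset.sum_le_sum fun _ hi => h.abs_iter_le hab (Finset.mem_range.1 hi).le hu hv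

lemma Pb.pullback_point {n : ℕ} {a b A C A' C' x : ℝ} (h : B.Pb n a b A C) (hx : x ∈ Ioo a b)
    (hx' : B.F^[n] x ∈ Ioo A' C') (hA : A ≤ A') (hC : C' ≤ C) :
    ∃ a' b', a ≤ a' ∧ b' ≤ b ∧ x ∈ Ioo a' b' ∧ B.Pb n a' b' A' C' := by
  obtain ⟨a', b', h1, h2, h3⟩ := h.pullback hA (hx'.1.trans hx'.2) hC
  exact ⟨a', b', h1, h2, h.mem_of_image h1 h2 h3 (Ioo_subset_Icc_self hx) hx', h3⟩

/-- Distortion of an interval whose image has space `r` on both sides inside a pull-back. -/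
lemma dst_of_space {c δ r η : ℝ} (hc : B.CrossBound c δ) (hr : 0 < r) {m : ℕ}
    {α β a b a0 b0 : ℝ} (h : B.Pb m α β (a - r) (b + r))
    (hδ : ∀ i < m, |B.F^[i] β - B.F^[i] α| ≤ δ) (hp : B.Pb m a0 b0 a b) (hα : α ≤ a0) (hβ : b0 ≤ β)
    (hV : b - a ≤ r * η) : B.Dst m a0 b0 (2 * η + c * B.csum m a0 b0) := by
  refine Dst.of_log hp.reg fun u hu v hv => ?_
  have hu1 := hp.mem_Ioo hu
  have hv1 := hp.mem_Ioo hv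
  have := log_distortion hc hr h hδ (v := v) (u := u)
    ⟨by linarith [hv1.1], by linarith [hv1.2]⟩ ⟨hα.trans_lt hu.1, hu.2.trans_le hβ⟩
    ⟨hα.trans_lt hv.1, hv.2.trans_le hβ⟩
  have h1 : |B.F^[m] u - B.F^[m] v| ≤ r * η := by
    rw [abs_le]; constructor <;> linarith [hu1.1, hu1.2, hv1.1, hv1.2]
  have h2 : 2 / r * |B.F^[m] u - B.F^[m] v| ≤ 2 / r * (r * η) :=
    mul_le_mul_of_nonneg_left h1 (by positivity)
  have h3 : 2 / r * (r * η) = 2 * η := by field_simp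
  have h4 := mul_le_mul_of_nonneg_left (hp.reg.csum_le hp.lt (Ioo_subset_Icc_self hu)
    (Ioo_subset_Icc_self hv)) hc.1
  linarith

variable (B)

lemma piece_pq : B.Piece 1 B.p B.q :=
  ⟨B.hpq, le_rfl, by simpa using B.deriv_p, by simpa using B.deriv_q,
    fun x hx => by simpa using (B.decr x hx).ne⟩

/-- The room around `[p, q]`. -/
def room : ℝ := min (B.p - B.dq) (B.dp - B.q)

lemma room_pos : 0 < B.room := lt_min (by linarith [B.hdq.2]) (by linarith [B.hdp.1])

lemma room_le_left : B.dq ≤ B.p - B.room := by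
  unfold room; linarith [min_le_left (B.p - B.dq) (B.dp - B.q)]

lemma room_le_right : B.q + B.room ≤ B.dp := by
  unfold room; linarith [min_le_right (B.p - B.dq) (B.dp - B.q)]

/-- Distortion of the branches onto `(p, q)`. -/
lemma exists_log_distortion : ∃ K ≥ 0, ∀ m a b (k : ℤ), B.Pb m a b (B.p + k) (B.q + k) →
    ∀ u ∈ Ioo a b, ∀ v ∈ Ioo a b, Real.log (B.dn m u) - Real.log (B.dn m v) ≤
      K * |B.F^[m] u - B.F^[m] v| + K * B.csum m u v := by
  obtain ⟨E, hE⟩ := B.exists_crossBound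
  have hr := B.room_pos
  refine ⟨max (2 / B.room) E, le_max_of_le_right hE.1, fun m a b k hp u hu v hv => ?_⟩
  have hu1 := hp.mem_Ioo hu
  have hv1 := hp.mem_Ioo hv
  obtain ⟨α, β, hx, hext⟩ := B.exists_extension m u k
    ⟨by linarith [hu1.1], by linarith [hu1.2]⟩
  obtain ⟨n1, n2⟩ := hext.nest hp hx hu (by linarith [B.hdq.2]) (by linarith [B.hdp.1])
  have := log_distortion hE hr hext
    (fun i hi => (hext.reg.length_le_one hext.lt hi).trans (by norm_num)) (v := v) (u := u)
    ⟨by linarith [hv1.1, B.room_le_left], by linarith [hv1.2, B.room_le_right]⟩ hx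
    ⟨n1.trans_lt hv.1, hv.2.trans_le n2⟩
  refine this.trans (add_le_add ?_ ?_)
  · exact mul_le_mul_of_nonneg_right (le_max_left _ _) (abs_nonneg _)
  · exact mul_le_mul_of_nonneg_right (le_max_right _ _) (B.csum_nonneg _ _ _)

lemma exists_dst : ∃ K ≥ 0, ∀ m a b (k : ℤ), B.Pb m a b (B.p + k) (B.q + k) →
    B.Dst m a b (K + K * B.csum m a b) := by
  obtain ⟨K, hK, h⟩ := B.exists_log_distortion
  refine ⟨K, hK, fun m a b k hp => Dst.of_log hp.reg fun u hu v hv => ?_⟩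
  have h1 := h m a b k hp u hu v hv
  have hu1 := hp.mem_Ioo hu
  have hv1 := hp.mem_Ioo hv
  have h2 : |B.F^[m] u - B.F^[m] v| ≤ 1 := by
    rw [abs_le]; constructor <;> linarith [hu1.1, hu1.2, hv1.1, hv1.2, B.hqp]
  have h3 := mul_le_mul_of_nonneg_left h2 hK
  have h4 := mul_le_mul_of_nonneg_left (hp.reg.csum_le hp.lt (Ioo_subset_Icc_self hu)
    (Ioo_subset_Icc_self hv)) hK
  linarith

lemma vsum_split (a b : ℝ) (T m : ℕ) (x u v : ℝ) :
    B.vsum a b (T + m) x u v = B.vsum a b T x u v +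
      B.vsum a b m (B.F^[T] x) (B.F^[T] u) (B.F^[T] v) := by
  classical
  unfold vsum
  simp only [Finset.sum_filter]
  rw [Finset.sum_range_add]
  simp only [← iter_add, add_comm T]

/-- The total length of a branch is controlled by the lengths at the visits to `(p, q)`. -/
lemma exists_csum_le_vsum : ∃ C ≥ 0, ∀ m x a b (k : ℤ), B.Pb m a b (B.p + k) (B.q + k) →
    x ∈ Ioo a b → B.csum m a b ≤ C * B.vsum B.p B.q (m + 1) x a b := by
  obtain ⟨K, hK, hdst⟩ := B.exists_dst
  have hpq := B.hpq
  set C := Real.exp (3 * K) * 2 / (B.q - B.p) with hC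
  have hC0 : 0 ≤ C := by
    have : 0 < B.q - B.p := by linarith
    positivity
  refine ⟨C, hC0, ?_⟩
  suffices H : ∀ m x a b (k : ℤ), B.Pb m a b (B.p + k) (B.q + k) → x ∈ Ioo a b →
      B.csum m a b ≤ C * B.vsum B.p B.q m (B.F x) (B.F a) (B.F b) by
    intro m x a b k hp hx
    refine (H m x a b k hp hx).trans (mul_le_mul_of_nonneg_left ?_ hC0)
    rw [add_comm, vsum_split]
    exact le_add_of_nonneg_left (vsum_nonneg _ _ _ _ _ _)
  intro m
  induction m using Nat.strong_induction_on with
  | _ m ih =>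
  intro x a b k hp hx
  rcases Nat.eq_zero_or_pos m with rfl | hm
  · simp [csum, vsum]
  classical
  have hVm : InMod B.p B.q (B.F^[m] x) := ⟨k, hp.mem_Ioo hx⟩
  have hex : ∃ j, 0 < j ∧ InMod B.p B.q (B.F^[j] x) := ⟨m, hm, hVm⟩
  obtain ⟨j, ⟨hj0, k', hk'⟩, hjm, hfirst⟩ : ∃ j, (0 < j ∧ InMod B.p B.q (B.F^[j] x)) ∧ j ≤ m ∧
      ∀ i, 0 < i → i < j → ¬ InMod B.p B.q (B.F^[i] x) :=
    ⟨Nat.find hex, Nat.find_spec hex, Nat.find_min' hex ⟨hm, hVm⟩,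
      fun i h1 h2 h3 => Nat.find_min hex h2 ⟨h1, h3⟩⟩
  obtain ⟨d, rfl⟩ := Nat.exists_eq_add_of_le' hjm
  obtain ⟨A1, C1, q1, q2⟩ := hp.split
  have hx1 := q1.mem_Ioo hx
  obtain ⟨α, β, hxα, hext⟩ := B.exists_extension j x k'
    ⟨by linarith [hk'.1], by linarith [hk'.2]⟩
  obtain ⟨w0, w1, -, -, hxw, hw⟩ := hext.pullback_point hxα hk' (by linarith [B.hdq.2])
    (by linarith [B.hdp.1])
  obtain ⟨n1, n2⟩ := B.piece_pq.nice q2 hx1 hk'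
  obtain ⟨z1, z2⟩ := hw.nest q1 hxw hx n1 n2
  have hs2 := hw.csum_le_of_first (B.piece_pq.first_of_point hw hxw hfirst)
  have hrat : ∀ r < j, |B.F^[r] b - B.F^[r] a| * (B.q - B.p) ≤
      Real.exp (3 * K) * (C1 - A1) * |B.F^[r] w1 - B.F^[r] w0| := by
    intro r hr
    obtain ⟨e, rfl⟩ := Nat.exists_eq_add_of_le' hr.le
    obtain ⟨E0, E1, v1, v2⟩ := hw.split
    obtain ⟨F0, F1, v3, v4⟩ := q1.split
    have hd : B.Dst e E0 E1 (3 * K) := by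
      refine (hdst e E0 E1 k' v2).mono le_rfl le_rfl ?_
      have := v1.csum_add e
      rw [add_comm r e] at this
      have := mul_le_mul_of_nonneg_left
        (show B.csum e E0 E1 ≤ 2 by linarith [B.csum_nonneg r w0 w1]) hK
      linarith
    obtain ⟨y1, y2⟩ := v2.nest v4 (v1.mem_Ioo hxw) (v3.mem_Ioo hx) n1 n2
    have := hd.ratio y1 v4.lt y2 le_rfl v2.lt le_rfl
    rw [v2.length, v4.length] at this
    rw [v1.length, v3.length]
    calc _ = (F1 - F0) * (B.q + (k' : ℝ) - (B.p + k')) := by ring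
      _ ≤ _ := this
  have hbl : B.csum j a b ≤ C * (C1 - A1) := by
    rw [hC, div_mul_eq_mul_div, le_div_iff₀ (by linarith)]
    calc B.csum j a b * (B.q - B.p) ≤ Real.exp (3 * K) * (C1 - A1) * B.csum j w0 w1 := by
          unfold csum
          rw [Finset.sum_mul, Finset.mul_sum]
          exact Finset.sum_le_sum fun r hr => hrat r (Finset.mem_range.1 hr)
      _ ≤ Real.exp (3 * K) * (C1 - A1) * 2 := by
          have := q1.lt'
          exact mul_le_mul_of_nonneg_left hs2 (mul_nonneg (Real.exp_pos _).le (by linarith))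
      _ = _ := by ring
  have hih := ih d (by omega) (B.F^[j] x) A1 C1 k q2 hx1
  rw [add_comm d j, q1.csum_add]
  have hv : (C1 - A1) + B.vsum B.p B.q d (B.F (B.F^[j] x)) (B.F A1) (B.F C1) ≤
      B.vsum B.p B.q (j + d) (B.F x) (B.F a) (B.F b) := by
    obtain ⟨j, rfl⟩ : ∃ i, j = i + 1 := ⟨j - 1, by omega⟩
    rw [show j + 1 + d = j + (1 + d) by ring, vsum_split, vsum_split]
    have e0 := B.vsum_nonneg B.p B.q j (B.F x) (B.F a) (B.F b)
    have e : ∀ y, B.F^[j] (B.F y) = B.F^[j + 1] y := fun y => rfl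
    have e1 : B.vsum B.p B.q 1 (B.F^[j + 1] x) (B.F^[j + 1] a) (B.F^[j + 1] b) = C1 - A1 := by
      unfold vsum
      rw [Finset.sum_filter, Finset.sum_range_one, if_pos (by simpa using ⟨k', hk'⟩)]
      simpa using q1.length
    have e2 : B.vsum B.p B.q d (B.F^[1] (B.F^[j + 1] x)) (B.F^[1] (B.F^[j + 1] a))
        (B.F^[1] (B.F^[j + 1] b)) = B.vsum B.p B.q d (B.F (B.F^[j + 1] x)) (B.F A1) (B.F C1) := by
      rcases q1.ends with ⟨-, e1, e2⟩ | ⟨-, e1, e2⟩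
      · rw [e1, e2]; simp only [Function.iterate_one]
      · rw [e1, e2]; simp only [Function.iterate_one]
        unfold vsum
        exact Finset.sum_congr rfl fun _ _ => abs_sub_comm _ _
    rw [e, e, e, e1, e2]
    linarith
  have := mul_le_mul_of_nonneg_left hv hC0
  rw [mul_add] at this
  linarith

end Bim

namespace Bim

variable (B : Bim)

lemma finite_fiber (u v y : ℝ) : {z ∈ Icc u v | B.F z = y}.Finite := by
  have hfin : (⋃ k ∈ Icc ⌊u - B.p - 1⌋ ⌈v - B.p⌉,
      ({z | z ∈ Icc (B.p + k) (B.q + k) ∧ B.F z = y} ∪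
        {z | z ∈ Icc (B.q + k) (B.p + 1 + k) ∧ B.F z = y})).Finite := by
    refine (Set.finite_Icc _ _).biUnion fun k _ => Set.Finite.union ?_ ?_
    · refine Set.Subsingleton.finite fun z hz w hw => ?_
      exact (B.pb_lap_decr k).injOn hz.1 hw.1 (by simpa using hz.2.trans hw.2.symm)
    · refine Set.Subsingleton.finite fun z hz w hw => ?_
      exact (B.pb_lap_incr k).injOn hz.1 hw.1 (by simpa using hz.2.trans hw.2.symm)
  refine hfin.subset ?_
  rintro z ⟨hz, rfl⟩
  obtain ⟨k, hk⟩ := B.exists_lap z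
  have hpq := B.hpq
  have hqp := B.hqp
  have hk' : z - k ∈ Icc B.p (B.p + 1) := by
    rcases hk with h | h | h | h
    · constructor <;> linarith
    · constructor <;> linarith [h.1, h.2]
    · constructor <;> linarith
    · constructor <;> linarith [h.1, h.2]
  simp only [mem_iUnion]
  refine ⟨k, ⟨?_, ?_⟩, ?_⟩
  · rw [← Int.cast_le (R := ℝ)]
    linarith [Int.floor_le (u - B.p - 1), hz.1, hk'.2]
  · rw [← Int.cast_le (R := ℝ)]
    linarith [Int.le_ceil (v - B.p), hz.2, hk'.1]
  · rcases hk with h | h | h | h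
    · exact Or.inl ⟨⟨by linarith, by linarith⟩, rfl⟩
    · exact Or.inl ⟨⟨by linarith [h.1], by linarith [h.2]⟩, rfl⟩
    · exact Or.inl ⟨⟨by linarith, by linarith⟩, rfl⟩
    · exact Or.inr ⟨⟨by linarith [h.1], by linarith [h.2]⟩, rfl⟩

lemma finite_zeros (n : ℕ) (u v : ℝ) : {z ∈ Icc u v | B.dn n z = 0}.Finite := by
  induction n generalizing u v with
  | zero => simp
  | succ n ih =>
    obtain ⟨u', hu'⟩ := (isCompact_Icc (a := u) (b := v)).bddBelow_image
      (B.continuous_iter 1).continuousOn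
    obtain ⟨v', hv'⟩ := (isCompact_Icc (a := u) (b := v)).bddAbove_image
      (B.continuous_iter 1).continuousOn
    have h1 : (⋃ y ∈ insert (B.F B.p) (insert (B.F B.q) {z ∈ Icc u' v' | B.dn n z = 0}),
        {z ∈ Icc (u - 0) v | B.F z = y}).Finite :=
      (((ih u' v').insert _).insert _).biUnion fun y _ => B.finite_fiber _ v y
    have h2 : (⋃ k ∈ Icc ⌊u - B.q⌋ ⌈v - B.p⌉, ({B.p + k, B.q + (k : ℝ)} : Set ℝ)).Finite :=
      (Set.finite_Icc _ _).biUnion fun k _ => by simp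
    refine (h1.union h2).subset ?_
    rintro z ⟨hz, h0⟩
    rw [B.dn_add n 1 z, mul_eq_zero, dn_one, deriv_eq_zero_iff] at h0
    rcases h0 with h0 | ⟨k, h0⟩
    · left
      simp only [mem_iUnion]
      refine ⟨B.F z, ?_, by simpa using hz, rfl⟩
      right; right
      exact ⟨⟨hu' (mem_image_of_mem _ hz), hv' (mem_image_of_mem _ hz)⟩, h0⟩
    · right
      simp only [mem_iUnion]
      have hpq := B.hpq
      refine ⟨k, ⟨?_, ?_⟩, ?_⟩
      · rw [← Int.cast_le (R := ℝ)]
        rcases h0 with h0 | h0 <;> linarith [Int.floor_le (u - B.q), hz.1]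
      · rw [← Int.cast_le (R := ℝ)]
        rcases h0 with h0 | h0 <;> linarith [Int.le_ceil (v - B.p), hz.2]
      · rcases h0 with h0 | h0
        · left; linarith
        · right; exact (by linarith : z = B.q + k)

variable {B}

/-- Every point outside the zeros of the derivative lies in a monotonicity interval. -/
lemma exists_piece {n : ℕ} (hn : 1 ≤ n) {s0 s1 y : ℝ} (h0 : B.dn n s0 = 0) (h1 : B.dn n s1 = 0)
    (hy : y ∈ Ioo s0 s1) (hd : B.dn n y ≠ 0) :
    ∃ a b, B.Piece n a b ∧ s0 ≤ a ∧ b ≤ s1 ∧ y ∈ Ioo a b := by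
  have hcl : IsClosed {z | B.dn n z = 0} := isClosed_eq (B.continuous_dn n) continuous_const
  have hL : IsCompact (Icc s0 y ∩ {z | B.dn n z = 0}) := isCompact_Icc.inter_right hcl
  have hR : IsCompact (Icc y s1 ∩ {z | B.dn n z = 0}) := isCompact_Icc.inter_right hcl
  obtain ⟨a, ⟨ha, ha0⟩, ha'⟩ := hL.exists_isGreatest ⟨s0, left_mem_Icc.2 hy.1.le, h0⟩
  obtain ⟨b, ⟨hb, hb0⟩, hb'⟩ := hR.exists_isLeast ⟨s1, right_mem_Icc.2 hy.2.le, h1⟩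
  have hay : a < y := lt_of_le_of_ne ha.2 (by rintro rfl; exact hd ha0)
  have hyb : y < b := lt_of_le_of_ne hb.1 (by rintro rfl; exact hd hb0)
  refine ⟨a, b, ⟨hay.trans hyb, hn, ha0, hb0, fun z hz hz0 => ?_⟩, ha.1, hb.2, hay, hyb⟩
  rcases le_total z y with h | h
  · exact absurd (ha' ⟨⟨ha.1.trans hz.1.le, h⟩, hz0⟩) (not_le.2 hz.1)
  · exact absurd (hb' ⟨⟨h, hz.2.le.trans hb.2⟩, hz0⟩) (not_le.2 hz.2)

lemma Piece.reg_subset {n : ℕ} {a b : ℝ} (h : B.Piece n a b) {u v x : ℝ} {l : ℤ}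
    (hr : B.Reg n (Ioo u v)) (hx : x ∈ Ioo u v) (hx' : x ∈ Ioo (a + l) (b + l)) :
    a + l ≤ u ∧ v ≤ b + l := by
  have key : ∀ z, B.dn n z = 0 → z + l ∉ Ioo u v := fun z hz hm =>
    hr _ hm (by rw [dn_translate, hz])
  constructor
  · by_contra hc; push Not at hc
    exact key a h.left ⟨hc, hx'.1.trans hx.2⟩
  · by_contra hc; push Not at hc
    exact key b h.right ⟨hx.1.trans hx'.2, hc⟩

lemma Ret.exists_bound_reg {n : ℕ} {a b κ c : ℝ} {O : ℝ → ℕ → Prop} (R : B.Ret n a b O κ c) :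
    ∃ A ≥ 0, ∀ x M a0 b0, x ∈ Ioo a0 b0 → B.Reg (M + n) (Ioo a0 b0) →
      (∀ i ≤ M, InMod a b (B.F^[i] x) → O x i) → B.vsum a b (M + 1) x a0 b0 ≤ A := by
  classical
  obtain ⟨A, hA⟩ := R.exists_bound
  refine ⟨max A 0, le_max_right _ _, fun x M a0 b0 hx hr hO => ?_⟩
  induction M with
  | zero =>
    by_cases hv : InMod a b (B.F^[0] x)
    · obtain ⟨k, hk⟩ := hv
      obtain ⟨y0, y1, hxy, hpy, -⟩ := R.ext x 0 k (hO 0 le_rfl ⟨k, hk⟩) hk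
      refine le_trans ?_ (le_max_left _ _)
      refine le_trans ?_ (hA x 0 k y0 y1 (hO 0 le_rfl ⟨k, hk⟩) hpy hxy)
      obtain ⟨A1, C1, q1⟩ := (hr.of_le (Nat.zero_le _)).exists_pb (hx.1.trans hx.2)
      obtain ⟨n1, n2⟩ := R.piece.reg_subset (hr.of_le (Nat.le_add_left n 0)) hx hk
      have e : ∀ {u v A C : ℝ}, B.Pb 0 u v A C → u = A ∧ v = C := by
        intro u v A C hp
        rcases hp.ends with ⟨-, e1, e2⟩ | ⟨-, e1, e2⟩
        · exact ⟨e1, e2⟩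
        · exfalso; simp only [Function.iterate_zero, id] at e1 e2; linarith [hp.lt, hp.lt']
      obtain ⟨e1, e2⟩ := e hpy
      unfold vsum
      refine Finset.sum_le_sum fun i hi => ?_
      rw [Finset.mem_filter, Finset.mem_range] at hi
      exact hpy.reg.abs_iter_le hpy.lt (by omega) ⟨by linarith, by linarith [hx.1, hx.2]⟩
        ⟨by linarith [hx.1, hx.2], by linarith⟩
    · refine le_trans (le_of_eq ?_) (le_max_right _ _)
      unfold vsum
      rw [Finset.filter_eq_empty_iff.2, Finset.sum_empty]
      intro i hi
      rw [Finset.mem_range] at hi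
      obtain rfl : i = 0 := by omega
      exact hv
  | succ M ih =>
    by_cases hv : InMod a b (B.F^[M + 1] x)
    · obtain ⟨k, hk⟩ := hv
      have hOM := hO (M + 1) le_rfl ⟨k, hk⟩
      obtain ⟨y0, y1, hxy, hpy, -⟩ := R.ext x (M + 1) k hOM hk
      refine le_trans ?_ (le_max_left _ _)
      refine le_trans ?_ (hA x (M + 1) k y0 y1 hOM hpy hxy)
      obtain ⟨A1, C1, q1⟩ := (hr.of_le (Nat.le_add_right (M + 1) n)).exists_pb (hx.1.trans hx.2)
      have hr' : B.Reg n (Ioo A1 C1) := by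
        rw [← q1.image_Ioo]
        rw [add_comm] at hr
        exact hr.comp_iter
      obtain ⟨n1, n2⟩ := R.piece.reg_subset hr' (q1.mem_Ioo hx) hk
      obtain ⟨z1, z2⟩ := hpy.nest q1 hxy hx n1 n2
      unfold vsum
      refine Finset.sum_le_sum fun i hi => ?_
      rw [Finset.mem_filter, Finset.mem_range] at hi
      exact hpy.reg.abs_iter_le hpy.lt (by omega) ⟨z1, by linarith [hx.1, hx.2]⟩
        ⟨by linarith [hx.1, hx.2], z2⟩
    · have hih := ih (hr.of_le (by omega)) fun i hi => hO i (by omega)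
      refine le_trans (le_of_eq ?_) hih
      unfold vsum
      rw [Finset.range_add_one, Finset.filter_insert, if_neg hv]

/-- Controlled monotonicity intervals filling `(s0, s1)` give a bound for the visits to it. -/
theorem exists_vsum_bound {n : ℕ} (hn : 1 ≤ n) {s0 s1 κ c : ℝ} {O : ℝ → ℕ → Prop}
    (h0 : B.dn n s0 = 0) (h1 : B.dn n s1 = 0)
    (hR : ∀ a b, B.Piece n a b → s0 ≤ a → b ≤ s1 → B.Ret n a b O κ c) :
    ∃ A, ∀ x M a0 b0, x ∈ Ioo a0 b0 → B.Reg (M + n) (Ioo a0 b0) →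
      (∀ i ≤ M, InMod s0 s1 (B.F^[i] x) → O x i) → B.vsum s0 s1 (M + 1) x a0 b0 ≤ A := by
  classical
  have H : ∀ P : ℝ × ℝ, ∃ A ≥ 0, (B.Piece n P.1 P.2 ∧ s0 ≤ P.1 ∧ P.2 ≤ s1) →
      ∀ x M a0 b0, x ∈ Ioo a0 b0 → B.Reg (M + n) (Ioo a0 b0) →
      (∀ i ≤ M, InMod P.1 P.2 (B.F^[i] x) → O x i) → B.vsum P.1 P.2 (M + 1) x a0 b0 ≤ A := by
    rintro ⟨a, b⟩
    by_cases hP : B.Piece n a b ∧ s0 ≤ a ∧ b ≤ s1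
    · obtain ⟨A, hA, h⟩ := (hR a b hP.1 hP.2.1 hP.2.2).exists_bound_reg
      exact ⟨A, hA, fun _ => h⟩
    · exact ⟨0, le_rfl, fun h => absurd h hP⟩
  choose A hA0 hA using H
  set S := (B.finite_zeros n s0 s1).toFinset with hS
  set P := (S ×ˢ S).filter (fun P : ℝ × ℝ => B.Piece n P.1 P.2 ∧ s0 ≤ P.1 ∧ P.2 ≤ s1) with hPdef
  refine ⟨∑ pr ∈ P, A pr, fun x M a0 b0 hx hr hO => ?_⟩
  have step : B.vsum s0 s1 (M + 1) x a0 b0 ≤ ∑ pr ∈ P, B.vsum pr.1 pr.2 (M + 1) x a0 b0 := by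
    unfold vsum
    simp only [Finset.sum_filter]
    rw [Finset.sum_comm]
    refine Finset.sum_le_sum fun i hi => ?_
    rw [Finset.mem_range] at hi
    have hnn : ∀ pr ∈ P, 0 ≤ (if InMod pr.1 pr.2 (B.F^[i] x) then |B.F^[i] b0 - B.F^[i] a0| else 0) := by
      intro pr _; split_ifs <;> positivity
    by_cases hv : InMod s0 s1 (B.F^[i] x)
    · rw [if_pos hv]
      obtain ⟨k, hk⟩ := hv
      have hd : B.dn n (B.F^[i] x - k) ≠ 0 := by
        have h2 : B.dn n (B.F^[i] x) ≠ 0 := by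
          have := (hr.of_le (show n + i ≤ M + n by omega)) x hx
          rw [dn_add] at this
          exact left_ne_zero_of_mul this
        rwa [show B.F^[i] x = (B.F^[i] x - k) + k by ring, dn_translate] at h2
      obtain ⟨a, b, hp, ha, hb, hy⟩ := exists_piece hn h0 h1
        ⟨by linarith [hk.1], by linarith [hk.2]⟩ hd
      have hmem : (a, b) ∈ P := by
        simp only [hPdef, hS, Finset.mem_filter, Finset.mem_product, Set.Finite.mem_toFinset]
        exact ⟨⟨⟨⟨ha, by linarith [hp.lt]⟩, hp.left⟩, ⟨by linarith [hp.lt], hb⟩, hp.right⟩, hp, ha, hb⟩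
      refine le_trans ?_ (Finset.single_le_sum hnn hmem)
      rw [if_pos ⟨k, by linarith [hy.1], by linarith [hy.2]⟩]
    · rw [if_neg hv]
      exact Finset.sum_nonneg hnn
  refine step.trans (Finset.sum_le_sum fun pr hpr => ?_)
  have hpr' := (Finset.mem_filter.1 hpr).2
  refine hA pr hpr' x M a0 b0 hx hr fun i hi ⟨k, hk⟩ => hO i hi ⟨k, ?_, ?_⟩
  · linarith [hk.1, hpr'.2.1]
  · linarith [hk.2, hpr'.2.2]

variable (B) in
/-- Short monotonicity intervals inside `(p, q)` are controlled. -/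
lemma exists_ret_pq : ∃ n ≥ 1, ∀ a b, B.Piece n a b → B.p ≤ a → b ≤ B.q →
    B.Ret n a b (fun _ _ => True) (1 / 40) (1 / 160) := by
  obtain ⟨δ, hδ, hcross⟩ := B.exists_crossBound_small (η := 1 / 160) (by norm_num)
  obtain ⟨r0, hr0, _, hU⟩ := B.exists_uniform hδ
  set r := min (B.room) (r0 / 3) with hrdef
  have hr : 0 < r := lt_min B.room_pos (by linarith)
  have hr1 : r ≤ B.room := min_le_left _ _
  have hr2 : r ≤ r0 / 3 := min_le_right _ _
  obtain ⟨_, _, N, hN⟩ := B.exists_uniform (δ := r / 80) (by linarith)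
  refine ⟨N + 1, by omega, fun a b hP ha hb => ⟨hP, fun _ _ _ _ => trivial, fun _ _ _ _ _ _ => trivial,
    ?_, by norm_num, by norm_num⟩⟩
  intro x m k _ hxk
  have hlen : b - a ≤ r / 80 := hN _ a b hP.lt hP.reg (Or.inl (by omega))
  obtain ⟨α, β, hxα, hext⟩ := B.exists_extension m x k
    ⟨by linarith [hxk.1], by linarith [hxk.2]⟩
  have l1 := B.room_le_left
  have l2 := B.room_le_right
  obtain ⟨α', β', h1, h2, hx', hext'⟩ := hext.pullback_point hxα (A' := a + k - r) (C' := b + k + r)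
    ⟨by linarith [hxk.1], by linarith [hxk.2]⟩ (by linarith) (by linarith)
  obtain ⟨a0, b0, h3, h4, hx0, hp0⟩ := hext'.pullback_point hx' hxk (by linarith) (by linarith)
  refine ⟨a0, b0, hx0, hp0, ?_⟩
  have := dst_of_space hcross hr hext' (η := 1 / 80) (fun i hi => ?_) hp0 h3 h4 (by linarith)
  · convert this using 2; norm_num
  · obtain ⟨d, rfl⟩ := Nat.exists_eq_add_of_le' hi.le
    obtain ⟨A1, C1, q1, q2⟩ := hext'.split
    rw [q1.length]
    exact hU d A1 C1 q2.lt q2.reg (Or.inr (by rw [q2.length]; linarith))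

variable (B) in
/-- The branches onto `(p, q)` have bounded total length. -/
theorem exists_csum_bound : ∃ A ≥ 0, ∀ m a b (k : ℤ), B.Pb m a b (B.p + k) (B.q + k) →
    B.csum m a b ≤ A := by
  obtain ⟨n, hn, hR⟩ := B.exists_ret_pq
  have hz : ∀ z, deriv B.F z = 0 → B.dn n z = 0 := by
    intro z hz
    obtain ⟨d, rfl⟩ := Nat.exists_eq_add_of_le' hn
    rw [dn_add, dn_one, hz, mul_zero]
  obtain ⟨A, hA⟩ := exists_vsum_bound hn (hz _ B.deriv_p) (hz _ B.deriv_q) hR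
  obtain ⟨C, hC, hcv⟩ := B.exists_csum_le_vsum
  refine ⟨C * (|A| + (n + 1)), by positivity, fun m a b k hp => ?_⟩
  obtain ⟨x, hx⟩ := nonempty_Ioo.2 hp.lt
  refine (hcv m x a b k hp hx).trans (mul_le_mul_of_nonneg_left ?_ hC)
  have hall : ∀ i ≤ m, |B.F^[i] b - B.F^[i] a| ≤ 1 := by
    intro i hi
    rcases eq_or_lt_of_le hi with rfl | h
    · rw [hp.length]; linarith [B.hqp]
    · exact hp.reg.length_le_one hp.lt h
  have hlast : ∀ M d, M + d ≤ m + 1 → B.vsum B.p B.q (M + d) x a b ≤ B.vsum B.p B.q M x a b + d := by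
    intro M d hd
    induction d with
    | zero => simp
    | succ d ih =>
      have := ih (by omega)
      rw [← add_assoc]
      have h2 : B.vsum B.p B.q (M + d + 1) x a b ≤ B.vsum B.p B.q (M + d) x a b + 1 := by
        classical
        unfold vsum
        simp only [Finset.sum_filter]
        rw [Finset.sum_range_succ]
        refine add_le_add le_rfl ?_
        split_ifs
        · exact hall _ (by omega)
        · norm_num
      push_cast; linarith
  rcases le_or_gt n m with h | h
  · obtain ⟨M, rfl⟩ := Nat.exists_eq_add_of_le' h
    have h1 := hA x M a b hx hp.reg fun _ _ _ => trivial
    have h2 := hlast (M + 1) n (by omega)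
    rw [show M + n + 1 = M + 1 + n by ring]
    linarith [le_abs_self A]
  · have h2 := hlast 0 (m + 1) (by omega)
    rw [zero_add] at h2
    have h3 : B.vsum B.p B.q 0 x a b = 0 := by simp [vsum]
    have h4 : ((m + 1 : ℕ) : ℝ) ≤ n + 1 := by exact_mod_cast (by omega)
    linarith [abs_nonneg A]

end Bim

/-- The set `S` has, at arbitrarily small scales around `x`, holes of definite proportion. -/
def PorousAt (S : Set ℝ) (x : ℝ) : Prop :=
  ∃ c > 0, ∀ ε > 0, ∃ a b s t : ℝ, x ∈ Ioo a b ∧ b - a < ε ∧ a ≤ s ∧ t ≤ b ∧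
    c * (b - a) ≤ t - s ∧ Disjoint (Ioo s t) S

lemma PorousAt.mono {S T : Set ℝ} {x : ℝ} (h : PorousAt T x) (hST : S ⊆ T) : PorousAt S x := by
  obtain ⟨c, hc, h⟩ := h
  refine ⟨c, hc, fun ε hε => ?_⟩
  obtain ⟨a, b, s, t, h1, h2, h3, h4, h5, h6⟩ := h ε hε
  exact ⟨a, b, s, t, h1, h2, h3, h4, h5, h6.mono_right hST⟩

lemma PorousAt.neg {S : Set ℝ} {x : ℝ} (h : PorousAt S x) : PorousAt (-S) (-x) := by
  obtain ⟨c, hc, h⟩ := h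
  refine ⟨c, hc, fun ε hε => ?_⟩
  obtain ⟨a, b, s, t, h1, h2, h3, h4, h5, h6⟩ := h ε hε
  refine ⟨-b, -a, -t, -s, ⟨by linarith [h1.2], by linarith [h1.1]⟩, by linarith, by linarith,
    by linarith, by linarith, ?_⟩
  rw [Set.disjoint_left] at h6 ⊢
  intro z hz hzS
  exact h6 (a := -z) ⟨by linarith [hz.2], by linarith [hz.1]⟩ hzS

lemma not_tendsto_of_porousAt {S : Set ℝ} {x : ℝ} (h : PorousAt S x) :
    ¬ Tendsto (fun r => volume (S ∩ Metric.closedBall x r) / volume (Metric.closedBall x r))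
      (nhdsWithin 0 (Ioi 0)) (nhds 1) := by
  intro ht
  obtain ⟨c, hc, h⟩ := h
  have hlt : ENNReal.ofReal (1 - c / 2) < 1 := by
    rw [ENNReal.ofReal_lt_one]; linarith
  have hev := ht.eventually (lt_mem_nhds hlt)
  rw [eventually_nhdsWithin_iff, Metric.eventually_nhds_iff] at hev
  obtain ⟨ε, hε, hev⟩ := hev
  obtain ⟨a, b, s, t, h1, h2, h3, h4, h5, h6⟩ := h ε hε
  have hr : 0 < b - a := by linarith [h1.1, h1.2]
  have := hev (y := b - a) (by rw [Real.dist_eq, sub_zero, abs_of_pos hr]; exact h2) hr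
  refine absurd this (not_lt.2 ?_)
  rw [Real.volume_closedBall]
  refine ENNReal.div_le_of_le_mul ?_
  have hst : s < t := by nlinarith
  have hsub : S ∩ Metric.closedBall x (b - a) ⊆ Metric.closedBall x (b - a) \ Ioo s t := by
    rintro z ⟨hz, hz'⟩
    exact ⟨hz', fun hzz => Set.disjoint_left.1 h6 hzz hz⟩
  have hsub' : Ioo s t ⊆ Metric.closedBall x (b - a) := by
    rw [Real.closedBall_eq_Icc]
    intro z hz
    exact ⟨by linarith [hz.1, h1.2], by linarith [hz.2, h1.1]⟩
  refine (measure_mono hsub).trans ?_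
  rw [measure_sdiff hsub' measurableSet_Ioo.nullMeasurableSet (by simp), Real.volume_closedBall,
    Real.volume_Ioo, ← ENNReal.ofReal_sub _ (by linarith), ← ENNReal.ofReal_mul']
  · exact ENNReal.ofReal_le_ofReal (by nlinarith)
  · linarith

/-- A set which is porous at each of its points is null. -/
theorem volume_eq_zero_of_porousAt {S : Set ℝ} (h : ∀ x ∈ S, PorousAt S x) : volume S = 0 := by
  have h1 := Besicovitch.ae_tendsto_measure_inter_div volume S
  have h2 : ∀ᵐ x ∂(volume.restrict S), x ∉ S := by
    filter_upwards [h1] with x hx hxS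
    exact not_tendsto_of_porousAt (h x hxS) hx
  rw [ae_iff] at h2
  simp only [not_not, ofPred_mem_eq] at h2
  exact le_antisymm ((Measure.le_restrict_apply S S).trans_eq' (by rw [inter_self]) |>.trans h2.le)
    bot_le

namespace Bim

variable {B : Bim}

lemma Pb.image_le {n : ℕ} {α β a b A C A' C' : ℝ} (h : B.Pb n α β A C) (h' : B.Pb n a b A' C')
    (h1 : α ≤ a) (h2 : b ≤ β) : A ≤ A' ∧ C' ≤ C := by
  have hlt := h'.lt
  have ma := h.mem_Icc (x := a) ⟨h1, by linarith⟩
  have mb := h.mem_Icc (x := b) ⟨by linarith, h2⟩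
  rcases h'.ends with ⟨-, e1, e2⟩ | ⟨-, e1, e2⟩
  · rw [e1] at ma; rw [e2] at mb; exact ⟨ma.1, mb.2⟩
  · rw [e1] at ma; rw [e2] at mb; exact ⟨mb.1, ma.2⟩

lemma Pb.csum_le_add {m : ℕ} {a0 b0 a b a' b' A M C : ℝ} (h : B.Pb m a0 b0 A C)
    (h1 : B.Pb m a b A M) (h2 : B.Pb m a' b' M C) (l1 : a0 ≤ a) (l2 : b ≤ b0) (l3 : a0 ≤ a')
    (l4 : b' ≤ b0) (j : ℕ) : B.csum j a0 b0 ≤ B.csum j a b + B.csum j a' b' := by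
  have ma : a ∈ Icc a0 b0 := ⟨l1, by linarith [h1.lt]⟩
  have mb : b ∈ Icc a0 b0 := ⟨by linarith [h1.lt], l2⟩
  have ma' : a' ∈ Icc a0 b0 := ⟨l3, by linarith [h2.lt]⟩
  have mb' : b' ∈ Icc a0 b0 := ⟨by linarith [h2.lt], l4⟩
  have m0 : a0 ∈ Icc a0 b0 := ⟨le_rfl, h.lt.le⟩
  have m1 : b0 ∈ Icc a0 b0 := ⟨h.lt.le, le_rfl⟩
  have hlt := h.lt
  have hlt1 := h1.lt
  have hlt2 := h2.lt
  have key : ∀ u v w : ℝ, B.csum j u w ≤ B.csum j u v + B.csum j v w := by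
    intro u v w
    unfold csum
    rw [← Finset.sum_add_distrib]
    refine Finset.sum_le_sum fun i _ => ?_
    calc _ = |(B.F^[i] v - B.F^[i] u) + (B.F^[i] w - B.F^[i] v)| := by congr 1; ring
      _ ≤ _ := abs_add_le _ _
  rcases h.ends with ⟨hm, e1, e2⟩ | ⟨hm, e1, e2⟩
  · rcases h1.ends with ⟨-, f1, f2⟩ | ⟨-, f1, f2⟩
    · rcases h2.ends with ⟨-, g1, g2⟩ | ⟨-, g1, g2⟩
      · have x1 := h.injOn m0 ma (e1.trans f1.symm)
        have x2 := h.injOn mb ma' (f2.trans g1.symm)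
        have x3 := h.injOn m1 mb' (e2.trans g2.symm)
        subst x1 x2 x3
        exact key _ _ _
      · have := hm ma' mb' hlt2
        rw [g1, g2] at this
        exact absurd h2.lt' (by linarith)
    · have := hm ma mb hlt1
      rw [f1, f2] at this
      exact absurd h1.lt' (by linarith)
  · rcases h1.ends with ⟨-, f1, f2⟩ | ⟨-, f1, f2⟩
    · have := hm ma mb hlt1
      rw [f1, f2] at this
      exact absurd h1.lt' (by linarith)
    · rcases h2.ends with ⟨-, g1, g2⟩ | ⟨-, g1, g2⟩
      · have := hm ma' mb' hlt2
        rw [g1, g2] at this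
        exact absurd h2.lt' (by linarith)
      · have x1 := h.injOn m0 ma' (e1.trans g1.symm)
        have x2 := h.injOn mb' ma (g2.trans f1.symm)
        have x3 := h.injOn m1 mb (e2.trans f2.symm)
        subst x1 x2 x3
        rw [add_comm]
        exact key _ _ _

variable (B) in
/-- A short interval adjacent to `(p, q)` pulls back to an interval comparable to the pull-back
of `(p, q)`, as long as the pull-back extends on both sides. -/
lemma exists_gap : ∃ g > 0, g ≤ B.room / 2 ∧ ∃ C ≥ 0, ∀ m (k : ℤ) α β a0 b0 a b a' b',
    B.Pb m α β (B.p + k - B.room / 2) (B.q + g + k + B.room / 2) →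
    B.Pb m a0 b0 (B.p + k) (B.q + g + k) → B.Pb m a b (B.p + k) (B.q + k) →
    B.Pb m a' b' (B.q + k) (B.q + g + k) → α ≤ a0 → b0 ≤ β → a0 ≤ a → b ≤ b0 → a0 ≤ a' → b' ≤ b0 →
    B.csum m a' b' ≤ C * B.csum m a b ∧ b0 - a0 ≤ C * (b - a) := by
  obtain ⟨E, hE⟩ := B.exists_crossBound
  obtain ⟨A, hA, hcs⟩ := B.exists_csum_bound
  have hr := B.room_pos
  set r := B.room / 2 with hrdef
  have hr0 : 0 < r := by linarith
  set K := 2 / r * (1 + r) + E * (A + 2) with hK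
  have hqp := B.hpq
  have hqp' := B.hqp
  set s := B.q - B.p with hs
  have hs0 : 0 < s := by linarith
  set g := min r (s / (Real.exp K * (A + 1))) with hg
  have hek := Real.exp_pos K
  have hg0 : 0 < g := lt_min hr0 (by positivity)
  have hgr : g ≤ r := min_le_left _ _
  have hgA : Real.exp K * g / s * A ≤ 1 := by
    have h1 : g ≤ s / (Real.exp K * (A + 1)) := min_le_right _ _
    rw [le_div_iff₀ (by positivity)] at h1
    rw [div_mul_eq_mul_div, div_le_one hs0]
    nlinarith [mul_pos hek hg0]
  refine ⟨g, hg0, hgr, Real.exp K * (s + g) / s, by positivity, ?_⟩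
  intro m k
  suffices H : ∀ m α β a0 b0 a b a' b',
      B.Pb m α β (B.p + k - r) (B.q + g + k + r) →
      B.Pb m a0 b0 (B.p + k) (B.q + g + k) → B.Pb m a b (B.p + k) (B.q + k) →
      B.Pb m a' b' (B.q + k) (B.q + g + k) → α ≤ a0 → b0 ≤ β → a0 ≤ a → b ≤ b0 → a0 ≤ a' → b' ≤ b0 →
      B.csum m a' b' ≤ Real.exp K * g / s * B.csum m a b ∧
        b0 - a0 ≤ Real.exp K * (s + g) / s * (b - a) by
    intro α β a0 b0 a b a' b' h1 h2 h3 h4 l1 l2 l3 l4 l5 l6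
    obtain ⟨x, y⟩ := H m α β a0 b0 a b a' b' h1 h2 h3 h4 l1 l2 l3 l4 l5 l6
    refine ⟨x.trans (mul_le_mul_of_nonneg_right ?_ (B.csum_nonneg _ _ _)), y⟩
    rw [div_le_div_iff_of_pos_right hs0]
    nlinarith
  have main : ∀ {m α β a0 b0 a b a' b'},
      B.Pb m α β (B.p + k - r) (B.q + g + k + r) →
      B.Pb m a0 b0 (B.p + k) (B.q + g + k) → B.Pb m a b (B.p + k) (B.q + k) →
      B.Pb m a' b' (B.q + k) (B.q + g + k) → α ≤ a0 → b0 ≤ β → a0 ≤ a → b ≤ b0 → a0 ≤ a' → b' ≤ b0 →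
      B.csum m a' b' ≤ 2 → b' - a' ≤ Real.exp K * g / s * (b - a) ∧
        b0 - a0 ≤ Real.exp K * (s + g) / s * (b - a) := by
    intro m α β a0 b0 a b a' b' h h0 h1 h2 l1 l2 l3 l4 l5 l6 hc
    have hcsum : B.csum m a0 b0 ≤ A + 2 :=
      (h0.csum_le_add h1 h2 l3 l4 l5 l6 m).trans (add_le_add (hcs m a b k h1) hc)
    have hd : B.Dst m a0 b0 K := by
      refine Dst.of_log h0.reg fun u hu v hv => ?_
      have hu1 := h0.mem_Ioo hu
      have hv1 := h0.mem_Ioo hv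
      refine (log_distortion hE hr0 h (fun i hi => (h.reg.length_le_one h.lt hi).trans (by norm_num))
        (v := v) (u := u) ⟨by linarith [hv1.1], by linarith [hv1.2]⟩
        ⟨l1.trans_lt hu.1, hu.2.trans_le l2⟩ ⟨l1.trans_lt hv.1, hv.2.trans_le l2⟩).trans ?_
      have t1 : |B.F^[m] u - B.F^[m] v| ≤ 1 + r := by
        rw [abs_le]; constructor <;> linarith [hu1.1, hu1.2, hv1.1, hv1.2]
      have t2 : B.csum m u v ≤ A + 2 :=
        (h0.reg.csum_le h0.lt (Ioo_subset_Icc_self hu) (Ioo_subset_Icc_self hv)).trans hcsum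
      exact add_le_add (mul_le_mul_of_nonneg_left t1 (by positivity))
        (mul_le_mul_of_nonneg_left t2 hE.1)
    have r1 := hd.ratio l5 h2.lt l6 l3 h1.lt l4
    have r2 := hd.ratio le_rfl h0.lt le_rfl l3 h1.lt l4
    rw [h1.length, h2.length] at r1
    rw [h1.length, h0.length] at r2
    rw [div_mul_eq_mul_div, div_mul_eq_mul_div, le_div_iff₀ hs0, le_div_iff₀ hs0]
    constructor
    · linarith
    · linarith
  intro m
  induction m with
  | zero =>
    intro α β a0 b0 a b a' b' h1 h2 h3 h4 l1 l2 l3 l4 l5 l6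
    exact ⟨by simp [csum], (main h1 h2 h3 h4 l1 l2 l3 l4 l5 l6 (by simp [csum])).2⟩
  | succ m ih =>
    intro α β a0 b0 a b a' b' h1 h2 h3 h4 l1 l2 l3 l4 l5 l6
    obtain ⟨A1, C1, p1, q1⟩ := h1.split
    obtain ⟨A2, C2, p2, q2⟩ := h2.split
    obtain ⟨A3, C3, p3, q3⟩ := h3.split
    obtain ⟨A4, C4, p4, q4⟩ := h4.split
    obtain ⟨i1, i2⟩ := p1.image_le p2 l1 l2
    obtain ⟨i3, i4⟩ := p2.image_le p3 l3 l4
    obtain ⟨i5, i6⟩ := p2.image_le p4 l5 l6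
    obtain ⟨j1, -⟩ := ih _ _ _ _ _ _ _ _ q1 q2 q3 q4 i1 i2 i3 i4 i5 i6
    have e1 : B.csum (m + 1) a b = (b - a) + B.csum m A3 C3 := by
      rw [add_comm m 1, p3.csum_add m]; congr 1; simp [csum, abs_of_pos (sub_pos.2 h3.lt)]
    have e2 : B.csum (m + 1) a' b' = (b' - a') + B.csum m A4 C4 := by
      rw [add_comm m 1, p4.csum_add m]; congr 1; simp [csum, abs_of_pos (sub_pos.2 h4.lt)]
    have t1 : b' - a' ≤ 1 := by
      have := h4.reg.length_le_one h4.lt (Nat.succ_pos m)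
      simpa [abs_of_pos (sub_pos.2 h4.lt)] using this
    have t2 : B.csum m A4 C4 ≤ 1 := by
      refine j1.trans (le_trans ?_ hgA)
      exact mul_le_mul_of_nonneg_left (hcs _ _ _ _ q3) (by positivity)
    obtain ⟨y1, y2⟩ := main h1 h2 h3 h4 l1 l2 l3 l4 l5 l6 (by rw [e2]; linarith)
    refine ⟨?_, y2⟩
    rw [e1, e2, mul_add]
    linarith

end Bim

namespace Bim
variable {B : Bim}

variable (B) in
/-- The points whose orbit never visits the interior of the decreasing lap. -/
def Lam : Set ℝ := {x | ∀ i, ¬ B.InI (B.F^[i] x)}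

lemma iter_mem_Lam {x : ℝ} (h : x ∈ B.Lam) (n : ℕ) : B.F^[n] x ∈ B.Lam := by
  intro i
  rw [← iter_add]
  exact h _

lemma not_mem_Lam_of_pb {m : ℕ} {a b x : ℝ} {k : ℤ} (h : B.Pb m a b (B.p + k) (B.q + k))
    (hx : x ∈ Ioo a b) : x ∉ B.Lam := by
  intro hL
  have := h.mem_Ioo hx
  exact hL m ⟨k, by linarith [this.1], by linarith [this.2]⟩

lemma InI.mirror {y : ℝ} (h : B.InI y) : B.mirror.InI (-y) := by
  obtain ⟨k, hk⟩ := h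
  refine ⟨-k, ?_⟩
  simp only [Bim.mirror]
  push_cast
  exact ⟨by linarith [hk.2], by linarith [hk.1]⟩

lemma mem_Lam_mirror {x : ℝ} : -x ∈ B.mirror.Lam ↔ x ∈ B.Lam := by
  refine forall_congr' fun i => not_congr ?_
  rw [mirror_iter, neg_neg]
  refine ⟨fun h => ?_, InI.mirror⟩
  have := h.mirror
  rwa [mirror_mirror, neg_neg] at this

/-- A point accumulating on the lower critical point is a porosity point. -/
lemma porousAt_of_records {x : ℝ} {κ : ℕ → ℤ} (hκ : ∀ i, B.F^[i] x - κ i ∈ Ioo B.q (B.p + 1))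
    (h : ∀ ε > 0, ∃ i, B.F^[i] x - κ i < B.q + ε) : PorousAt B.Lam x := by
  obtain ⟨g, hg, hgr, C, hC, hgap⟩ := B.exists_gap
  have hr := B.room_pos
  have l1 := B.room_le_left
  have l2 := B.room_le_right
  have hpq := B.hpq
  refine ⟨(C + 1)⁻¹, by positivity, fun ε hε => ?_⟩
  obtain ⟨_, _, N, hN⟩ := B.exists_uniform (δ := ε / 2) (by linarith)
  obtain ⟨m, hm, hu, hrec⟩ := exists_strict_record (fun i => (hκ i).1) h hg N
  obtain ⟨α, β, hx, hp⟩ := B.exists_extension_record m x κ (fun i _ => hκ i) hrec (by linarith)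
  have hum := (hκ m).1
  obtain ⟨α', β', -, -, hx', hp'⟩ := hp.pullback_point hx (A' := B.p + κ m - B.room / 2)
    (C' := B.q + g + κ m + B.room / 2) ⟨by linarith, by linarith⟩ (by linarith) (by linarith)
  obtain ⟨a0, b0, i1, i2, hx0, hp0⟩ := hp'.pullback_point hx' (A' := B.p + κ m)
    (C' := B.q + g + κ m) ⟨by linarith, by linarith⟩ (by linarith) (by linarith)
  obtain ⟨a, b, i3, i4, hp1⟩ := hp0.pullback (A' := B.p + κ m) (C' := B.q + κ m) (by linarith)
    (by linarith) (by linarith)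
  obtain ⟨a', b', i5, i6, hp2⟩ := hp0.pullback (A' := B.q + κ m) (C' := B.q + g + κ m) (by linarith)
    (by linarith) (by linarith)
  have hlen := (hgap m (κ m) α' β' a0 b0 a b a' b' hp' hp0 hp1 hp2 i1 i2 i3 i4 i5 i6).2
  refine ⟨a0, b0, a, b, hx0, ?_, i3, i4, ?_, ?_⟩
  · linarith [hN m a0 b0 hp0.lt hp0.reg (Or.inl hm)]
  · rw [inv_mul_le_iff₀ (by positivity)]
    linarith [hp1.lt]
  · rw [Set.disjoint_left]
    exact fun z hz => not_mem_Lam_of_pb hp1 hz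

lemma porousAt_of_records' {x : ℝ} {κ : ℕ → ℤ} (hκ : ∀ i, B.F^[i] x - κ i ∈ Ioo B.q (B.p + 1))
    (h : ∀ ε > 0, ∃ i, B.p + 1 - ε < B.F^[i] x - κ i) : PorousAt B.Lam x := by
  have := porousAt_of_records (B := B.mirror) (x := -x) (κ := fun i => -κ i - 1) (fun i => by
      have := hκ i
      rw [mirror_iter, neg_neg]
      simp only [Bim.mirror]
      push_cast
      exact ⟨by linarith [this.2], by linarith [this.1]⟩) (fun ε hε => by
      obtain ⟨i, hi⟩ := h ε hε
      refine ⟨i, ?_⟩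
      rw [mirror_iter, neg_neg]
      simp only [Bim.mirror]
      push_cast
      linarith)
  have h2 := this.neg
  rw [neg_neg] at h2
  refine h2.mono fun z hz => ?_
  exact mem_Lam_mirror.2 hz

variable (B) in
/-- The orbit of `x` stays at distance `ε` from the decreasing lap up to time `m`. -/
def Stay (ε : ℝ) (x : ℝ) (m : ℕ) : Prop :=
  ∀ i ≤ m, ∃ k : ℤ, B.F^[i] x - k ∈ Icc (B.q + ε) (B.p + 1 - ε)

lemma Stay.tail {ε x : ℝ} {m i : ℕ} (h : B.Stay ε x (m + i)) : B.Stay ε (B.F^[i] x) m := by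
  intro j hj
  rw [← iter_add]
  exact h _ (by omega)

lemma Stay.of_le {ε x : ℝ} {m i : ℕ} (h : B.Stay ε x m) (hi : i ≤ m) : B.Stay ε x i :=
  fun j hj => h j (hj.trans hi)

variable (B) in
/-- Short intervals pull back along orbits staying away from the decreasing lap. -/
lemma exists_pb_of_stay {ε : ℝ} (hε : 0 < ε) : ∃ r > 0, ∀ m x A C, B.Stay ε x m →
    B.F^[m] x ∈ Ioo A C → C - A ≤ r → ∃ α β, x ∈ Ioo α β ∧ B.Pb m α β A C := by
  have hlap := B.pb_lap_incr 0
  have hmono : StrictMonoOn B.F (Icc B.q (B.p + 1)) :=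
    strictMonoOn_of_deriv_pos (convex_Icc _ _) (B.continuous_iter 1).continuousOn
      (by rw [interior_Icc]; exact B.incr)
  have hp1 : B.F (B.p + 1) = B.F B.p + 1 := B.lift _
  rcases le_or_gt (B.q + ε) (B.p + 1 - ε) with hne | hne
  swap
  · refine ⟨1, one_pos, fun m x A C hs _ _ => ?_⟩
    obtain ⟨k, hk⟩ := hs 0 (Nat.zero_le _)
    linarith [hk.1, hk.2]
  have g1 : B.F B.q < B.F (B.q + ε) := hmono ⟨le_rfl, B.hqp.le⟩ ⟨by linarith, by linarith⟩ (by linarith)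
  have g2 : B.F (B.p + 1 - ε) < B.F (B.p + 1) :=
    hmono ⟨by linarith, by linarith⟩ ⟨B.hqp.le, le_rfl⟩ (by linarith)
  set e := min (B.F (B.q + ε) - B.F B.q) (B.F (B.p + 1) - B.F (B.p + 1 - ε)) with he
  have he0 : 0 < e := lt_min (by linarith) (by linarith)
  have he1 : e ≤ _ := min_le_left _ _
  have he2 : e ≤ _ := min_le_right _ _
  obtain ⟨r, hr, N, hU⟩ := B.exists_uniform he0
  refine ⟨r, hr, fun m => ?_⟩
  induction m with
  | zero =>
    intro x A C _ hx _
    exact ⟨A, C, hx, Pb.zero (hx.1.trans hx.2)⟩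
  | succ m ih =>
    intro x A C hs hx hAC
    obtain ⟨α, β, hx1, hp⟩ := ih (B.F x) A C (hs.tail (i := 1)) hx hAC
    have hlen : β - α ≤ e := hU m α β hp.lt hp.reg (Or.inr (by rw [hp.length]; exact hAC))
    obtain ⟨k, hk⟩ := hs 0 (Nat.zero_le _)
    simp only [Function.iterate_zero, id] at hk
    have m1 : B.F (B.q + ε) ≤ B.F (x - k) :=
      hmono.monotoneOn ⟨by linarith, by linarith⟩ ⟨by linarith [hk.1], by linarith [hk.2]⟩ hk.1
    have m2 : B.F (x - k) ≤ B.F (B.p + 1 - ε) :=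
      hmono.monotoneOn ⟨by linarith [hk.1], by linarith [hk.2]⟩ ⟨by linarith, by linarith⟩ hk.2
    have hFk : B.F (x - k) = B.F x - k := B.iter_sub_int 1 x k
    have hxI : x ∈ Ioo (B.q + k) (B.p + 1 + k) := ⟨by linarith [hk.1], by linarith [hk.2]⟩
    obtain ⟨a', b', -, -, hx', hp'⟩ := (B.pb_lap_incr k).pullback_point hxI (A' := α) (C' := β) hx1
      (by linarith [hx1.1, hx1.2]) (by linarith [hx1.1, hx1.2])
    exact ⟨a', b', hx', hp'.comp hp⟩

variable (B) in
lemma exists_ret_stay {ε : ℝ} (hε : 0 < ε) : ∃ n ≥ 1, ∀ a b, B.Piece n a b → B.q ≤ a →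
    b ≤ B.p + 1 → B.Ret n a b (B.Stay ε) (1 / 40) (1 / 160) := by
  obtain ⟨δ, hδ, hcross⟩ := B.exists_crossBound_small (η := 1 / 160) (by norm_num)
  obtain ⟨r0, hr0, _, hU⟩ := B.exists_uniform hδ
  obtain ⟨r1, hr1, hst⟩ := B.exists_pb_of_stay hε
  set r := min (r1 / 3) (r0 / 3) with hrdef
  have hr : 0 < r := lt_min (by linarith) (by linarith)
  have hl1 : r ≤ r1 / 3 := min_le_left _ _
  have hl2 : r ≤ r0 / 3 := min_le_right _ _
  obtain ⟨_, _, N, hN⟩ := B.exists_uniform (δ := r / 80) (by linarith)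
  refine ⟨N + 1, by omega, fun a b hP ha hb => ⟨hP, fun _ _ _ h => h.tail,
    fun _ _ _ h hi _ => h.of_le hi, ?_, by norm_num, by norm_num⟩⟩
  intro x m k hO hxk
  have hlen : b - a ≤ r / 80 := hN _ a b hP.lt hP.reg (Or.inl (by omega))
  obtain ⟨α', β', hx', hext'⟩ := hst m x (a + k - r) (b + k + r) hO
    ⟨by linarith [hxk.1], by linarith [hxk.2]⟩ (by linarith)
  obtain ⟨a0, b0, h3, h4, hx0, hp0⟩ := hext'.pullback_point hx' hxk (by linarith) (by linarith)
  refine ⟨a0, b0, hx0, hp0, ?_⟩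
  have := dst_of_space hcross hr hext' (η := 1 / 80) (fun i hi => ?_) hp0 h3 h4 (by linarith)
  · convert this using 2; norm_num
  · obtain ⟨d, rfl⟩ := Nat.exists_eq_add_of_le' hi.le
    obtain ⟨A1, C1, q1, q2⟩ := hext'.split
    rw [q1.length]
    exact hU d A1 C1 q2.lt q2.reg (Or.inr (by rw [q2.length]; linarith))

/-- Every interval contains an interval avoiding `Lam`. -/
lemma exists_hole {s t : ℝ} (hst : s < t) : ∃ u v, s ≤ u ∧ u < v ∧ v ≤ t ∧
    Disjoint (Ioo u v) B.Lam := by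
  classical
  obtain ⟨z, hz, hZ⟩ := B.exists_mem_Zset hst
  have hmin := Nat.find_spec hZ
  obtain ⟨i, hi⟩ : ∃ i, Nat.find hZ = i + 1 :=
    Nat.exists_eq_succ_of_ne_zero fun h0 => by rw [h0, dn_zero] at hmin; exact one_ne_zero hmin
  have hdi : B.dn i z ≠ 0 := Nat.find_min hZ (by omega)
  rw [hi, dn_succ'] at hmin
  obtain ⟨j, hj⟩ := (B.deriv_eq_zero_iff _).1 ((mul_eq_zero.1 hmin).resolve_right hdi)
  have hmap : Filter.map (B.F^[i]) (nhds z) = nhds (B.F^[i] z) :=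
    ((B.contDiff_iter i).contDiffAt.hasStrictDerivAt (by norm_num)).map_nhds_eq hdi
  have himg : B.F^[i] '' Ioo s t ∈ nhds (B.F^[i] z) := by
    rw [← hmap]
    exact image_mem_map (Ioo_mem_nhds hz.1 hz.2)
  have hcl : B.F^[i] z ∈ closure (Ioo (B.p + j) (B.q + j)) := by
    rw [closure_Ioo (by linarith [B.hpq])]
    have := B.hpq
    rcases hj with hj | hj <;> constructor <;> linarith
  obtain ⟨y, ⟨w, hw, rfl⟩, hy⟩ := mem_closure_iff_nhds.1 hcl _ himg
  have hopen : IsOpen (Ioo s t ∩ B.F^[i] ⁻¹' Ioo (B.p + j) (B.q + j)) :=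
    isOpen_Ioo.inter (isOpen_Ioo.preimage (B.continuous_iter i))
  obtain ⟨e, he, hball⟩ := Metric.isOpen_iff.1 hopen w ⟨hw, hy⟩
  rw [Real.ball_eq_Ioo] at hball
  refine ⟨w, w + e, hw.1.le, by linarith, ?_, ?_⟩
  · by_contra hc
    push Not at hc
    exact absurd (hball ⟨by linarith [hw.2], hc⟩).1.2 (lt_irrefl _)
  · rw [Set.disjoint_left]
    intro v hv hL
    have := (hball ⟨by linarith [hv.1], hv.2⟩).2
    exact hL i ⟨j, by linarith [this.1], by linarith [this.2]⟩

variable (B) in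
lemma exists_hole_piece (n : ℕ) (s0 s1 : ℝ) : ∃ η > 0, ∀ a b, B.Piece n a b → s0 ≤ a → b ≤ s1 →
    ∃ u v, a ≤ u ∧ v ≤ b ∧ η ≤ v - u ∧ Disjoint (Ioo u v) B.Lam := by
  classical
  set S := (B.finite_zeros n s0 s1).toFinset with hS
  have H : ∀ P : ℝ × ℝ, ∃ η > 0, P.1 < P.2 → ∃ u v, P.1 ≤ u ∧ v ≤ P.2 ∧ η ≤ v - u ∧
      Disjoint (Ioo u v) B.Lam := by
    rintro ⟨a, b⟩
    by_cases hab : a < b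
    · obtain ⟨u, v, h1, h2, h3, h4⟩ := B.exists_hole hab
      exact ⟨v - u, by linarith, fun _ => ⟨u, v, h1, h3, le_rfl, h4⟩⟩
    · exact ⟨1, one_pos, fun h => absurd h hab⟩
  choose η hη0 hη using H
  rcases (S ×ˢ S).eq_empty_or_nonempty with he | hne
  · refine ⟨1, one_pos, fun a b hP ha hb => ?_⟩
    have : (a, b) ∈ S ×ˢ S := by
      simp only [hS, Finset.mem_product, Set.Finite.mem_toFinset]
      exact ⟨⟨⟨ha, by linarith [hP.lt]⟩, hP.left⟩, ⟨by linarith [hP.lt], hb⟩, hP.right⟩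
    simp [he] at this
  · obtain ⟨P0, hP0, hmin⟩ := (S ×ˢ S).exists_min_image η hne
    refine ⟨η P0, hη0 _, fun a b hP ha hb => ?_⟩
    have : (a, b) ∈ S ×ˢ S := by
      simp only [hS, Finset.mem_product, Set.Finite.mem_toFinset]
      exact ⟨⟨⟨ha, by linarith [hP.lt]⟩, hP.left⟩, ⟨by linarith [hP.lt], hb⟩, hP.right⟩
    obtain ⟨u, v, h1, h2, h3, h4⟩ := hη (a, b) hP.lt
    exact ⟨u, v, h1, h2, (hmin _ this).trans h3, h4⟩

/-- A point whose orbit stays away from the decreasing lap is a porosity point. -/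
lemma porousAt_of_stay {ε x : ℝ} (hε : 0 < ε) (hx : ∀ m, B.Stay ε x m) (hz : x ∉ B.Zset) :
    PorousAt B.Lam x := by
  classical
  obtain ⟨n, hn, hR⟩ := B.exists_ret_stay hε
  have hcrit : ∀ z, deriv B.F z = 0 → B.dn n z = 0 := by
    intro z hz
    obtain ⟨d, rfl⟩ := Nat.exists_eq_add_of_le' hn
    rw [dn_add, dn_one, hz, mul_zero]
  have h0 := hcrit B.q B.deriv_q
  have h1 : B.dn n (B.p + 1) = 0 :=
    hcrit _ ((B.deriv_eq_zero_iff _).2 ⟨1, Or.inl (by push_cast; ring)⟩)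
  obtain ⟨A, hA⟩ := exists_vsum_bound hn h0 h1 hR
  obtain ⟨η, hη, hhole⟩ := B.exists_hole_piece n B.q (B.p + 1)
  set K := 1 / 40 + 1 / 160 * |A| with hK
  refine ⟨Real.exp (-K) * η, by positivity, fun τ hτ => ?_⟩
  obtain ⟨_, _, N, hN⟩ := B.exists_uniform (δ := τ / 2) (by linarith)
  obtain ⟨k, hk⟩ := hx N N le_rfl
  have hd : B.dn n (B.F^[N] x - k) ≠ 0 := by
    intro h
    rw [← B.dn_translate n _ k, sub_add_cancel] at h
    exact hz (iter_mem_Zset ⟨n, h⟩)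
  obtain ⟨a, b, hP, ha, hb, hy⟩ := exists_piece hn h0 h1
    (y := B.F^[N] x - k) ⟨by linarith [hk.1], by linarith [hk.2]⟩ hd
  obtain ⟨a0, b0, hx0, hp0, hD⟩ := (hR a b hP ha hb).ext x N k (hx N)
    ⟨by linarith [hy.1], by linarith [hy.2]⟩
  have hreg : B.Reg (N + n) (Ioo a0 b0) := by
    intro z hz
    rw [add_comm, dn_add]
    refine mul_ne_zero ?_ (hp0.reg z hz)
    have hm := hp0.mem_Ioo hz
    have := hP.reg (B.F^[N] z - k) ⟨by linarith [hm.1], by linarith [hm.2]⟩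
    rwa [← B.dn_translate n _ k, sub_add_cancel] at this
  have hcs : B.csum N a0 b0 ≤ |A| := by
    refine le_trans ?_ ((hA x N a0 b0 hx0 hreg fun i _ _ => hx i).trans (le_abs_self A))
    unfold csum vsum
    refine Finset.sum_le_sum_of_subset_of_nonneg (fun i hi => ?_) fun _ _ _ => abs_nonneg _
    rw [Finset.mem_filter]
    rw [Finset.mem_range] at hi ⊢
    obtain ⟨j, hj⟩ := hx i i le_rfl
    exact ⟨by omega, j, by linarith [hj.1], by linarith [hj.2]⟩
  have hD' : B.Dst N a0 b0 K := hD.mono le_rfl le_rfl (by rw [hK]; linarith)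
  obtain ⟨u, v, hu, hv, huv, hdis⟩ := hhole a b hP ha hb
  obtain ⟨u0, v0, i1, i2, hpu⟩ := hp0.pullback (A' := u + k) (C' := v + k) (by linarith) (by linarith)
    (by linarith)
  have hr := hD'.ratio le_rfl hp0.lt le_rfl i1 hpu.lt i2
  rw [hpu.length, hp0.length] at hr
  have hba : b - a ≤ 1 := by
    have := hP.reg.length_le_one hP.lt (i := 0) (by omega)
    simpa [abs_of_pos (sub_pos.2 hP.lt)] using this
  refine ⟨a0, b0, u0, v0, hx0, ?_, i1, i2, ?_, ?_⟩
  · linarith [hN N a0 b0 hp0.lt hp0.reg (Or.inl le_rfl)]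
  · rw [Real.exp_neg, mul_assoc, inv_mul_le_iff₀ (Real.exp_pos _)]
    have e1 : (b0 - a0) * η ≤ (b0 - a0) * (v + k - (u + k)) :=
      mul_le_mul_of_nonneg_left (by linarith) (by linarith [hp0.lt])
    have e2 : Real.exp K * (b + k - (a + k)) * (v0 - u0) ≤ Real.exp K * (v0 - u0) := by
      rw [mul_assoc]
      refine mul_le_mul_of_nonneg_left ?_ (Real.exp_pos _).le
      nlinarith [hpu.lt]
    linarith
  · rw [Set.disjoint_left] at hdis ⊢
    intro z hz hzL
    have hm := hpu.mem_Ioo hz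
    refine hdis (a := B.F^[N] z - k) ⟨by linarith [hm.1], by linarith [hm.2]⟩ fun i => ?_
    rw [iter_sub_int]
    rintro ⟨j, hj⟩
    refine iter_mem_Lam hzL N i ⟨j + k, ?_⟩
    push_cast
    exact ⟨by linarith [hj.1], by linarith [hj.2]⟩

lemma porousAt_of_mem_Lam {x : ℝ} (hx : x ∈ B.Lam) (hz : x ∉ B.Zset) : PorousAt B.Lam x := by
  obtain ⟨κ, hκ⟩ := exists_lap_seq hz hx
  by_cases h1 : ∀ ε > 0, ∃ i, B.F^[i] x - κ i < B.q + ε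
  · exact porousAt_of_records hκ h1
  by_cases h2 : ∀ ε > 0, ∃ i, B.p + 1 - ε < B.F^[i] x - κ i
  · exact porousAt_of_records' hκ h2
  push Not at h1 h2
  obtain ⟨ε1, hε1, h1⟩ := h1
  obtain ⟨ε2, hε2, h2⟩ := h2
  refine porousAt_of_stay (ε := min ε1 ε2) (lt_min hε1 hε2) (fun m i _ => ⟨κ i, ?_, ?_⟩) hz
  · linarith [h1 i, min_le_left ε1 ε2]
  · linarith [h2 i, min_le_right ε1 ε2]

variable (B) in
lemma countable_Zset : B.Zset.Countable := by
  have : B.Zset ⊆ ⋃ n : ℕ, ⋃ k : ℕ, {z ∈ Icc (-(k : ℝ)) k | B.dn n z = 0} := by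
    rintro z ⟨n, hn⟩
    obtain ⟨k, hk⟩ := exists_nat_ge |z|
    simp only [mem_iUnion]
    exact ⟨n, k, abs_le.1 hk, hn⟩
  exact (countable_iUnion fun n => countable_iUnion fun k => (B.finite_zeros n _ _).countable).mono this

variable (B) in
/-- Almost every orbit visits the decreasing lap. -/
theorem volume_Lam : volume B.Lam = 0 := by
  have h1 : volume (B.Lam \ B.Zset) = 0 :=
    volume_eq_zero_of_porousAt fun x hx => (porousAt_of_mem_Lam hx.1 hx.2).mono sdiff_subset
  have h2 : volume B.Zset = 0 := B.countable_Zset.measure_zero _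
  refine measure_mono_null (t := (B.Lam \ B.Zset) ∪ B.Zset) (fun x hx => ?_) (measure_union_null h1 h2)
  by_cases hz : x ∈ B.Zset
  · exact Or.inr hz
  · exact Or.inl ⟨hx, hz⟩

end Bim

lemma ContinuousOn.lt_iff_of_ne {g : ℝ → ℝ} {a b c x z : ℝ} (hg : ContinuousOn g (Icc a b))
    (hne : ∀ w ∈ Icc a b, g w ≠ c) (hx : x ∈ Icc a b) (hz : z ∈ Icc a b) : c < g x ↔ c < g z := by
  have key : ∀ {x z}, x ∈ Icc a b → z ∈ Icc a b → c < g x → c < g z := by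
    intro x z hx hz h
    by_contra hc
    push Not at hc
    obtain ⟨w, hw, e⟩ := isPreconnected_Icc.intermediate_value hz hx hg ⟨hc, h.le⟩
    exact hne w hw e
  exact ⟨key hx hz, key hz hx⟩

namespace Bim
variable {B : Bim}

variable (B) in
/-- The point `y` projects into the closed decreasing lap. -/
def InC (y : ℝ) : Prop := ∃ k : ℤ, y - k ∈ Icc B.p B.q

variable (B) in
/-- The interval `(a, b)` is a branch with time `m` of the first return to `(p, q)`. -/
structure Branch (m : ℕ) (k : ℤ) (a b : ℝ) : Prop where
  one_le : 1 ≤ m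
  pb : B.Pb m a b (B.p + k) (B.q + k)
  left : B.p < a
  right : b < B.q
  first : ∀ i, 1 ≤ i → i < m → ∀ z ∈ Icc a b, ¬ B.InC (B.F^[i] z)

lemma Pb.not_crit {m i : ℕ} {k j : ℤ} {a b z : ℝ} (h : B.Pb m a b (B.p + k) (B.q + k))
    (hz : z ∈ Icc a b) (hi : i < m) : B.F^[i] z - j ≠ B.p ∧ B.F^[i] z - j ≠ B.q := by
  have hm := h.mem_Icc hz
  obtain ⟨d, rfl⟩ := Nat.exists_eq_add_of_le' hi.le
  have hd : 1 ≤ d := by omega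
  rw [iter_add] at hm
  have e : B.F^[d] (B.F^[i] z - j) = B.F^[d] (B.F^[i] z) - j := B.iter_sub_int _ _ _
  constructor
  · intro h0
    rw [h0] at e
    refine B.avp d hd (k - j) ?_
    rw [e]; push_cast
    exact ⟨by linarith [hm.1], by linarith [hm.2, B.hdp.1]⟩
  · intro h0
    rw [h0] at e
    refine B.avq d hd (k - j) ?_
    rw [e]; push_cast
    exact ⟨by linarith [hm.1, B.hdq.2], by linarith [hm.2]⟩

lemma exists_branch {x : ℝ} (hx : x ∈ Ioo B.p B.q) (h : ∃ n, 1 ≤ n ∧ B.InI (B.F^[n] x)) :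
    ∃ m k a b, B.Branch m k a b ∧ x ∈ Ioo a b := by
  classical
  obtain ⟨hm1, k, hk⟩ := Nat.find_spec h
  set m := Nat.find h with hm
  have hmin : ∀ i, 1 ≤ i → i < m → ¬ B.InI (B.F^[i] x) := fun i h1 h2 h3 =>
    Nat.find_min h h2 ⟨h1, h3⟩
  obtain ⟨α, β, hxα, hext⟩ := B.exists_extension m x k hk
  obtain ⟨a, b, -, -, hxa, hp⟩ := hext.pullback_point hxα (A' := B.p + k) (C' := B.q + k)
    ⟨by linarith [hk.1], by linarith [hk.2]⟩ (by linarith [B.hdq.2]) (by linarith [B.hdp.1])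
  have hab := hp.lt
  have hxI := Ioo_subset_Icc_self hxa
  have side : ∀ i < m, ∀ j : ℤ, ∀ z ∈ Icc a b, (B.p < B.F^[i] x - j ↔ B.p < B.F^[i] z - j) ∧
      (B.q < B.F^[i] x - j ↔ B.q < B.F^[i] z - j) := by
    intro i hi j z hz
    have hc : ContinuousOn (fun t => B.F^[i] t - j) (Icc a b) :=
      ((B.continuous_iter i).sub continuous_const).continuousOn
    exact ⟨hc.lt_iff_of_ne (fun w hw => (hp.not_crit hw hi).1) hxI hz,
      hc.lt_iff_of_ne (fun w hw => (hp.not_crit hw hi).2) hxI hz⟩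
  have h0 : ∀ z ∈ Icc a b, z ∈ Ioo B.p B.q := by
    intro z hz
    have s := side 0 (by omega) 0 z hz
    have n := (hp.not_crit (i := 0) (j := 0) hz (by omega)).2
    simp only [Function.iterate_zero, id, Int.cast_zero, sub_zero] at s n
    exact ⟨s.1.1 hx.1, lt_of_le_of_ne (not_lt.1 fun hc => absurd (s.2.2 hc) (by linarith [hx.2])) n⟩
  refine ⟨m, k, a, b, ⟨hm1, hp, (h0 a ⟨le_rfl, hab.le⟩).1, (h0 b ⟨hab.le, le_rfl⟩).2, ?_⟩, hxa⟩
  rintro i hi1 hi z hz ⟨j, hj⟩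
  have s := side i hi j z hz
  have n := hp.not_crit (j := j) hz hi
  have n' := hp.not_crit (j := j) hxI hi
  refine hmin i hi1 hi ⟨j, s.1.2 (lt_of_le_of_ne hj.1 n.1.symm), lt_of_le_of_ne (not_lt.1 fun hc => ?_) n'.2⟩
  exact absurd (s.2.1 hc) (by linarith [hj.2])

lemma InI.inC {y : ℝ} (h : B.InI y) : B.InC y := by
  obtain ⟨k, hk⟩ := h
  exact ⟨k, Ioo_subset_Icc_self hk⟩

lemma Branch.inI {m : ℕ} {k : ℤ} {a b x : ℝ} (h : B.Branch m k a b) (hx : x ∈ Ioo a b) :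
    B.InI (B.F^[m] x) := by
  have := h.pb.mem_Ioo hx
  exact ⟨k, by linarith [this.1], by linarith [this.2]⟩

lemma Branch.inC {m : ℕ} {k : ℤ} {a b x : ℝ} (h : B.Branch m k a b) (hx : x ∈ Icc a b) :
    B.InC (B.F^[m] x) := by
  have := h.pb.mem_Icc hx
  exact ⟨k, by linarith [this.1], by linarith [this.2]⟩

lemma Branch.unique {m m' : ℕ} {k k' : ℤ} {a b a' b' x : ℝ} (h : B.Branch m k a b)
    (h' : B.Branch m' k' a' b') (hx : x ∈ Ioo a b) (hx' : x ∈ Ioo a' b') : a = a' ∧ b = b' := by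
  have hmm : m = m' := by
    rcases lt_trichotomy m m' with hlt | heq | hlt
    · exact absurd (h.inI hx).inC (h'.first m h.one_le hlt x (Ioo_subset_Icc_self hx'))
    · exact heq
    · exact absurd (h'.inI hx').inC (h.first m' h'.one_le hlt x (Ioo_subset_Icc_self hx))
  subst hmm
  have h1 := h.pb.mem_Ioo hx
  have h2 := h'.pb.mem_Ioo hx'
  have hpq := B.hqp
  have e1 : (k : ℝ) < k' + 1 := by linarith [h1.1, h2.2]
  have e2 : (k' : ℝ) < k + 1 := by linarith [h2.1, h1.2]
  have e : k = k' := by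
    have e1' : k < k' + 1 := by exact_mod_cast e1
    have e2' : k' < k + 1 := by exact_mod_cast e2
    omega
  subst e
  obtain ⟨n1, n2⟩ := h.pb.nest h'.pb hx hx' le_rfl le_rfl
  obtain ⟨n3, n4⟩ := h'.pb.nest h.pb hx' hx le_rfl le_rfl
  exact ⟨le_antisymm n1 n3, le_antisymm n4 n2⟩

variable (B) in
lemma isClosed_Lam : IsClosed B.Lam := by
  have : B.Lam = ⋂ i, ⋂ k : ℤ, (fun x => B.F^[i] x - k) ⁻¹' (Ioo B.p B.q)ᶜ := by
    ext x
    simp only [Lam, InI, mem_iInter, mem_preimage, mem_compl_iff, not_exists]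
    rfl
  rw [this]
  exact isClosed_iInter fun i => isClosed_iInter fun k =>
    isOpen_Ioo.isClosed_compl.preimage ((B.continuous_iter i).sub continuous_const)

variable (B) in
/-- Almost every point of the decreasing lap returns to it. -/
lemma volume_never_return : volume {x ∈ Ioo B.p B.q | B.F x ∈ B.Lam} = 0 := by
  set R := {x ∈ Ioo B.p B.q | B.F x ∈ B.Lam} with hR
  have hmeas : MeasurableSet R :=
    measurableSet_Ioo.inter ((B.isClosed_Lam.preimage (B.continuous_iter 1)).measurableSet)
  have h1 := lintegral_image_eq_lintegral_abs_deriv_mul (f := B.F) (f' := deriv B.F) hmeas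
    (fun x _ => ((B.hasDerivAt_iter 1 x).hasDerivWithinAt :))
    (((B.pb_lap_decr 0).injOn).mono fun x hx => by
      simp only [Int.cast_zero, add_zero]; exact Ioo_subset_Icc_self hx.1) (fun _ => 1)
  have h2 : volume (B.F '' R) = 0 := by
    refine measure_mono_null ?_ B.volume_Lam
    rintro _ ⟨x, hx, rfl⟩
    exact hx.2
  simp only [lintegral_const, Measure.restrict_apply MeasurableSet.univ, univ_inter, h2, mul_zero,
    mul_one] at h1
  have hm : Measurable fun x => ENNReal.ofReal |deriv B.F x| :=
    (measurable_deriv B.F).norm.ennreal_ofReal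
  have h3 := (lintegral_eq_zero_iff hm).1 h1.symm
  have h4 : ∀ᵐ x ∂(volume.restrict R), x ∉ R := by
    filter_upwards [h3] with x hx hxR
    simp only [Pi.zero_apply, ENNReal.ofReal_eq_zero] at hx
    have := B.decr x hxR.1
    exact absurd hx (not_le.2 (abs_pos.2 this.ne))
  rw [ae_iff] at h4
  simp only [not_not, ofPred_mem_eq] at h4
  rwa [Measure.restrict_apply_self] at h4

variable (B) in
/-- Distortion bound for all iterates of the first return map. -/
theorem exists_markov_bound : ∃ D > 0, ∀ m a b (k : ℤ), B.Pb m a b (B.p + k) (B.q + k) →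
    ∀ x ∈ Ioo a b, ∀ y ∈ Ioo a b, B.dn m x / B.dn m y ≤ 1 + D * |B.F^[m] y - B.F^[m] x| := by
  obtain ⟨K, hK, hlog⟩ := B.exists_log_distortion
  obtain ⟨K', hK', hdst⟩ := B.exists_dst
  obtain ⟨A, hA, hcs⟩ := B.exists_csum_bound
  have hpq : 0 < B.q - B.p := by linarith [B.hpq]
  set L := Real.exp (K' + K' * A) / (B.q - B.p) * A with hL
  have hL0 : 0 ≤ L := by positivity
  set M := K + K * L with hM
  have hM0 : 0 ≤ M := by positivity
  refine ⟨M * Real.exp M + 1, by positivity, fun m a b k hp x hx y hy => ?_⟩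
  set Δ := |B.F^[m] y - B.F^[m] x| with hΔ
  have hΔ0 : 0 ≤ Δ := abs_nonneg _
  have hΔ1 : Δ ≤ 1 := by
    have h1 := hp.mem_Ioo hx
    have h2 := hp.mem_Ioo hy
    rw [hΔ, abs_le]
    constructor <;> linarith [h1.1, h1.2, h2.1, h2.2, B.hqp]
  have hsum : B.csum m x y ≤ L * Δ := by
    have h1 : ∀ i ∈ Finset.range m, |B.F^[i] y - B.F^[i] x| ≤
        Real.exp (K' + K' * A) / (B.q - B.p) * Δ * |B.F^[i] b - B.F^[i] a| := by
      intro i hi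
      rw [Finset.mem_range] at hi
      obtain ⟨d, rfl⟩ := Nat.exists_eq_add_of_le' hi.le
      obtain ⟨A1, C1, p1, p2⟩ := hp.split
      have hD : B.Dst d A1 C1 (K' + K' * A) := (hdst d A1 C1 k p2).mono le_rfl le_rfl
        (by linarith [mul_le_mul_of_nonneg_left (hcs d A1 C1 k p2) hK'])
      have key : ∀ s ∈ Icc A1 C1, ∀ t ∈ Icc A1 C1, s < t →
          (t - s) ≤ Real.exp (K' + K' * A) / (B.q - B.p) * |B.F^[d] t - B.F^[d] s| * (C1 - A1) := by
        intro s hs t ht hst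
        have := hD.ratio hs.1 hst ht.2 le_rfl p2.lt le_rfl
        rw [p2.length] at this
        rw [div_mul_eq_mul_div, div_mul_eq_mul_div, le_div_iff₀ hpq]
        linarith
      have hx1 := Ioo_subset_Icc_self (p1.mem_Ioo hx)
      have hy1 := Ioo_subset_Icc_self (p1.mem_Ioo hy)
      rw [p1.length, hΔ, iter_add, iter_add]
      rcases lt_trichotomy (B.F^[i] x) (B.F^[i] y) with hlt | heq | hlt
      · rw [abs_of_pos (sub_pos.2 hlt)]
        exact key _ hx1 _ hy1 hlt
      · rw [heq, sub_self, abs_zero]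
        have := p1.lt'
        simp
      · rw [abs_sub_comm, abs_of_pos (sub_pos.2 hlt), abs_sub_comm (B.F^[d] _)]
        exact key _ hy1 _ hx1 hlt
    refine (Finset.sum_le_sum h1).trans ?_
    rw [← Finset.mul_sum]
    have h2 : ∑ i ∈ Finset.range m, |B.F^[i] b - B.F^[i] a| ≤ A := hcs m a b k hp
    calc _ ≤ Real.exp (K' + K' * A) / (B.q - B.p) * Δ * A :=
          mul_le_mul_of_nonneg_left h2 (by positivity)
      _ = L * Δ := by rw [hL]; ring
  have hlog' := hlog m a b k hp x hx y hy
  rw [abs_sub_comm] at hlog'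
  have hle : Real.log (B.dn m x) - Real.log (B.dn m y) ≤ M * Δ := by
    have := mul_le_mul_of_nonneg_left hsum hK
    rw [hM]; linarith
  have hpos : 0 < B.dn m x / B.dn m y := by
    rcases hp.reg.sign with h | h
    · exact div_pos (h x hx) (h y hy)
    · exact div_pos_of_neg_of_neg (h x hx) (h y hy)
  rw [← Real.log_div (hp.reg x hx) (hp.reg y hy)] at hle
  have h1 : B.dn m x / B.dn m y ≤ Real.exp (M * Δ) := (Real.log_le_iff_le_exp hpos).1 hle
  have h2 : Real.exp (M * Δ) ≤ 1 + M * Δ * Real.exp (M * Δ) := by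
    have := Real.add_one_le_exp (-(M * Δ))
    have e : Real.exp (-(M * Δ)) * Real.exp (M * Δ) = 1 := by rw [← Real.exp_add]; simp
    nlinarith [Real.exp_pos (M * Δ)]
  have h3 : Real.exp (M * Δ) ≤ Real.exp M := Real.exp_le_exp.2 (by nlinarith)
  have h4 : M * Δ * Real.exp (M * Δ) ≤ M * Δ * Real.exp M :=
    mul_le_mul_of_nonneg_left h3 (by positivity)
  nlinarith

end Bim

lemma UnitAddCircle.coe_eq_coe_iff {x y : ℝ} :
    (x : UnitAddCircle) = (y : UnitAddCircle) ↔ ∃ k : ℤ, y = x + k := by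
  rw [eq_comm, ← sub_eq_zero, ← AddCircle.coe_sub, AddCircle.coe_eq_zero_iff]
  constructor
  · rintro ⟨k, hk⟩
    exact ⟨k, by simp at hk; linarith⟩
  · rintro ⟨k, hk⟩
    exact ⟨k, by simp [hk]⟩

/-- On short arcs the projection to the circle contracts distances by a bounded factor. -/
lemma UnitAddCircle.mul_abs_sub_le_dist {δ s t : ℝ} (h : |s - t| ≤ 1 - δ) (hδ : 0 ≤ δ) :
    δ * |s - t| ≤ dist (s : UnitAddCircle) t := by
  rw [dist_eq_norm, ← AddCircle.coe_sub, UnitAddCircle.norm_eq]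
  set r := s - t
  by_cases h0 : round r = 0
  · rw [h0]; simp only [Int.cast_zero, sub_zero]
    exact mul_le_of_le_one_left (abs_nonneg r) (by linarith [abs_nonneg r])
  · have h2 : (1 : ℝ) ≤ |(round r : ℝ)| := by
      have := Int.one_le_abs h0
      exact_mod_cast this
    have h3 : |(round r : ℝ)| - |r| ≤ |r - round r| := by
      rw [abs_sub_comm r]; exact abs_sub_abs_le_abs_sub (round r : ℝ) r
    nlinarith [mul_le_of_le_one_right hδ (by linarith : |r| ≤ 1)]

namespace BimodData

variable (B : BimodData)

lemma f_iter (n : ℕ) (x : ℝ) : B.f^[n] (x : UnitAddCircle) = ((B.toBim.F^[n] x : ℝ) : UnitAddCircle) := by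
  induction n with
  | zero => rfl
  | succ n ih => rw [Function.iterate_succ_apply', ih, B.hf, Function.iterate_succ_apply']; rfl

lemma coe_mem_II {y : ℝ} : (y : UnitAddCircle) ∈ B.II ↔ B.toBim.InC y := by
  constructor
  · rintro ⟨x, hx, e⟩
    obtain ⟨k, rfl⟩ := UnitAddCircle.coe_eq_coe_iff.1 e
    exact ⟨k, by rw [add_sub_cancel_right]; exact hx⟩
  · rintro ⟨k, hk⟩
    exact ⟨y - k, hk, UnitAddCircle.coe_eq_coe_iff.2 ⟨k, by ring⟩⟩

lemma coe_mem_image_Ioo {y a b : ℝ} :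
    (y : UnitAddCircle) ∈ (fun x : ℝ => (x : UnitAddCircle)) '' Ioo a b ↔
      ∃ k : ℤ, y - k ∈ Ioo a b := by
  constructor
  · rintro ⟨x, hx, e⟩
    obtain ⟨k, rfl⟩ := UnitAddCircle.coe_eq_coe_iff.1 e
    exact ⟨k, by simpa using hx⟩
  · rintro ⟨k, hk⟩
    exact ⟨y - k, hk, UnitAddCircle.coe_eq_coe_iff.2 ⟨k, by ring⟩⟩

lemma isOpen_image_Ioo (a b : ℝ) : IsOpen ((fun x : ℝ => (x : UnitAddCircle)) '' Ioo a b) :=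
  QuotientAddGroup.isOpenMap_coe _ isOpen_Ioo

lemma interior_II : interior B.II =
    (fun x : ℝ => (x : UnitAddCircle)) '' Ioo B.toBim.p B.toBim.q := by
  have hqp := B.toBim.hqp
  have hpq := B.toBim.hpq
  refine Subset.antisymm ?_ (interior_maximal (image_mono Ioo_subset_Icc_self) (isOpen_image_Ioo _ _))
  intro z hz
  obtain ⟨x, hx, rfl⟩ := interior_subset hz
  have ho : IsOpen ((fun x : ℝ => (x : UnitAddCircle)) ⁻¹' interior B.II) :=
    isOpen_interior.preimage (AddCircle.continuous_mk' (1 : ℝ))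
  obtain ⟨ε, hε, hb⟩ := Metric.isOpen_iff.1 ho x hz
  have key : ∀ y, |y - x| < ε → B.toBim.InC y := fun y hy =>
    B.coe_mem_II.1 (interior_subset (hb (by simpa [Real.dist_eq] using hy)))
  set η := min (ε / 2) ((B.toBim.p + 1 - B.toBim.q) / 2) with hη
  have h0 : 0 < η := lt_min (by linarith) (by linarith)
  have h1 : η ≤ ε / 2 := min_le_left _ _
  have h2 : η ≤ (B.toBim.p + 1 - B.toBim.q) / 2 := min_le_right _ _
  have hx' : x ∈ Icc B.toBim.p B.toBim.q := hx
  refine ⟨x, ⟨lt_of_le_of_ne hx'.1 ?_, lt_of_le_of_ne hx'.2 ?_⟩, rfl⟩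
  · intro e
    obtain ⟨k, k1, k2⟩ := key (x - η) (by
      rw [sub_sub_cancel_left, abs_neg, abs_of_pos h0]; linarith)
    have e1 : k < 0 := by
      have : (k : ℝ) < 0 := by linarith
      exact_mod_cast this
    have e2 : -1 < k := by
      have : (-1 : ℝ) < k := by linarith
      exact_mod_cast this
    omega
  · intro e
    obtain ⟨k, k1, k2⟩ := key (x + η) (by
      rw [add_sub_cancel_left, abs_of_pos h0]; linarith)
    have e1 : 0 < k := by
      have : (0 : ℝ) < k := by linarith
      exact_mod_cast this
    have e2 : k < 1 := by
      have : (k : ℝ) < 1 := by linarith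
      exact_mod_cast this
    omega

lemma coe_mem_interior_II {y : ℝ} : (y : UnitAddCircle) ∈ interior B.II ↔ B.toBim.InI y := by
  rw [interior_II, coe_mem_image_Ioo]; rfl

/-- Two lifts in `(p, q)` of the same point of the circle agree. -/
lemma eq_of_coe_eq {x y : ℝ} (hx : x ∈ Ioo B.toBim.p B.toBim.q) (hy : y ∈ Ioo B.toBim.p B.toBim.q)
    (h : (x : UnitAddCircle) = (y : UnitAddCircle)) : x = y := by
  obtain ⟨k, rfl⟩ := UnitAddCircle.coe_eq_coe_iff.1 h
  have hqp := B.toBim.hqp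
  have e1 : k < 1 := by
    have : (k : ℝ) < 1 := by linarith [hx.1, hy.2]
    exact_mod_cast this
  have e2 : -1 < k := by
    have : (-1 : ℝ) < k := by linarith [hx.2, hy.1]
    exact_mod_cast this
  have : k = 0 := by omega
  simp [this]

/-- The derivative of the first entry map. -/
def entryDeriv (z : UnitAddCircle) : ℝ :=
  B.toBim.dn (B.N0 z) (Function.surjInv (QuotientAddGroup.mk_surjective) z)

lemma entryDeriv_coe (y : ℝ) : B.entryDeriv y = B.toBim.dn (B.N0 y) y := by
  unfold entryDeriv
  obtain ⟨k, hk⟩ := UnitAddCircle.coe_eq_coe_iff.1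
    (Function.surjInv_eq (QuotientAddGroup.mk_surjective) (y : UnitAddCircle))
  rw [← B.toBim.dn_translate _ _ k, ← hk]

end BimodData

namespace Bim.Branch

variable {B : BimodData} {m : ℕ} {k : ℤ} {a b x : ℝ}

lemma subset (h : B.toBim.Branch m k a b) : Icc a b ⊆ Ioo B.toBim.p B.toBim.q := fun _ hx =>
  ⟨h.left.trans_le hx.1, hx.2.trans_lt h.right⟩

lemma N0_eq (h : B.toBim.Branch m k a b) (hx : x ∈ Icc a b) : B.N0 x = m := by
  have hm : m ∈ B.returnSet x := ⟨h.one_le, by rw [B.f_iter, B.coe_mem_II]; exact h.inC hx⟩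
  refine le_antisymm (Nat.sInf_le hm) (le_csInf ⟨m, hm⟩ ?_)
  rintro i ⟨hi, hi'⟩
  by_contra hc
  rw [B.f_iter, B.coe_mem_II] at hi'
  exact h.first i hi (by omega) x hx hi'

lemma T0_eq (h : B.toBim.Branch m k a b) (hx : x ∈ Icc a b) :
    B.T0 x = ((B.toBim.F^[m] x : ℝ) : UnitAddCircle) := by
  rw [BimodData.T0, h.N0_eq hx, B.f_iter]

lemma entryDeriv_eq (h : B.toBim.Branch m k a b) (hx : x ∈ Icc a b) :
    B.entryDeriv x = B.toBim.dn m x := by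
  rw [B.entryDeriv_coe, h.N0_eq hx]

lemma end_not_mem (h : B.toBim.Branch m k a b) (hx : x = a ∨ x = b) :
    B.T0 x ∉ interior B.II := by
  have hx' : x ∈ Icc a b := by
    rcases hx with rfl | rfl
    · exact left_mem_Icc.2 h.pb.lt.le
    · exact right_mem_Icc.2 h.pb.lt.le
  rw [h.T0_eq hx', B.coe_mem_interior_II]
  rintro ⟨j, j1, j2⟩
  have hqp := B.toBim.hqp
  have hpq := B.toBim.hpq
  have e : B.toBim.F^[m] x = B.toBim.p + k ∨ B.toBim.F^[m] x = B.toBim.q + k := by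
    rcases hx with rfl | rfl
    · exact h.pb.left_mem
    · exact h.pb.right_mem
  rcases e with e | e <;> rw [e] at j1 j2
  · have e1 : j < k := by
      have : (j : ℝ) < k := by linarith
      exact_mod_cast this
    have e2 : k < j + 1 := by
      have : (k : ℝ) < j + 1 := by linarith
      exact_mod_cast this
    omega
  · have e1 : k < j := by
      have : (k : ℝ) < j := by linarith
      exact_mod_cast this
    have e2 : j < k + 1 := by
      have : (j : ℝ) < k + 1 := by linarith
      exact_mod_cast this
    omega

lemma bijOn (h : B.toBim.Branch m k a b) :
    BijOn B.T0 ((fun x : ℝ => (x : UnitAddCircle)) '' Ioo a b) (interior B.II) := by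
  refine ⟨?_, ?_, ?_⟩
  · rintro _ ⟨x, hx, rfl⟩
    simp only [h.T0_eq (Ioo_subset_Icc_self hx)]
    exact B.coe_mem_interior_II.2 (h.inI hx)
  · rintro _ ⟨x, hx, rfl⟩ _ ⟨y, hy, rfl⟩ e
    simp only [h.T0_eq (Ioo_subset_Icc_self hx), h.T0_eq (Ioo_subset_Icc_self hy)] at e
    have hx' := h.pb.mem_Ioo hx
    have hy' := h.pb.mem_Ioo hy
    have e' := B.eq_of_coe_eq (x := B.toBim.F^[m] x - k) (y := B.toBim.F^[m] y - k)
      ⟨by linarith [hx'.1], by linarith [hx'.2]⟩ ⟨by linarith [hy'.1], by linarith [hy'.2]⟩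
      (by simp only [AddCircle.coe_sub, e])
    have : x = y := h.pb.injOn (Ioo_subset_Icc_self hx) (Ioo_subset_Icc_self hy) (by linarith)
    rw [this]
  · intro z hz
    rw [B.interior_II] at hz
    obtain ⟨y, hy, rfl⟩ := hz
    obtain ⟨x, hx, e⟩ := h.pb.exists_preimage (y := y + k)
      ⟨by linarith [hy.1], by linarith [hy.2]⟩
    refine ⟨x, ⟨x, hx, rfl⟩, ?_⟩
    rw [h.T0_eq (Ioo_subset_Icc_self hx), e]
    exact (UnitAddCircle.coe_eq_coe_iff.2 ⟨k, rfl⟩).symm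

lemma hasCircleDerivAt (h : B.toBim.Branch m k a b) (hx : x ∈ Ioo a b) :
    HasCircleDerivAt B.T0 x (B.entryDeriv x) := by
  refine ⟨B.toBim.F^[m], x, rfl, ?_, ?_⟩
  · filter_upwards [Ioo_mem_nhds hx.1 hx.2] with y hy
    exact (h.T0_eq (Ioo_subset_Icc_self hy)).symm
  · rw [h.entryDeriv_eq (Ioo_subset_Icc_self hx)]
    exact B.toBim.hasDerivAt_iter m x

lemma entryDeriv_ne_zero (h : B.toBim.Branch m k a b) (hx : x ∈ Ioo a b) : B.entryDeriv x ≠ 0 := by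
  rw [h.entryDeriv_eq (Ioo_subset_Icc_self hx)]
  exact h.pb.reg x hx

lemma continuousAt_entryDeriv (h : B.toBim.Branch m k a b) (hx : x ∈ Ioo a b) :
    ContinuousAt B.entryDeriv x := by
  have hmap : Filter.map (fun x : ℝ => (x : UnitAddCircle)) (nhds x) = nhds (x : UnitAddCircle) :=
    (QuotientAddGroup.isOpenMap_coe).map_nhds_eq (AddCircle.continuous_mk' (1 : ℝ)).continuousAt
  rw [ContinuousAt, ← hmap, tendsto_map'_iff, h.entryDeriv_eq (Ioo_subset_Icc_self hx)]
  refine ((B.toBim.continuous_dn m).tendsto x).congr' ?_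
  filter_upwards [Ioo_mem_nhds hx.1 hx.2] with y hy
  exact (h.entryDeriv_eq (Ioo_subset_Icc_self hy)).symm

end Bim.Branch

namespace BimodData

variable (B : BimodData)

lemma exists_branch_of_Icc {u v : ℝ} (huv : u < v) (hs : Icc u v ⊆ Ioo B.toBim.p B.toBim.q)
    (hT : ∀ t ∈ Icc u v, B.T0 t ∈ interior B.II) :
    ∃ m k a b, B.toBim.Branch m k a b ∧ Icc u v ⊆ Ioo a b := by
  obtain ⟨t, ht, hL⟩ : ∃ t ∈ Icc u v, B.toBim.F t ∉ B.toBim.Lam := by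
    by_contra! hc
    have hsub : Icc u v ⊆ {x ∈ Ioo B.toBim.p B.toBim.q | B.toBim.F x ∈ B.toBim.Lam} :=
      fun t ht => ⟨hs ht, hc t ht⟩
    have := measure_mono_null hsub B.toBim.volume_never_return
    rw [Real.volume_Icc, ENNReal.ofReal_eq_zero] at this
    linarith
  simp only [Bim.Lam, mem_ofPred_eq, not_forall, not_not] at hL
  obtain ⟨i, hi⟩ := hL
  obtain ⟨m, k, a, b, hb, htb⟩ := Bim.exists_branch (hs ht) ⟨i + 1, by omega, hi⟩
  refine ⟨m, k, a, b, hb, fun w hw => ⟨?_, ?_⟩⟩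
  · by_contra! hc
    exact hb.end_not_mem (Or.inl rfl) (hT a ⟨hw.1.trans hc, htb.1.le.trans ht.2⟩)
  · by_contra! hc
    exact hb.end_not_mem (Or.inr rfl) (hT b ⟨ht.1.trans htb.2.le, hc.trans hw.2⟩)

/-- An interval whose first `n` images under the first return map stay in `𝕀` lies in a full
branch of the `n`-th iterate of the first return map. -/
lemma exists_full_branch (n : ℕ) : ∀ {u v : ℝ}, u < v → Icc u v ⊆ Ioo B.toBim.p B.toBim.q →
    (∀ t ∈ Icc u v, ∀ j, 1 ≤ j → j ≤ n → B.T0^[j] (t : UnitAddCircle) ∈ interior B.II) →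
    ∃ (m : ℕ) (a b : ℝ) (k : ℤ), B.toBim.p ≤ a ∧ b ≤ B.toBim.q ∧ Icc u v ⊆ Ioo a b ∧
      B.toBim.Pb m a b (B.toBim.p + k) (B.toBim.q + k) ∧ ∀ t ∈ Icc u v,
        ∏ i ∈ Finset.range n, B.entryDeriv (B.T0^[i] (t : UnitAddCircle)) = B.toBim.dn m t ∧
        B.T0^[n] (t : UnitAddCircle) = ((B.toBim.F^[m] t : ℝ) : UnitAddCircle) := by
  induction n with
  | zero =>
    intro u v _ hs _
    refine ⟨0, B.toBim.p, B.toBim.q, 0, le_rfl, le_rfl, hs, ?_, fun t _ => ⟨by simp, rfl⟩⟩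
    simpa using Bim.Pb.zero (B := B.toBim) B.toBim.hpq
  | succ n ih =>
    intro u v huv hs hT
    obtain ⟨m₁, k₁, a₁, b₁, hb, hsub⟩ := B.exists_branch_of_Icc huv hs
      fun t ht => hT t ht 1 le_rfl (by omega)
    have hsub' : ∀ {t}, t ∈ Icc u v → t ∈ Icc a₁ b₁ := fun ht => Ioo_subset_Icc_self (hsub ht)
    obtain ⟨A, C, hAC⟩ := (hb.pb.reg.subset (Ioo_subset_Icc_self.trans hsub)).exists_pb huv
    have himg : ∀ s ∈ Icc (A - k₁) (C - k₁), ∃ t ∈ Icc u v, s = B.toBim.F^[m₁] t - k₁ := by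
      intro s hs
      have : s + k₁ ∈ B.toBim.F^[m₁] '' Icc u v := by
        rw [hAC.image_Icc]; exact ⟨by linarith [hs.1], by linarith [hs.2]⟩
      obtain ⟨t, ht, e⟩ := this
      exact ⟨t, ht, by linarith⟩
    have hcoe : ∀ t ∈ Icc u v,
        ((B.toBim.F^[m₁] t - k₁ : ℝ) : UnitAddCircle) = B.T0 (t : UnitAddCircle) := by
      intro t ht
      rw [hb.T0_eq (hsub' ht)]
      exact UnitAddCircle.coe_eq_coe_iff.2 ⟨k₁, by ring⟩
    obtain ⟨m, a, b, k, hpa, hbq, hI, hpb, hprod⟩ := ih (u := A - k₁) (v := C - k₁)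
      (by linarith [hAC.lt']) (by
        intro s hs
        obtain ⟨t, ht, rfl⟩ := himg s hs
        have := hb.pb.mem_Ioo (hsub ht)
        exact ⟨by linarith [this.1], by linarith [this.2]⟩) (by
        intro s hs j _ hj
        obtain ⟨t, ht, rfl⟩ := himg s hs
        rw [hcoe t ht, ← Function.iterate_succ_apply]
        exact hT t ht (j + 1) (by omega) (by omega))
    have hpb' := hpb.translate k₁
    obtain ⟨a', b', ha', hb', hpull⟩ := hb.pb.pullback (A' := a + k₁) (C' := b + k₁)
      (by linarith) (by linarith [hpb.lt]) (by linarith)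
    have hmem : ∀ t ∈ Icc u v, B.toBim.F^[m₁] t - k₁ ∈ Icc (A - k₁) (C - k₁) := by
      intro t ht
      have := hAC.mem_Icc ht
      exact ⟨by linarith [this.1], by linarith [this.2]⟩
    refine ⟨m + m₁, a', b', k + k₁, hb.left.le.trans ha', hb'.trans hb.right.le, ?_, ?_, ?_⟩
    · intro t ht
      have := hI (hmem t ht)
      exact hb.pb.mem_of_image ha' hb' hpull (hsub' ht)
        ⟨by linarith [this.1], by linarith [this.2]⟩
    · push_cast
      rw [← add_assoc, ← add_assoc]
      exact hpull.comp hpb'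
    · intro t ht
      obtain ⟨e1, e2⟩ := hprod _ (hmem t ht)
      rw [hcoe t ht] at e1 e2
      constructor
      · rw [Finset.prod_range_succ']
        simp only [Function.iterate_succ_apply, Function.iterate_zero, id_eq]
        rw [e1, hb.entryDeriv_eq (hsub' ht), B.toBim.dn_add, ← B.toBim.dn_translate m _ k₁,
          sub_add_cancel]
      · rw [Function.iterate_succ_apply, e2, B.toBim.iter_sub_int, B.toBim.iter_add]
        exact UnitAddCircle.coe_eq_coe_iff.2 ⟨k₁, by ring⟩

/-- The lift to `(p, q)` of a connected subset of `𝕀` is an interval. -/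
lemma ordConnected_lift {J : Set UnitAddCircle} (hJ : IsPreconnected J)
    (hJU : J ⊆ interior B.II) :
    OrdConnected {t ∈ Ioo B.toBim.p B.toBim.q | (t : UnitAddCircle) ∈ J} := by
  have hqp := B.toBim.hqp
  let e := AddCircle.openPartialHomeomorphCoe (1 : ℝ) B.toBim.p
  have hsrc : ∀ t ∈ Ioo B.toBim.p B.toBim.q, t ∈ e.source := fun t ht =>
    ⟨ht.1, ht.2.trans hqp⟩
  have hlift : ∀ z ∈ J, ∃ t ∈ Ioo B.toBim.p B.toBim.q, (t : UnitAddCircle) = z := by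
    intro z hz
    have := hJU hz
    rw [B.interior_II] at this
    exact this
  have him : {t ∈ Ioo B.toBim.p B.toBim.q | (t : UnitAddCircle) ∈ J} = e.symm '' J := by
    ext t
    constructor
    · rintro ⟨ht, htJ⟩
      exact ⟨t, htJ, e.left_inv (hsrc t ht)⟩
    · rintro ⟨z, hz, rfl⟩
      obtain ⟨t, ht, rfl⟩ := hlift z hz
      have : e.symm (t : UnitAddCircle) = t := e.left_inv (hsrc t ht)
      rw [this]
      exact ⟨ht, hz⟩
  rw [him]
  refine (hJ.image _ (e.continuousOn_symm.mono ?_)).ordConnected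
  intro z hz
  obtain ⟨t, ht, rfl⟩ := hlift z hz
  exact e.map_source (hsrc t ht)

/-- The partition of `𝕀` into the branches of the first return map. -/
def branches : Set (Set UnitAddCircle) :=
  {I | ∃ m k a b, B.toBim.Branch m k a b ∧ I = (fun x : ℝ => (x : UnitAddCircle)) '' Ioo a b}

variable {B} in
lemma isOpen_of_mem_branches {I : Set UnitAddCircle} (hI : I ∈ B.branches) : IsOpen I := by
  obtain ⟨m, k, a, b, -, rfl⟩ := hI
  exact isOpen_image_Ioo a b

variable {B} in
lemma subset_of_mem_branches {I : Set UnitAddCircle} (hI : I ∈ B.branches) :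
    I ⊆ interior B.II := by
  obtain ⟨m, k, a, b, hb, rfl⟩ := hI
  rw [B.interior_II]
  exact image_mono (Ioo_subset_Icc_self.trans hb.subset)

lemma pairwise_disjoint_branches : B.branches.Pairwise Disjoint := by
  rintro _ ⟨m, k, a, b, hb, rfl⟩ _ ⟨m', k', a', b', hb', rfl⟩ hne
  rw [Set.disjoint_left]
  rintro _ ⟨x, hx, rfl⟩ ⟨y, hy, e⟩
  have hxy : y = x := B.eq_of_coe_eq (hb'.subset (Ioo_subset_Icc_self hy))
    (hb.subset (Ioo_subset_Icc_self hx)) e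
  subst hxy
  obtain ⟨rfl, rfl⟩ := hb.unique hb' hx hy
  exact hne rfl

lemma countable_branches : B.branches.Countable := by
  refine Set.PairwiseDisjoint.countable_of_isOpen (s := id) B.pairwise_disjoint_branches
    (fun I hI => isOpen_of_mem_branches hI) ?_
  rintro _ ⟨m, k, a, b, hb, rfl⟩
  exact (nonempty_Ioo.2 hb.pb.lt).image _

lemma volume_diff_branches : volume (interior B.II \ ⋃₀ B.branches) = 0 := by
  have hm : MeasurableSet (interior B.II \ ⋃₀ B.branches) :=
    isOpen_interior.measurableSet.diff
      (isOpen_sUnion fun I hI => isOpen_of_mem_branches hI).measurableSet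
  rw [← (UnitAddCircle.measurePreserving_mk B.toBim.p).measure_preimage hm.nullMeasurableSet,
    Measure.restrict_apply (AddCircle.measurable_mk' hm)]
  refine measure_mono_null ?_ B.toBim.volume_never_return
  rintro x ⟨⟨hxU, hxN⟩, hx⟩
  have hxI : x ∈ Ioo B.toBim.p B.toBim.q := by
    obtain ⟨k, k1, k2⟩ := B.coe_mem_interior_II.1 hxU
    have hqp := B.toBim.hqp
    have e1 : k < 1 := by
      have : (k : ℝ) < 1 := by linarith [hx.2]
      exact_mod_cast this
    have e2 : -1 < k := by
      have : (-1 : ℝ) < k := by linarith [hx.1]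
      exact_mod_cast this
    have : k = 0 := by omega
    subst this
    exact ⟨by simpa using k1, by simpa using k2⟩
  refine ⟨hxI, fun i hi => hxN ?_⟩
  obtain ⟨m, k, a, b, hb, hxb⟩ := Bim.exists_branch hxI ⟨i + 1, by omega, hi⟩
  exact ⟨_, ⟨m, k, a, b, hb, rfl⟩, x, hxb, rfl⟩

/-- Bounded distortion along chains of intervals following the partition. -/
lemma exists_distortion_bound : ∃ D₀ > (0 : ℝ), ∀ n : ℕ, ∀ J : Set UnitAddCircle,
    IsPreconnected J → J ⊆ interior B.II →
    (∀ j, 1 ≤ j → j ≤ n → ∃ I ∈ B.branches, B.T0^[j] '' J ⊆ I) →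
    ∀ x ∈ J, ∀ y ∈ J,
      (∏ k ∈ Finset.range n, B.entryDeriv (B.T0^[k] x)) /
        (∏ k ∈ Finset.range n, B.entryDeriv (B.T0^[k] y))
          ≤ 1 + D₀ * dist (B.T0^[n] y) (B.T0^[n] x) := by
  obtain ⟨D, hD, hbound⟩ := B.toBim.exists_markov_bound
  have hqp := B.toBim.hqp
  have hpq := B.toBim.hpq
  set δ := 1 - (B.toBim.q - B.toBim.p) with hδ
  have hδ0 : 0 < δ := by linarith
  refine ⟨D / δ, div_pos hD hδ0, fun n J hJ hJU hchain x hx y hy => ?_⟩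
  rcases eq_or_ne x y with rfl | hne
  · rw [dist_self, mul_zero, add_zero]
    exact div_self_le_one _
  have hx' := hJU hx
  have hy' := hJU hy
  rw [B.interior_II] at hx' hy'
  obtain ⟨s, hs, rfl⟩ := hx'
  obtain ⟨t, ht, rfl⟩ := hy'
  have hst : s ≠ t := fun e => hne (by rw [e])
  have hsub := (B.ordConnected_lift hJ hJU).uIcc_subset ⟨hs, hx⟩ ⟨ht, hy⟩
  obtain ⟨m, a, b, k, -, -, hI, hpb, hprod⟩ := B.exists_full_branch n (u := s ⊓ t) (v := s ⊔ t)
    (inf_lt_sup.2 hst) (fun w hw => (hsub hw).1) (by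
      intro w hw j h1 h2
      obtain ⟨I, hIN, hIJ⟩ := hchain j h1 h2
      exact subset_of_mem_branches hIN (hIJ ⟨_, (hsub hw).2, rfl⟩))
  have hs1 : s ∈ Icc (s ⊓ t) (s ⊔ t) := ⟨inf_le_left, le_sup_left⟩
  have ht1 : t ∈ Icc (s ⊓ t) (s ⊔ t) := ⟨inf_le_right, le_sup_right⟩
  obtain ⟨e1, e2⟩ := hprod s hs1
  obtain ⟨e3, e4⟩ := hprod t ht1
  rw [e1, e2, e3, e4]
  refine (hbound m a b k hpb s (hI hs1) t (hI ht1)).trans ?_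
  have h1 := hpb.mem_Ioo (hI hs1)
  have h2 := hpb.mem_Ioo (hI ht1)
  have h3 := UnitAddCircle.mul_abs_sub_le_dist (δ := δ) (s := B.toBim.F^[m] t)
    (t := B.toBim.F^[m] s) (by
      rw [abs_le]; constructor <;> linarith [h1.1, h1.2, h2.1, h2.2]) hδ0.le
  have h4 : D * |B.toBim.F^[m] t - B.toBim.F^[m] s| =
      D / δ * (δ * |B.toBim.F^[m] t - B.toBim.F^[m] s|) := by
    field_simp
  rw [h4]
  gcongr

end BimodData

/-- **Proposition (the first return map is Markov).** For every `f ∈ Bimod`, the first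
return map `T⁰` to `𝕀` is a Markov map of `Int(𝕀)`. -/
theorem firstReturn_isMarkov (B : BimodData) :
    IsMarkovMap B.T0 (interior B.II) := by
  refine ⟨B.branches, B.entryDeriv, B.countable_branches, ?_, B.pairwise_disjoint_branches,
    B.volume_diff_branches, ?_, B.exists_distortion_bound⟩
  · intro I hI
    refine ⟨?_, BimodData.subset_of_mem_branches hI⟩
    obtain ⟨m, k, a, b, -, rfl⟩ := hI
    exact isPreconnected_Ioo.image _ (AddCircle.continuous_mk' (1 : ℝ)).continuousOn
  · intro I hI
    rw [(BimodData.isOpen_of_mem_branches hI).interior_eq]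
    obtain ⟨m, k, a, b, hb, rfl⟩ := hI
    refine ⟨hb.bijOn, ?_⟩
    rintro _ ⟨x, hx, rfl⟩
    exact ⟨hb.hasCircleDerivAt hx, hb.entryDeriv_ne_zero hx,
      (hb.continuousAt_entryDeriv hx).continuousWithinAt⟩
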